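/- Let d ≥ 1, s = 1/2, α > 0, and let f : [−1,1] → ℝ be C^{1,α} with C^{1,α} norm bounded by M₀, where M₀ ≥ 2. Let u be a stable solution of (−Δ)^{1/2} u = f(u) in ℝ^d with |u| ≤ 1. Then there is a constant C = C(d,α), independent of f, such that for every x₀ ∈ ℝ^d and every R ≥ 1: ∫_{B_R(x₀)} |∇u(x)| dx ≤ C · R^{d−1} · log(M₀ R) and J^{1/2}(u, B_R(x₀)) ≤ C · R^{d−1} · (log(M₀ R))². -/

import Mathlib

open MeasureTheory Metric Set
open scoped ENNReal NNReal

/-- The fractional `s`-energy `J^s(u,Ω)` of `u : ℝ^d → ℝ` on an open set `Ω`: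
`J^s(u,Ω) = ∬_{(ℝ^d×ℝ^d)∖(Ωᶜ×Ωᶜ)} |u(x)−u(y)|²/|x−y|^{d+2s} dy dx`, valued in `[0,∞]`. -/
noncomputable def Js (d : ℕ) (s : ℝ) (u : EuclideanSpace ℝ (Fin d) → ℝ)
    (Ω : Set (EuclideanSpace ℝ (Fin d))) : ℝ≥0∞ :=
  ∫⁻ p : EuclideanSpace ℝ (Fin d) × EuclideanSpace ℝ (Fin d) in (Ωᶜ ×ˢ Ωᶜ)ᶜ,
    ENNReal.ofReal ((u p.1 - u p.2)^2 / ‖p.1 - p.2‖ ^ ((d : ℝ) + 2*s))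

/-- The normalizing constant `C(d,s) = 2^{2s} Γ(d/2+s) / (π^{d/2} |Γ(−s)|)` of the fractional
Laplacian, which normalizes its Fourier symbol to `|ξ|^{2s}`. -/
noncomputable def fracC (d : ℕ) (s : ℝ) : ℝ :=
  2 ^ (2*s) * Real.Gamma ((d : ℝ)/2 + s) / (Real.pi ^ ((d : ℝ)/2) * |Real.Gamma (-s)|)

/-- `f : [−1,1] → ℝ` is `C^{1,α}`: it has derivative `f'` on `[−1,1]` and `f'` is
`α`-Hölder continuous on `[−1,1]`. -/
def IsC1Alpha (f f' : ℝ → ℝ) (α : ℝ) : Prop :=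
  (∀ x ∈ Set.Icc (-1 : ℝ) 1, HasDerivAt f (f' x) x) ∧
  ∃ Cα : ℝ, 0 ≤ Cα ∧ ∀ x ∈ Set.Icc (-1 : ℝ) 1, ∀ y ∈ Set.Icc (-1 : ℝ) 1,
    |f' x - f' y| ≤ Cα * |x - y| ^ α

/-- `u ∈ C²(ℝ^d)` with `|u| ≤ 1` is a stable solution of `(−Δ)^s u = f(u)` in `ℝ^d`:
the equation `(C(d,s)/2)∫ (2u(x)−u(x+y)−u(x−y))/|y|^{d+2s} dy = f(u(x))` holds pointwise and
for every `η ∈ C_c^∞(ℝ^d)` one has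
`(C(d,s)/2) ∬ |η(x)−η(y)|²/|x−y|^{d+2s} dx dy ≥ ∫ f'(u(x)) η(x)² dx`. -/
def IsStableSolution (d : ℕ) (s : ℝ) (f f' : ℝ → ℝ)
    (u : EuclideanSpace ℝ (Fin d) → ℝ) : Prop :=
  ContDiff ℝ 2 u ∧ (∀ x, |u x| ≤ 1) ∧
  (∀ x : EuclideanSpace ℝ (Fin d),
    fracC d s / 2 * ∫ y : EuclideanSpace ℝ (Fin d),
      (2 * u x - u (x + y) - u (x - y)) / ‖y‖ ^ ((d : ℝ) + 2*s) = f (u x)) ∧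
  (∀ η : EuclideanSpace ℝ (Fin d) → ℝ, ContDiff ℝ (⊤ : ℕ∞) η → HasCompactSupport η →
    ∫ x : EuclideanSpace ℝ (Fin d), f' (u x) * (η x)^2 ≤
      fracC d s / 2 * ∫ x : EuclideanSpace ℝ (Fin d), ∫ y : EuclideanSpace ℝ (Fin d),
        (η x - η y)^2 / ‖x - y‖ ^ ((d : ℝ) + 2*s))

abbrev EE (d : ℕ) := EuclideanSpace ℝ (Fin d)

noncomputable def kap (d : ℕ) (h : EE d) : ℝ := (‖h‖ ^ (d+1))⁻¹

noncomputable def kmu (d : ℕ) : Measure (EE d) :=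
  volume.withDensity (fun h => ENNReal.ofReal (kap d h))

noncomputable def cdd (d : ℕ) : ℝ := d * volume.real (ball (0 : EE d) 1)

lemma cdd_nonneg (d : ℕ) : 0 ≤ cdd d := by unfold cdd; positivity

lemma kap_nonneg (d : ℕ) (h : EE d) : 0 ≤ kap d h := by unfold kap; positivity

@[fun_prop]
lemma kap_meas (d : ℕ) : Measurable (kap d) := by unfold kap; fun_prop

lemma kap_neg (d : ℕ) (h : EE d) : kap d (-h) = kap d h := by simp [kap]

instance (d : ℕ) : SFinite (kmu d) := by unfold kmu; infer_instance

lemma lintegral_kmu (d : ℕ) (g : EE d → ℝ≥0∞) :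
    ∫⁻ h, g h ∂(kmu d) = ∫⁻ h, ENNReal.ofReal (kap d h) * g h := by
  unfold kmu
  rw [lintegral_withDensity_eq_lintegral_mul_non_measurable]
  · rfl
  · fun_prop
  · simp

lemma setLintegral_kmu (d : ℕ) (g : EE d → ℝ≥0∞) {s : Set (EE d)} (hs : MeasurableSet s) :
    ∫⁻ h in s, g h ∂(kmu d) = ∫⁻ h in s, ENNReal.ofReal (kap d h) * g h := by
  rw [← lintegral_indicator hs, lintegral_kmu, ← lintegral_indicator hs]
  congr 1; ext h
  by_cases hh : h ∈ s <;> simp [hh]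

lemma integral_kmu (d : ℕ) (g : EE d → ℝ) :
    ∫ h, g h ∂(kmu d) = ∫ h, kap d h * g h := by
  unfold kmu
  rw [integral_withDensity_eq_integral_toReal_smul (by fun_prop) (by simp)]
  simp [ENNReal.toReal_ofReal (kap_nonneg d _)]

lemma integrable_kmu (d : ℕ) (g : EE d → ℝ) :
    Integrable g (kmu d) ↔ Integrable (fun h => kap d h * g h) := by
  unfold kmu
  rw [integrable_withDensity_iff_integrable_smul' (by fun_prop) (by simp)]
  simp [ENNReal.toReal_ofReal (kap_nonneg d _)]

lemma kmu_ac (d : ℕ) : kmu d ≪ volume := withDensity_absolutelyContinuous _ _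

/-- the measure kmu is invariant under negation -/
lemma kmu_neg (d : ℕ) : MeasurePreserving (fun h : EE d => -h) (kmu d) (kmu d) := by
  refine ⟨measurable_neg, ?_⟩
  ext s hs
  rw [Measure.map_apply measurable_neg hs, kmu, withDensity_apply _ (measurable_neg hs),
    withDensity_apply _ hs, ← lintegral_indicator (measurable_neg hs), ← lintegral_indicator hs,
    ← lintegral_neg_eq_self]
  congr 1; ext h
  by_cases hh : h ∈ s <;> simp [hh, kap_neg]

lemma radial_kmu {d : ℕ} (hd : 1 ≤ d) (g : ℝ → ℝ)
    (hg : IntegrableOn (fun y => g y / y^2) (Ioi 0)) :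
    Integrable (fun h => g ‖h‖) (kmu d) ∧
      ∫ h, g ‖h‖ ∂(kmu d) = cdd d * ∫ y in Ioi (0:ℝ), g y / y^2 := by
  have : Nontrivial (EE d) := by
    have : Nonempty (Fin d) := ⟨⟨0, hd⟩⟩
    infer_instance
  have key : ∀ y ∈ Ioi (0:ℝ), g y / y^2 = y ^ (d-1) • ((y^(d+1))⁻¹ * g y) := by
    intro y hy
    have hy' : (0:ℝ) < y := hy
    obtain ⟨e, rfl⟩ : ∃ e, d = e+1 := ⟨d-1, by omega⟩
    simp only [Nat.add_sub_cancel, smul_eq_mul]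
    field_simp
    ring
  have hfin : Module.finrank ℝ (EE d) = d := by simp
  constructor
  · rw [integrable_kmu]
    have := (integrable_fun_norm_addHaar (volume : Measure (EE d))
      (f := fun y => (y^(d+1))⁻¹ * g y)).2 (by
        rw [hfin]
        exact hg.congr_fun key measurableSet_Ioi)
    simpa [kap] using this
  · rw [integral_kmu]
    have := integral_fun_norm_addHaar (volume : Measure (EE d))
      (f := fun y => (y^(d+1))⁻¹ * g y)
    simp only [kap]
    rw [this, hfin, setIntegral_congr_fun measurableSet_Ioi key]
    simp [cdd, mul_assoc]

lemma rpow_int_near (ε : ℝ) (hε : 0 < ε) :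
    IntegrableOn (fun y : ℝ => y ^ (-(3/4):ℝ)) (Ioo 0 ε) ∧
    ∫ y in Ioo 0 ε, y ^ (-(3/4):ℝ) = 4 * ε ^ (1/4:ℝ) := by
  have h1 := intervalIntegral.intervalIntegrable_rpow' (a := 0) (b := ε) (r := -(3/4)) (by norm_num)
  have h2 := integral_rpow (a := 0) (b := ε) (r := -(3/4)) (by left; norm_num)
  rw [intervalIntegrable_iff_integrableOn_Ioo_of_le hε.le] at h1
  refine ⟨h1, ?_⟩
  rw [intervalIntegral.integral_of_le hε.le, integral_Ioc_eq_integral_Ioo] at h2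
  rw [h2]
  have : (-(3/4):ℝ)+1 = 1/4 := by norm_num
  rw [this, Real.zero_rpow (by norm_num)]
  ring

lemma pow54 {y : ℝ} (hy : 0 < y) : y ^ (5/4:ℝ) / y^2 = y ^ (-(3/4):ℝ) := by
  rw [← Real.rpow_natCast, ← Real.rpow_sub hy]; norm_num

/-- near integral -/
lemma I_near {d : ℕ} (hd : 1 ≤ d) {ε : ℝ} (hε : 0 < ε) :
    ∫⁻ h in ball (0:EE d) ε, ENNReal.ofReal (‖h‖ ^ (5/4:ℝ)) ∂(kmu d)
      ≤ ENNReal.ofReal (cdd d * (4 * ε ^ (1/4:ℝ))) := by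
  set g : ℝ → ℝ := (Iio ε).indicator (fun y => y ^ (5/4:ℝ)) with hgdef
  have e1 : ∀ y ∈ Ioi (0:ℝ), (Ioo 0 ε).indicator (fun y : ℝ => y ^ (-(3/4):ℝ)) y = g y / y^2 := by
    intro y hy
    have hy' : (0:ℝ) < y := hy
    by_cases hyε : y < ε
    · simp [g, hyε, hy', pow54 hy']
    · simp [g, hyε]
  have hi : IntegrableOn (fun y => g y / y^2) (Ioi 0) := by
    refine IntegrableOn.congr_fun ?_ e1 measurableSet_Ioi
    exact ((rpow_int_near ε hε).1.integrable_indicator measurableSet_Ioo).integrableOn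
  obtain ⟨r1, r2⟩ := radial_kmu hd g hi
  have r3 : ∫ y in Ioi (0:ℝ), g y / y^2 = 4 * ε ^ (1/4:ℝ) := by
    rw [← setIntegral_congr_fun measurableSet_Ioi e1, setIntegral_indicator measurableSet_Ioo,
      inter_eq_right.2 Ioo_subset_Ioi_self, (rpow_int_near ε hε).2]
  rw [r3] at r2
  rw [← r2, ofReal_integral_eq_lintegral_ofReal r1, ← lintegral_indicator measurableSet_ball]
  · refine lintegral_mono fun h => ?_
    by_cases hh : ‖h‖ < ε <;> simp [g, hh]
  · refine Filter.Eventually.of_forall fun h => ?_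
    simp only [g, indicator]
    split_ifs
    · positivity
    · simp

lemma I_mid {d : ℕ} (hd : 1 ≤ d) {ε : ℝ} (hε : 0 < ε) (hε1 : ε ≤ 1) :
    ∫⁻ h in {h : EE d | ε ≤ ‖h‖ ∧ ‖h‖ < 1}, ENNReal.ofReal ‖h‖ ∂(kmu d)
      ≤ ENNReal.ofReal (cdd d * Real.log (1/ε)) := by
  set g : ℝ → ℝ := (Ico ε 1).indicator (fun y => y) with hgdef
  have e1 : ∀ y ∈ Ioi (0:ℝ), (Ico ε 1).indicator (fun y : ℝ => 1/y) y = g y / y^2 := by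
    intro y hy
    have hy' : (0:ℝ) < y := hy
    by_cases hyε : y ∈ Ico ε 1
    · simp only [g, hyε, indicator_of_mem]; field_simp
    · simp [g, hyε]
  have hio : IntegrableOn (fun y : ℝ => 1/y) (Ico ε 1) := by
    refine (ContinuousOn.integrableOn_Icc (a := ε) (b := 1) ?_).mono_set Ico_subset_Icc_self
    intro y hy
    have : y ≠ 0 := by linarith [hy.1]
    exact ContinuousAt.continuousWithinAt (by fun_prop (disch := exact this))
  have hi : IntegrableOn (fun y => g y / y^2) (Ioi 0) := by
    refine IntegrableOn.congr_fun ?_ e1 measurableSet_Ioi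
    exact (hio.integrable_indicator measurableSet_Ico).integrableOn
  obtain ⟨r1, r2⟩ := radial_kmu hd g hi
  have r3 : ∫ y in Ioi (0:ℝ), g y / y^2 = Real.log (1/ε) := by
    rw [← setIntegral_congr_fun measurableSet_Ioi e1, setIntegral_indicator measurableSet_Ico,
      inter_eq_right.2, integral_Ico_eq_integral_Ioc, ← intervalIntegral.integral_of_le hε1,
      integral_one_div_of_pos hε one_pos]
    intro y hy; exact lt_of_lt_of_le hε hy.1
  rw [r3] at r2
  have ms : MeasurableSet {h : EE d | ε ≤ ‖h‖ ∧ ‖h‖ < 1} :=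
    (measurableSet_le measurable_const measurable_norm).inter
      (measurableSet_lt measurable_norm measurable_const)
  rw [← r2, ofReal_integral_eq_lintegral_ofReal r1, ← lintegral_indicator ms]
  · refine lintegral_mono fun h => ?_
    by_cases hh : ε ≤ ‖h‖ ∧ ‖h‖ < 1 <;> simp [g, hh, indicator]
  · refine Filter.Eventually.of_forall fun h => ?_
    simp only [g, indicator]
    split_ifs
    · positivity
    · simp

/-- the weight `min(1,|h|^{5/4})` is integrable -/
noncomputable def mh (d : ℕ) (h : EE d) : ℝ := min 1 (‖h‖ ^ (5/4:ℝ))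

lemma mh_integrable {d : ℕ} (hd : 1 ≤ d) : Integrable (mh d) (kmu d) := by
  have := (radial_kmu hd (fun y => min 1 (y ^ (5/4:ℝ))) ?_).1
  · exact this
  rw [← Ioo_union_Ici_eq_Ioi (zero_lt_one' ℝ)]
  refine IntegrableOn.union ?_ ?_
  · refine (rpow_int_near 1 one_pos).1.congr_fun ?_ measurableSet_Ioo
    intro y hy
    simp only
    rw [min_eq_right (Real.rpow_le_one hy.1.le hy.2.le (by norm_num)), pow54 hy.1]
  · rw [integrableOn_Ici_iff_integrableOn_Ioi]
    refine (integrableOn_Ioi_rpow_of_lt (a := -2) (by norm_num) one_pos).congr_fun ?_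
      measurableSet_Ioi
    intro y hy
    have hy' : (1:ℝ) < y := hy
    simp only
    rw [min_eq_left (Real.one_le_rpow hy'.le (by norm_num)), Real.rpow_neg (by linarith)]
    norm_num

lemma mh_nonneg {d : ℕ} (h : EE d) : 0 ≤ mh d h := by unfold mh; positivity

lemma mh_le_one {d : ℕ} (h : EE d) : mh d h ≤ 1 := min_le_left _ _

lemma sq_le_mh {d : ℕ} (h : EE d) (hh : ‖h‖ ≤ 1) : ‖h‖^2 ≤ mh d h := by
  refine le_min (pow_le_one₀ (norm_nonneg _) hh) ?_
  rcases eq_or_lt_of_le (norm_nonneg h) with h0 | h0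
  · rw [← h0]; simp
  · rw [← Real.rpow_natCast]
    exact Real.rpow_le_rpow_of_exponent_ge h0 hh (by norm_num)

lemma mh_eq_one {d : ℕ} (h : EE d) (hh : 1 ≤ ‖h‖) : mh d h = 1 :=
  min_eq_left (Real.one_le_rpow hh (by norm_num))

@[fun_prop]
lemma mh_meas (d : ℕ) : Measurable (mh d) := by unfold mh; fun_prop

noncomputable def Psi (d : ℕ) (x : EE d) : ℝ := ((1 + ‖x‖)^(d+1))⁻¹

lemma Psi_pos (d : ℕ) (x : EE d) : 0 < Psi d x := by unfold Psi; positivity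

@[fun_prop]
lemma Psi_meas (d : ℕ) : Measurable (Psi d) := by unfold Psi; fun_prop

lemma Psi_integrable (d : ℕ) : Integrable (Psi d) := by
  have := integrable_one_add_norm (E := EE d) (μ := volume) (r := d+1) (by simp)
  refine this.congr (Filter.Eventually.of_forall fun x => ?_)
  simp only [Psi]
  rw [Real.rpow_neg (by positivity)]
  norm_cast

lemma Psi_comp (d : ℕ) {x y : EE d} (h : ‖y - x‖ ≤ 1) : Psi d x ≤ 2^(d+1) * Psi d y := by
  unfold Psi
  have hy : ‖y‖ ≤ ‖x‖ + 1 := by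
    calc ‖y‖ = ‖x + (y-x)‖ := by congr 1; abel
      _ ≤ _ := (norm_add_le _ _).trans (by linarith)
  rw [← div_eq_mul_inv, le_div_iff₀ (by positivity), inv_mul_le_iff₀ (by positivity), ← mul_pow]
  gcongr
  nlinarith [norm_nonneg x]

noncomputable def loc (d : ℕ) (F : EE d → ℝ≥0∞) : ℝ≥0∞ := ⨆ y, ∫⁻ x in ball y 1, F x

lemma le_loc {d : ℕ} (F : EE d → ℝ≥0∞) (y : EE d) : ∫⁻ x in ball y 1, F x ≤ loc d F :=
  le_iSup (fun y => ∫⁻ x in ball y 1, F x) y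

lemma omega_pos (d : ℕ) : 0 < volume.real (ball (0:EE d) 1) :=
  ENNReal.toReal_pos (measure_ball_pos _ _ one_pos).ne' measure_ball_lt_top.ne

noncomputable def Jk (d : ℕ) (x y : EE d) : ℝ≥0∞ :=
  (ball y 1).indicator (fun _ => ENNReal.ofReal (Psi d y)) x

lemma Jk_meas (d : ℕ) : Measurable (Function.uncurry (Jk d)) := by
  have : Function.uncurry (Jk d) =
      {p : EE d × EE d | dist p.1 p.2 < 1}.indicator (fun p => ENNReal.ofReal (Psi d p.2)) := by
    ext p; simp [indicator, Function.uncurry, Jk]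
  rw [this]
  refine Measurable.indicator (by fun_prop) ?_
  exact measurableSet_lt (by fun_prop) measurable_const

lemma ball_shift {d : ℕ} (F : EE d → ℝ≥0∞) (y z : EE d) (ρ : ℝ) :
    ∫⁻ x in ball y ρ, F (x+z) = ∫⁻ x in ball (y+z) ρ, F x := by
  have h := lintegral_add_right_eq_self (μ := volume) ((ball (y+z) ρ).indicator F) z
  rw [lintegral_indicator measurableSet_ball] at h
  rw [← h, ← lintegral_indicator measurableSet_ball]
  congr 1; ext x
  simp [indicator]

lemma Psi_loc (d : ℕ) : ∃ C : ℝ, 0 < C ∧ ∀ F : EE d → ℝ≥0∞, Measurable F →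
    ∫⁻ x, ENNReal.ofReal (Psi d x) * F x ≤ ENNReal.ofReal C * loc d F := by
  set ω := volume.real (ball (0:EE d) 1) with hω
  have hωp : 0 < ω := omega_pos d
  set I := ∫ x, Psi d x with hI
  have hIp : 0 ≤ I := integral_nonneg fun x => (Psi_pos d x).le
  refine ⟨2^(d+1) / ω * I + 1, by positivity, fun F hF => ?_⟩
  have step : ∀ x, ENNReal.ofReal (Psi d x) ≤
      ENNReal.ofReal (2^(d+1)/ω) * ∫⁻ y, Jk d x y := by
    intro x
    have e1 : ∫⁻ y in ball x 1, ENNReal.ofReal (Psi d x / 2^(d+1)) ≤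
        ∫⁻ y, Jk d x y := by
      rw [← lintegral_indicator measurableSet_ball]
      refine lintegral_mono fun y => ?_
      by_cases hy : y ∈ ball x 1
      · have hx : x ∈ ball y 1 := by rwa [mem_ball_comm]
        simp only [Jk, hy, hx, indicator_of_mem]
        apply ENNReal.ofReal_le_ofReal
        rw [div_le_iff₀ (by positivity), mul_comm]
        exact Psi_comp d (by rw [← dist_eq_norm]; exact (mem_ball.1 hy).le)
      · simp [hy]
    rw [setLIntegral_const] at e1
    have e2 : volume (ball x 1) = ENNReal.ofReal ω := by
      rw [Measure.addHaar_ball_center, hω]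
      exact (ENNReal.ofReal_toReal measure_ball_lt_top.ne).symm
    rw [e2, ← ENNReal.ofReal_mul (by have := Psi_pos d x; positivity)] at e1
    calc ENNReal.ofReal (Psi d x) = ENNReal.ofReal (2^(d+1)/ω) * ENNReal.ofReal (Psi d x / 2^(d+1) * ω) := by
          rw [← ENNReal.ofReal_mul (by positivity)]
          congr 1; field_simp
      _ ≤ _ := by gcongr
  have hm := Jk_meas d
  calc ∫⁻ x, ENNReal.ofReal (Psi d x) * F x
      ≤ ∫⁻ x, (ENNReal.ofReal (2^(d+1)/ω) * ∫⁻ y, Jk d x y) * F x := by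
        refine lintegral_mono fun x => ?_
        gcongr; exact step x
    _ = ENNReal.ofReal (2^(d+1)/ω) * ∫⁻ x, ∫⁻ y, Jk d x y * F x := by
        rw [← lintegral_const_mul']
        · congr 1; ext x
          rw [mul_assoc]; congr 1
          rw [lintegral_mul_const]
          exact hm.of_uncurry_left
        · simp
    _ = ENNReal.ofReal (2^(d+1)/ω) * ∫⁻ y, ∫⁻ x, Jk d x y * F x := by
        rw [lintegral_lintegral_swap]
        exact (hm.mul (hF.comp measurable_fst)).aemeasurable
    _ ≤ ENNReal.ofReal (2^(d+1)/ω) * ∫⁻ y, ENNReal.ofReal (Psi d y) * loc d F := by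
        gcongr with y
        calc _ = ∫⁻ x in ball y 1, ENNReal.ofReal (Psi d y) * F x := by
              rw [← lintegral_indicator measurableSet_ball]
              congr 1; ext x
              by_cases hx : x ∈ ball y 1 <;> simp [Jk, hx]
          _ = ENNReal.ofReal (Psi d y) * ∫⁻ x in ball y 1, F x := by
              rw [lintegral_const_mul _ hF]
          _ ≤ _ := by gcongr; exact le_loc F y
    _ = ENNReal.ofReal (2^(d+1)/ω * I) * loc d F := by
        rw [lintegral_mul_const _ (by fun_prop), ← ofReal_integral_eq_lintegral_ofReal (Psi_integrable d)
          (Filter.Eventually.of_forall fun x => (Psi_pos d x).le), ← mul_assoc,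
          ← ENNReal.ofReal_mul (by positivity)]
    _ ≤ _ := by gcongr; linarith

lemma ball_loc (d : ℕ) (ρ : ℝ) (hρ : 0 ≤ ρ) : ∃ C : ℝ, 0 < C ∧ ∀ F : EE d → ℝ≥0∞, Measurable F →
    ∀ z, ∫⁻ x in ball z ρ, F x ≤ ENNReal.ofReal C * loc d F := by
  obtain ⟨C, hC, hF⟩ := Psi_loc d
  refine ⟨(1+ρ)^(d+1) * C, by positivity, fun F hFm z => ?_⟩
  have h1 := hF (fun x => F (x + z)) (by fun_prop)
  have h2 : loc d (fun x => F (x+z)) ≤ loc d F := by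
    refine iSup_le fun y => ?_
    rw [ball_shift]; exact le_loc F (y+z)
  calc ∫⁻ x in ball z ρ, F x = ∫⁻ x in ball 0 ρ, F (x+z) := by
        rw [ball_shift, zero_add]
    _ ≤ ∫⁻ x, ENNReal.ofReal ((1+ρ)^(d+1)) * (ENNReal.ofReal (Psi d x) * F (x+z)) := by
        rw [← lintegral_indicator measurableSet_ball]
        refine lintegral_mono fun x => ?_
        by_cases hx : x ∈ ball 0 ρ
        · simp only [hx, indicator_of_mem]
          rw [← mul_assoc, ← ENNReal.ofReal_mul (by positivity)]
          refine le_mul_of_one_le_left (by simp) ?_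
          rw [ENNReal.one_le_ofReal]
          unfold Psi
          rw [← div_eq_mul_inv, one_le_div (by positivity)]
          have : ‖x‖ < ρ := by simpa using hx
          gcongr
        · simp [hx]
    _ = ENNReal.ofReal ((1+ρ)^(d+1)) * ∫⁻ x, (ENNReal.ofReal (Psi d x) * F (x+z)) := by
        rw [lintegral_const_mul _ (by fun_prop)]
    _ ≤ ENNReal.ofReal ((1+ρ)^(d+1)) * (ENNReal.ofReal C * loc d F) := by
        gcongr; exact h1.trans (by gcongr)
    _ = _ := by rw [← mul_assoc, ← ENNReal.ofReal_mul (by positivity)]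

lemma lip_bound {d : ℕ} {f : EE d → ℝ} (hf : ContDiff ℝ 1 f) (ρ : ℝ) :
    ∃ C : ℝ, 0 ≤ C ∧ ∀ x y, ‖x‖ ≤ ρ → ‖y‖ ≤ ρ → |f x - f y| ≤ C * ‖x - y‖ := by
  have hc : Continuous (fderiv ℝ f) := hf.continuous_fderiv (by simp)
  obtain ⟨C, hC⟩ := (isCompact_closedBall (0:EE d) ρ).exists_bound_of_continuousOn hc.continuousOn
  refine ⟨max C 0, le_max_right _ _, fun x y hx hy => ?_⟩
  have := Convex.norm_image_sub_le_of_norm_fderiv_le (𝕜 := ℝ) (f := f) (C := max C 0)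
    (s := closedBall (0:EE d) ρ)
    (fun x _ => hf.differentiable (by simp) x) (fun x hx => (hC x hx).trans (le_max_left _ _))
    (convex_closedBall _ _) (x := y) (y := x) (by simpa using hy) (by simpa using hx)
  simpa using this

lemma sd_bound {d : ℕ} {f : EE d → ℝ} (hf : ContDiff ℝ 2 f) (ρ : ℝ) :
    ∃ C : ℝ, 0 ≤ C ∧ ∀ x h, ‖x‖ ≤ ρ → ‖h‖ ≤ 1 → |2 * f x - f (x+h) - f (x-h)| ≤ C * ‖h‖^2 := by
  have hf' : ContDiff ℝ 1 (fderiv ℝ f) := hf.fderiv_right (by norm_num)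
  have hc : Continuous (fderiv ℝ (fderiv ℝ f)) := hf'.continuous_fderiv (by simp)
  obtain ⟨C, hC⟩ := (isCompact_closedBall (0:EE d) (ρ+1)).exists_bound_of_continuousOn (f := fderiv ℝ (fderiv ℝ f)) hc.continuousOn
  refine ⟨max C 0, le_max_right _ _, fun x h hx hh => ?_⟩
  have hlip : ∀ a b : EE d, ‖a‖ ≤ ρ+1 → ‖b‖ ≤ ρ+1 →
      ‖fderiv ℝ f a - fderiv ℝ f b‖ ≤ max C 0 * ‖a - b‖ := by
    intro a b ha hb
    exact Convex.norm_image_sub_le_of_norm_fderiv_le (𝕜 := ℝ) (f := fderiv ℝ f) (C := max C 0)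
      (s := closedBall (0:EE d) (ρ+1))
      (fun x _ => hf'.differentiable (by simp) x) (fun x hx => (hC x hx).trans (le_max_left _ _))
      (convex_closedBall _ _) (x := b) (y := a) (by simpa using hb) (by simpa using ha)
  have hd1 : Differentiable ℝ f := hf.differentiable (by simp)
  set F : EE d → ℝ := fun y => f (y + h) - f y with hF
  have hFd : ∀ y, HasFDerivAt F (fderiv ℝ f (y+h) - fderiv ℝ f y) y := by
    intro y
    refine HasFDerivAt.sub ?_ (hd1 y).hasFDerivAt
    have := (hd1 (y+h)).hasFDerivAt.comp y ((hasFDerivAt_id y).add_const h)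
    simpa [Function.comp_def] using this
  have := Convex.norm_image_sub_le_of_norm_hasFDerivWithin_le (𝕜 := ℝ) (f := F)
    (C := max C 0 * ‖h‖) (s := segment ℝ (x-h) x) (fun y _ => (hFd y).hasFDerivWithinAt) ?_
    (convex_segment _ _) (x := x) (y := x - h) (right_mem_segment _ _ _) (left_mem_segment _ _ _)
  · simp only [hF, sub_add_cancel, Real.norm_eq_abs] at this
    have e : x - h - x = -h := by abel
    rw [e, norm_neg] at this
    calc _ = |f x - f (x - h) - (f (x + h) - f x)| := by congr 1; ring
      _ ≤ _ := this
      _ = _ := by ring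
  · intro y hy
    rw [segment_symm, segment_eq_image'] at hy
    obtain ⟨θ, hθ, rfl⟩ := hy
    have e : x + θ • (x - h - x) = x - θ • h := by
      rw [show x - h - x = -h by abel]; simp [sub_eq_add_neg]
    simp only [e]
    refine (hlip _ _ ?_ ?_).trans (le_of_eq ?_)
    · have : x - θ • h + h = x + (1-θ) • h := by rw [sub_smul, one_smul]; abel
      rw [this]
      refine (norm_add_le _ _).trans (add_le_add hx ?_)
      rw [norm_smul, Real.norm_of_nonneg (by linarith [hθ.2])]
      nlinarith [norm_nonneg h, hθ.1, hθ.2]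
    · refine (norm_sub_le _ _).trans (add_le_add hx ?_)
      rw [norm_smul, Real.norm_of_nonneg hθ.1]
      nlinarith [norm_nonneg h, hθ.1, hθ.2]
    · simp

noncomputable def bi {d : ℕ} (ρ : ℝ) (x : EE d) : ℝ := (ball (0:EE d) ρ).indicator (fun _ => (1:ℝ)) x

lemma bi_nonneg {d : ℕ} (ρ : ℝ) (x : EE d) : 0 ≤ bi ρ x := by
  unfold bi; exact indicator_nonneg (by simp) _

lemma bi_one {d : ℕ} {ρ : ℝ} {x : EE d} (h : ‖x‖ < ρ) : bi ρ x = 1 := by simp [bi, h]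

lemma bi_zero {d : ℕ} {ρ : ℝ} {x : EE d} (h : ¬ ‖x‖ < ρ) : bi ρ x = 0 := by simp [bi, h]

@[fun_prop]
lemma bi_meas {d : ℕ} (ρ : ℝ) : Measurable (bi (d := d) ρ) := by
  unfold bi; exact measurable_const.indicator measurableSet_ball

lemma bi_int {d : ℕ} (ρ : ℝ) : Integrable (bi (d := d) ρ) := by
  unfold bi
  exact (integrable_indicator_iff measurableSet_ball).2 (integrableOn_const (measure_ball_lt_top.ne))

lemma int_shift {d : ℕ} (hd : 1 ≤ d) (ρ c : ℝ) :
    Integrable (fun p : EE d × EE d => mh d p.2 * bi ρ (p.1 + c • p.2)) (volume.prod (kmu d)) := by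
  have hm : AEStronglyMeasurable (fun p : EE d × EE d => mh d p.2 * bi ρ (p.1 + c • p.2))
    (volume.prod (kmu d)) := by
    apply Measurable.aestronglyMeasurable; fun_prop
  rw [integrable_prod_iff' hm]
  constructor
  · refine Filter.Eventually.of_forall fun h => ?_
    exact ((bi_int ρ).comp_add_right (c • h)).const_mul (mh d h)
  · have : (fun y : EE d => ∫ x : EE d, ‖mh d y * bi ρ (x + c • y)‖) =
      fun y => mh d y * ∫ x : EE d, bi ρ x := by
      ext y
      rw [← integral_add_right_eq_self (fun x => bi ρ x) (c • y), ← integral_const_mul]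
      congr 1; ext x
      rw [Real.norm_of_nonneg (mul_nonneg (mh_nonneg _) (bi_nonneg _ _))]
    simp only
    rw [this]
    exact (mh_integrable hd).mul_const _

/-- master integrability criterion -/
lemma INT {d : ℕ} (hd : 1 ≤ d) (ρ C : ℝ) {F : EE d × EE d → ℝ} (hF : Continuous F)
    (hb : ∀ x h, |F (x,h)| ≤ C * mh d h * (bi ρ x + bi ρ (x+h) + bi ρ (x-h))) :
    Integrable F (volume.prod (kmu d)) := by
  have h1 := ((int_shift hd ρ 0).add ((int_shift hd ρ 1).add (int_shift hd ρ (-1)))).const_mul C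
  refine h1.mono' hF.aestronglyMeasurable (Filter.Eventually.of_forall fun p => ?_)
  refine (hb p.1 p.2).trans (le_of_eq ?_)
  simp only [Pi.add_apply, zero_smul, add_zero, one_smul, neg_smul, ← sub_eq_add_neg]
  ring

noncomputable def m1 {d : ℕ} (h : EE d) : ℝ := min 1 ‖h‖

lemma m1_nonneg {d : ℕ} (h : EE d) : 0 ≤ m1 h := by unfold m1; positivity

lemma m1_sq {d : ℕ} (h : EE d) : m1 h * m1 h ≤ mh d h := by
  rcases le_total ‖h‖ 1 with h1 | h1
  · rw [m1, min_eq_right h1, ← pow_two]; exact sq_le_mh h h1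
  · rw [m1, min_eq_left h1, mh_eq_one h h1]; norm_num

/-- locally Lipschitz -/
def LL {d : ℕ} (f : EE d → ℝ) : Prop := ∀ ρ : ℝ,
    ∃ C : ℝ, 0 ≤ C ∧ ∀ x y, ‖x‖ ≤ ρ → ‖y‖ ≤ ρ → |f x - f y| ≤ C * ‖x - y‖

lemma LL_m1 {d : ℕ} {f : EE d → ℝ} (hf : LL f) {B : ℝ} (hB : ∀ x, |f x| ≤ B) (ρ : ℝ) :
    ∃ C : ℝ, 0 ≤ C ∧ ∀ x h, (‖x‖ < ρ ∨ ‖x+h‖ < ρ) → |f (x+h) - f x| ≤ C * m1 h := by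
  obtain ⟨C, hC, h⟩ := hf (ρ+1)
  have hB0 : 0 ≤ B := (abs_nonneg _).trans (hB 0)
  refine ⟨C + 2*B, by positivity, fun x k hx => ?_⟩
  rcases le_total ‖k‖ 1 with h1 | h1
  · rw [m1, min_eq_right h1]
    have := h (x+k) x ?_ ?_
    · simp only [add_sub_cancel_left] at this
      nlinarith [norm_nonneg k]
    · rcases hx with hx | hx
      · exact (norm_add_le _ _).trans (by linarith)
      · linarith
    · rcases hx with hx | hx
      · linarith
      · calc ‖x‖ = ‖(x+k) - k‖ := by simp
          _ ≤ _ := (norm_sub_le _ _).trans (by linarith)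
  · rw [m1, min_eq_left h1]
    calc _ ≤ |f (x+k)| + |f x| := abs_sub _ _
      _ ≤ _ := by linarith [hB (x+k), hB x]

lemma sd_mh {d : ℕ} {f : EE d → ℝ} (hf : ContDiff ℝ 2 f) {B : ℝ} (hB : ∀ x, |f x| ≤ B) (ρ : ℝ) :
    ∃ C : ℝ, 0 ≤ C ∧ ∀ x h, ‖x‖ ≤ ρ → |2 * f x - f (x+h) - f (x-h)| ≤ C * mh d h := by
  obtain ⟨C, hC, h⟩ := sd_bound hf ρ
  have hB0 : 0 ≤ B := (abs_nonneg _).trans (hB 0)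
  refine ⟨C + 4*B, by positivity, fun x k hx => ?_⟩
  rcases le_total ‖k‖ 1 with h1 | h1
  · have := h x k hx h1
    nlinarith [sq_le_mh k h1, mh_nonneg k]
  · rw [mh_eq_one k h1]
    have a1 := abs_le.1 (hB x)
    have a2 := abs_le.1 (hB (x+k))
    have a3 := abs_le.1 (hB (x-k))
    rw [abs_le]; constructor <;> linarith

lemma sd_integrable {d : ℕ} (hd : 1 ≤ d) {f : EE d → ℝ} (hf : ContDiff ℝ 2 f) {B : ℝ}
    (hB : ∀ x, |f x| ≤ B) (x : EE d) :
    Integrable (fun h => 2 * f x - f (x+h) - f (x-h)) (kmu d) := by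
  obtain ⟨C, hC, h⟩ := sd_mh hf hB ‖x‖
  refine ((mh_integrable hd).const_mul C).mono' ?_ (Filter.Eventually.of_forall fun k => h x k le_rfl)
  have := hf.continuous
  exact Continuous.aestronglyMeasurable (by fun_prop)

/-- nonlocal operator -/
noncomputable def LL2 {d : ℕ} (f : EE d → ℝ) (x : EE d) : ℝ :=
  ∫ h, (2 * f x - f (x+h) - f (x-h)) ∂(kmu d)

lemma int_psi_sd {d : ℕ} (hd : 1 ≤ d) {w ψ : EE d → ℝ} (hw : ContDiff ℝ 2 w) {B : ℝ}
    (hB : ∀ x, |w x| ≤ B) (hψ : Continuous ψ) {D ρ : ℝ} (hD : ∀ x, |ψ x| ≤ D)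
    (hsupp : ∀ x, ρ ≤ ‖x‖ → ψ x = 0) :
    Integrable (fun p : EE d × EE d => ψ p.1 * (2 * w p.1 - w (p.1+p.2) - w (p.1-p.2)))
      (volume.prod (kmu d)) := by
  obtain ⟨C, hC, h⟩ := sd_mh hw hB ρ
  have := hw.continuous
  have hD0 : 0 ≤ D := (abs_nonneg _).trans (hD 0)
  refine INT hd ρ (D * C) (by fun_prop) fun x k => ?_
  have n1 := bi_nonneg ρ (x+k)
  have n2 := bi_nonneg ρ (x-k)
  have n3 := mh_nonneg k
  by_cases hx : ‖x‖ < ρ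
  · rw [bi_one hx, abs_mul]
    calc _ ≤ D * (C * mh d k) := mul_le_mul (hD x) (h x k hx.le) (abs_nonneg _) hD0
      _ = D * C * mh d k * 1 := by ring
      _ ≤ _ := by gcongr; linarith
  · simp only [hsupp x (not_lt.1 hx), zero_mul, abs_zero]
    have n0 := bi_nonneg ρ x
    positivity

lemma int_dd {d : ℕ} (hd : 1 ≤ d) {w ψ : EE d → ℝ} (hw : LL w) (hwc : Continuous w) {B : ℝ}
    (hB : ∀ x, |w x| ≤ B) (hψ : LL ψ) (hψc : Continuous ψ) {D ρ : ℝ} (hD : ∀ x, |ψ x| ≤ D)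
    (hsupp : ∀ x, ρ ≤ ‖x‖ → ψ x = 0) :
    Integrable (fun p : EE d × EE d => (ψ (p.1+p.2) - ψ p.1) * (w (p.1+p.2) - w p.1))
      (volume.prod (kmu d)) := by
  obtain ⟨C1, hC1, h1⟩ := LL_m1 hw hB ρ
  obtain ⟨C2, hC2, h2⟩ := LL_m1 hψ hD ρ
  refine INT hd ρ (C2 * C1) (by fun_prop) fun x k => ?_
  have n0 := bi_nonneg ρ x
  have n1 := bi_nonneg ρ (x+k)
  have n2 := bi_nonneg ρ (x-k)
  have n3 := mh_nonneg k
  by_cases hx : ‖x‖ < ρ ∨ ‖x+k‖ < ρ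
  · rw [abs_mul]
    have one : 1 ≤ bi ρ x + bi ρ (x+k) + bi ρ (x-k) := by
      rcases hx with hx | hx
      · rw [bi_one hx]; linarith
      · rw [bi_one hx]; linarith
    calc _ ≤ (C2 * m1 k) * (C1 * m1 k) :=
            mul_le_mul (h2 x k hx) (h1 x k hx) (abs_nonneg _) (mul_nonneg hC2 (m1_nonneg _))
      _ = C2 * C1 * (m1 k * m1 k) := by ring
      _ ≤ C2 * C1 * mh d k := by gcongr; exact m1_sq k
      _ = C2 * C1 * mh d k * 1 := by ring
      _ ≤ _ := by gcongr
  · push Not at hx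
    simp only [hsupp x hx.1, hsupp (x+k) hx.2, sub_zero, zero_mul, abs_zero]
    positivity

lemma cs_int {d : ℕ} {ψ : EE d → ℝ} (hψ : Continuous ψ) {ρ : ℝ}
    (hsupp : ∀ x, ρ ≤ ‖x‖ → ψ x = 0) : Integrable ψ := by
  refine hψ.integrable_of_hasCompactSupport ?_
  refine HasCompactSupport.intro (isCompact_closedBall (0:EE d) ρ) fun x hx => hsupp x ?_
  simp at hx; exact hx.le

lemma cs_int_mul {d : ℕ} {ψ w : EE d → ℝ} (hψ : Continuous ψ) (hw : Continuous w) {ρ : ℝ}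
    (hsupp : ∀ x, ρ ≤ ‖x‖ → ψ x = 0) : Integrable (fun x => ψ x * w x) :=
  cs_int (hψ.mul hw) (ρ := ρ) fun x hx => by simp [hsupp x hx]

lemma cs_int_shift {d : ℕ} {ψ w : EE d → ℝ} (hψ : Continuous ψ) (hw : Continuous w) {ρ : ℝ}
    (hsupp : ∀ x, ρ ≤ ‖x‖ → ψ x = 0) (a b : EE d) : Integrable (fun x => ψ (x+a) * w (x+b)) := by
  have := (cs_int_mul hψ (w := fun x => w (x + (b - a))) (by fun_prop) hsupp).comp_add_right a
  refine this.congr (Filter.Eventually.of_forall fun x => ?_)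
  simp

/-- weak formulation -/
lemma weak_form {d : ℕ} (hd : 1 ≤ d) {w ψ : EE d → ℝ} (hw : ContDiff ℝ 2 w) {B : ℝ}
    (hB : ∀ x, |w x| ≤ B) (hψ : LL ψ) (hψc : Continuous ψ) {D ρ : ℝ} (hD : ∀ x, |ψ x| ≤ D)
    (hsupp : ∀ x, ρ ≤ ‖x‖ → ψ x = 0) :
    ∫ x, ψ x * LL2 w x = ∫ p : EE d × EE d, (ψ (p.1+p.2) - ψ p.1) * (w (p.1+p.2) - w p.1)
      ∂(volume.prod (kmu d)) := by
  have i1 := int_psi_sd hd hw hB hψc hD hsupp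
  have hwc := hw.continuous
  have i2 := int_dd hd (fun ρ => lip_bound (hw.of_le (by norm_num)) ρ) hwc hB hψ hψc hD hsupp
  rw [integral_prod_symm _ i2]
  have e : ∀ x, ψ x * LL2 w x = ∫ h, ψ x * (2 * w x - w (x+h) - w (x-h)) ∂(kmu d) := by
    intro x; rw [LL2, integral_const_mul]
  simp_rw [e]
  rw [integral_integral_swap i1]
  congr 1; ext h
  have j0 := cs_int_mul hψc hwc hsupp
  have j1 := cs_int_shift hψc hwc hsupp 0 h
  have j2 := cs_int_shift hψc hwc hsupp 0 (-h)
  have j3 := cs_int_shift hψc hwc hsupp h h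
  have j4 := cs_int_shift hψc hwc hsupp h 0
  simp only [add_zero, ← sub_eq_add_neg] at j1 j2 j3 j4
  have t1 : ∫ x, ψ (x+h) * w (x+h) = ∫ x, ψ x * w x := integral_add_right_eq_self (fun x => ψ x * w x) h
  have t2 : ∫ x, ψ (x+h) * w x = ∫ x, ψ x * w (x-h) := by
    rw [← integral_add_right_eq_self (fun x => ψ x * w (x-h)) h]; simp
  have L : ∫ x, ψ x * (2 * w x - w (x+h) - w (x-h)) =
      2 * (∫ x, ψ x * w x) - (∫ x, ψ x * w (x+h)) - (∫ x, ψ x * w (x-h)) := by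
    have a1 : Integrable (fun x => 2 * (ψ x * w x) - ψ x * w (x+h)) := (j0.const_mul 2).sub j1
    rw [← integral_const_mul, ← integral_sub (j0.const_mul 2) j1, ← integral_sub a1 j2]
    congr 1; ext x; ring
  have Rr : ∫ x, (ψ (x+h) - ψ x) * (w (x+h) - w x) =
      (∫ x, ψ (x+h) * w (x+h)) - (∫ x, ψ (x+h) * w x) - (∫ x, ψ x * w (x+h)) + (∫ x, ψ x * w x) := by
    have a1 : Integrable (fun x => ψ (x+h) * w (x+h) - ψ (x+h) * w x) := j3.sub j4
    have a2 : Integrable (fun x => ψ (x+h) * w (x+h) - ψ (x+h) * w x - ψ x * w (x+h)) := a1.sub j1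
    rw [← integral_sub j3 j4, ← integral_sub a1 j1, ← integral_add a2 j0]
    congr 1; ext x; ring
  rw [L, Rr, t1, t2]; ring

noncomputable def cut {d : ℕ} (r : ℝ) (x : EE d) : ℝ := max 0 (min 1 (r + 1 - ‖x‖))

@[fun_prop]
lemma cut_cont {d : ℕ} (r : ℝ) : Continuous (cut (d := d) r) := by unfold cut; fun_prop

lemma cut_nonneg {d : ℕ} (r : ℝ) (x : EE d) : 0 ≤ cut r x := le_max_left _ _

lemma cut_le_one {d : ℕ} (r : ℝ) (x : EE d) : cut r x ≤ 1 := max_le zero_le_one (min_le_left _ _)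

lemma cut_abs {d : ℕ} (r : ℝ) (x : EE d) : |cut r x| ≤ 1 := by
  rw [abs_of_nonneg (cut_nonneg _ _)]; exact cut_le_one _ _

lemma cut_one {d : ℕ} {r : ℝ} {x : EE d} (h : ‖x‖ ≤ r) : cut r x = 1 := by
  unfold cut; rw [min_eq_left (by linarith)]; simp

lemma cut_zero {d : ℕ} {r : ℝ} {x : EE d} (h : r + 1 ≤ ‖x‖) : cut r x = 0 := by
  unfold cut; rw [max_eq_left]; exact (min_le_right _ _).trans (by linarith)

lemma cut_lip {d : ℕ} (r : ℝ) (x y : EE d) : |cut r x - cut r y| ≤ ‖x - y‖ := by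
  unfold cut
  calc _ ≤ |min 1 (r + 1 - ‖x‖) - min 1 (r + 1 - ‖y‖)| := by
        have := abs_max_sub_max_le_abs (min 1 (r + 1 - ‖x‖)) (min 1 (r + 1 - ‖y‖)) 0
        rwa [max_comm, max_comm _ (0:ℝ)] at this
    _ ≤ |(r + 1 - ‖x‖) - (r + 1 - ‖y‖)| := by
        have := abs_min_sub_min_le_max 1 (r + 1 - ‖x‖) 1 (r + 1 - ‖y‖)
        simpa using this
    _ = |‖y‖ - ‖x‖| := by congr 1; ring
    _ ≤ ‖y - x‖ := abs_norm_sub_norm_le _ _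
    _ = _ := norm_sub_rev _ _

lemma cut_LL {d : ℕ} (r : ℝ) : LL (cut (d := d) r) := fun ρ =>
  ⟨1, zero_le_one, fun x y _ _ => by simpa using cut_lip r x y⟩

lemma LL_mul {d : ℕ} {f g : EE d → ℝ} (hf : LL f) (hg : LL g) {A B : ℝ} (hA : ∀ x, |f x| ≤ A)
    (hB : ∀ x, |g x| ≤ B) : LL (fun x => f x * g x) := fun ρ => by
  obtain ⟨C, hC, h1⟩ := hf ρ
  obtain ⟨D, hD, h2⟩ := hg ρ
  have hA0 : 0 ≤ A := (abs_nonneg _).trans (hA 0)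
  have hB0 : 0 ≤ B := (abs_nonneg _).trans (hB 0)
  refine ⟨A * D + C * B, by positivity, fun x y hx hy => ?_⟩
  have e : f x * g x - f y * g y = f x * (g x - g y) + (f x - f y) * g y := by ring
  rw [e]
  refine (abs_add_le _ _).trans ?_
  rw [abs_mul, abs_mul]
  calc _ ≤ A * (D * ‖x - y‖) + (C * ‖x-y‖) * B := by
        gcongr
        · exact hA x
        · exact h2 x y hx hy
        · exact h1 x y hx hy
        · exact hB y
    _ = _ := by ring

lemma cut_m1 {d : ℕ} (r : ℝ) (x h : EE d) : |cut r (x+h) - cut r x| ≤ m1 h := by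
  refine le_min ?_ ?_
  · rw [abs_le]
    constructor <;> linarith [cut_nonneg r x, cut_nonneg r (x+h), cut_le_one r x, cut_le_one r (x+h)]
  · simpa using cut_lip r (x+h) x

lemma cut_sq {d : ℕ} (r : ℝ) (x h : EE d) : (cut r (x+h) - cut r x)^2 ≤ mh d h := by
  refine le_trans ?_ (m1_sq h)
  rw [← sq_abs, ← pow_two]
  exact pow_le_pow_left₀ (abs_nonneg _) (cut_m1 r x h) 2

lemma cut_sq_bi {d : ℕ} {r : ℝ} (x h : EE d) : (cut r (x+h) - cut r x)^2 ≤
    mh d h * (bi (r+1) x + bi (r+1) (x+h)) := by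
  have n0 := bi_nonneg (r+1) x
  have n1 := bi_nonneg (r+1) (x+h)
  have n3 := mh_nonneg h
  by_cases hx : ‖x‖ < r+1 ∨ ‖x+h‖ < r+1
  · have one : 1 ≤ bi (r+1) x + bi (r+1) (x+h) := by
      rcases hx with hx | hx
      · rw [bi_one hx]; linarith
      · rw [bi_one hx]; linarith
    nlinarith [cut_sq r x h]
  · push Not at hx
    rw [cut_zero hx.1, cut_zero hx.2]; simp; positivity

lemma cutA (d : ℕ) (hd : 1 ≤ d) (r : ℝ) (hr : 0 ≤ r) : ∃ C : ℝ, 0 < C ∧ ∀ x : EE d,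
    ∫⁻ h, ENNReal.ofReal ((cut r (x+h) - cut r x)^2) ∂(kmu d) ≤ ENNReal.ofReal (C * Psi d x) := by
  set ρ := r + 1 with hρ
  have hρ1 : 1 ≤ ρ := by linarith
  set I := ∫ h, mh d h ∂(kmu d) with hI
  have hI0 : 0 ≤ I := integral_nonneg fun h => mh_nonneg h
  set V := volume.real (ball (0:EE d) ρ) with hV
  have hV0 : 0 ≤ V := measureReal_nonneg
  refine ⟨(1 + 2*ρ)^(d+1) * I + 4^(d+1) * V + 1, by positivity, fun x => ?_⟩
  have hP := Psi_pos d x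
  by_cases hx : ‖x‖ < 2*ρ
  · calc _ ≤ ∫⁻ h, ENNReal.ofReal (mh d h) ∂(kmu d) :=
          lintegral_mono fun h => ENNReal.ofReal_le_ofReal (cut_sq r x h)
      _ = ENNReal.ofReal I := by
          rw [ofReal_integral_eq_lintegral_ofReal (mh_integrable hd)
            (Filter.Eventually.of_forall fun h => mh_nonneg h)]
      _ ≤ _ := by
          apply ENNReal.ofReal_le_ofReal
          have : 1 ≤ (1 + 2*ρ)^(d+1) * Psi d x := by
            unfold Psi
            rw [← div_eq_mul_inv, one_le_div (by positivity)]
            gcongr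
          have e : 0 ≤ (4^(d+1) * V + 1) * Psi d x := by positivity
          nlinarith
  · push Not at hx
    have hx1 : 2 ≤ ‖x‖ := by linarith
    rw [lintegral_kmu]
    have key : ∀ h : EE d, ENNReal.ofReal (kap d h) * ENNReal.ofReal ((cut r (x+h) - cut r x)^2)
        ≤ ENNReal.ofReal (4^(d+1) * Psi d x) * (ball (0:EE d) ρ).indicator (fun _ => 1) (x+h) := by
      intro h
      rw [cut_zero (x := x) (by linarith)]
      by_cases hh : ‖x+h‖ < ρ
      · have : x + h ∈ ball (0:EE d) ρ := by simpa using hh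
        rw [indicator_of_mem this, mul_one, ← ENNReal.ofReal_mul (kap_nonneg _ _)]
        apply ENNReal.ofReal_le_ofReal
        have c1 : (cut r (x+h) - 0)^2 ≤ 1 := by
          have := cut_le_one r (x+h); have := cut_nonneg r (x+h); nlinarith
        have hh2 : ‖x‖ / 2 ≤ ‖h‖ := by
          have : ‖x‖ ≤ ‖x+h‖ + ‖h‖ := by
            calc ‖x‖ = ‖(x+h) - h‖ := by simp
              _ ≤ _ := norm_sub_le _ _
          linarith
        have k1 : kap d h ≤ 4^(d+1) * Psi d x := by
          unfold kap Psi
          rw [← div_eq_mul_inv, le_div_iff₀ (by positivity), inv_mul_le_iff₀ (by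
            have : 0 < ‖h‖ := by linarith
            positivity), ← mul_pow]
          gcongr
          linarith
        calc _ ≤ kap d h * 1 := by gcongr; exact kap_nonneg _ _
          _ ≤ _ := by linarith
      · rw [cut_zero (x := x + h) (by linarith)]; simp
    calc _ ≤ _ := lintegral_mono key
      _ = ENNReal.ofReal (4^(d+1) * Psi d x) * ENNReal.ofReal V := by
          rw [lintegral_const_mul]
          · congr 1
            have := lintegral_add_left_eq_self (μ := volume) ((ball (0:EE d) ρ).indicator (fun _ => (1:ℝ≥0∞))) x
            rw [this, lintegral_indicator measurableSet_ball]
            simp [hV, measure_ball_lt_top.ne]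
          · exact (measurable_const.indicator measurableSet_ball).comp (by fun_prop)
      _ ≤ _ := by
          rw [← ENNReal.ofReal_mul (by positivity)]
          apply ENNReal.ofReal_le_ofReal
          have e : 0 ≤ ((1 + 2*ρ)^(d+1) * I + 1) * Psi d x := by positivity
          nlinarith

lemma lsym {d : ℕ} {G : EE d × EE d → ℝ≥0∞} (hG : Measurable G) :
    ∫⁻ p, G (p.1 + p.2, -p.2) ∂((volume : Measure (EE d)).prod (kmu d)) =
      ∫⁻ p, G p ∂((volume : Measure (EE d)).prod (kmu d)) := by
  rw [lintegral_prod_symm _ (by fun_prop), lintegral_prod_symm _ (by fun_prop)]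
  calc _ = ∫⁻ h, ∫⁻ x, G (x, -h) ∂volume ∂(kmu d) := by
        congr 1; ext h
        exact lintegral_add_right_eq_self (fun x => G (x, -h)) h
    _ = _ := (kmu_neg d).lintegral_comp (f := fun h => ∫⁻ x, G (x, h))
        (Measurable.lintegral_prod_left' hG)

lemma psiLL2_int {d : ℕ} (hd : 1 ≤ d) {w ψ : EE d → ℝ} (hw : ContDiff ℝ 2 w) {B : ℝ}
    (hB : ∀ x, |w x| ≤ B) (hψ : Continuous ψ) {D ρ : ℝ} (hD : ∀ x, |ψ x| ≤ D)
    (hsupp : ∀ x, ρ ≤ ‖x‖ → ψ x = 0) : Integrable (fun x => ψ x * LL2 w x) := by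
  have := (int_psi_sd hd hw hB hψ hD hsupp).integral_prod_left
  refine this.congr (Filter.Eventually.of_forall fun x => ?_)
  simp only [LL2, integral_const_mul]

lemma int_cut {d : ℕ} (hd : 1 ≤ d) (r : ℝ) {H : EE d × EE d → ℝ} (hH : Continuous H) {B : ℝ}
    (hB : ∀ p, |H p| ≤ B) :
    Integrable (fun p : EE d × EE d => H p * (cut r (p.1+p.2) - cut r p.1)^2)
      (volume.prod (kmu d)) := by
  have hB0 : 0 ≤ B := (abs_nonneg _).trans (hB 0)
  refine INT hd (r+1) B (by fun_prop) fun x h => ?_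
  rw [abs_mul, abs_of_nonneg (sq_nonneg (cut r (x+h) - cut r x))]
  calc _ ≤ B * (mh d h * (bi (r+1) x + bi (r+1) (x+h))) := by
        gcongr
        · exact hB _
        · exact cut_sq_bi x h
    _ ≤ B * (mh d h * (bi (r+1) x + bi (r+1) (x+h) + bi (r+1) (x-h))) := by
        refine mul_le_mul_of_nonneg_left (mul_le_mul_of_nonneg_left ?_ (mh_nonneg h)) hB0
        linarith [bi_nonneg (r+1) (x-h)]
    _ = _ := by ring

lemma LL_C2 {d : ℕ} {w : EE d → ℝ} (hw : ContDiff ℝ 2 w) : LL w :=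
  fun ρ => lip_bound (hw.of_le (by norm_num)) ρ

/-- energy identity with the truncated test function -/
lemma energy_id {d : ℕ} (hd : 1 ≤ d) (r : ℝ) {w : EE d → ℝ} (hw : ContDiff ℝ 2 w) {B : ℝ}
    (hB : ∀ x, |w x| ≤ B) :
    Integrable (fun p : EE d × EE d => (cut r (p.1+p.2) * w (p.1+p.2) - cut r p.1 * w p.1)^2)
      (volume.prod (kmu d)) ∧
    ∫ p : EE d × EE d, (cut r (p.1+p.2) * w (p.1+p.2) - cut r p.1 * w p.1)^2
      ∂(volume.prod (kmu d)) =
    (∫ x, (cut r x * (cut r x * w x)) * LL2 w x) +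
      ∫ p : EE d × EE d, (w p.1 * w (p.1 + p.2)) * (cut r (p.1+p.2) - cut r p.1)^2
        ∂(volume.prod (kmu d)) := by
  have hwc := hw.continuous
  have hB0 : 0 ≤ B := (abs_nonneg _).trans (hB 0)
  have b1 : ∀ x, |cut r x * w x| ≤ B := fun x => by
    rw [abs_mul]
    calc _ ≤ 1 * B := by gcongr; exact cut_abs r x; exact hB x
      _ = B := one_mul _
  have b2 : ∀ x, |cut r x * (cut r x * w x)| ≤ B := fun x => by
    rw [abs_mul]
    calc _ ≤ 1 * B := by gcongr; exact cut_abs r x; exact b1 x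
      _ = B := one_mul _
  have l1 : LL (fun x => cut r x * w x) := LL_mul (cut_LL r) (LL_C2 hw) (cut_abs r) hB
  have l2 : LL (fun x => cut r x * (cut r x * w x)) := LL_mul (cut_LL r) l1 (cut_abs r) b1
  have s1 : ∀ x : EE d, r + 1 ≤ ‖x‖ → cut r x * w x = 0 := fun x hx => by rw [cut_zero hx]; simp
  have s2 : ∀ x : EE d, r + 1 ≤ ‖x‖ → cut r x * (cut r x * w x) = 0 := fun x hx => by
    rw [cut_zero hx]; simp
  have i0 := int_dd hd l1 (by fun_prop) b1 l1 (by fun_prop) b1 s1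
  have i0' : Integrable (fun p : EE d × EE d =>
      (cut r (p.1+p.2) * w (p.1+p.2) - cut r p.1 * w p.1)^2) (volume.prod (kmu d)) :=
    i0.congr (Filter.Eventually.of_forall fun p => (pow_two _).symm)
  have i1 := int_dd hd (LL_C2 hw) hwc hB l2 (by fun_prop) b2 s2
  have i2 := int_cut hd r (H := fun p : EE d × EE d => w p.1 * w (p.1+p.2)) (by fun_prop)
    (B := B * B) (fun p => by rw [abs_mul]; gcongr; exact hB _; exact hB _)
  refine ⟨i0', ?_⟩
  rw [weak_form hd hw hB l2 (by fun_prop) b2 s2, ← integral_add i1 i2]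
  congr 1; ext p; ring

lemma LemG0 (d : ℕ) (hd : 1 ≤ d) : ∃ C : ℝ, 0 < C ∧ ∀ w : EE d → ℝ, ContDiff ℝ 2 w →
    ∀ B : ℝ, (∀ x, |w x| ≤ B) → ∀ Λ : ℝ, 0 ≤ Λ → (∀ x, w x * LL2 w x ≤ Λ * w x^2) →
    ∫⁻ x in ball 0 2, ∫⁻ h, ENNReal.ofReal ((w (x+h) - w x)^2) ∂(kmu d) ≤
      ENNReal.ofReal (C * (Λ+1)) * loc d (fun x => ENNReal.ofReal (w x^2)) := by
  obtain ⟨C1, hC1, hA⟩ := cutA d hd 2 (by norm_num)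
  obtain ⟨C2, hC2, hP⟩ := Psi_loc d
  obtain ⟨C3, hC3, hb⟩ := ball_loc d 3 (by norm_num)
  refine ⟨2*C3 + 4*(C1*C2), by positivity, fun w hw B hB Λ hΛ hL => ?_⟩
  have hwc := hw.continuous
  have hB0 : 0 ≤ B := (abs_nonneg _).trans (hB 0)
  set S : EE d → ℝ≥0∞ := fun x => ENNReal.ofReal (w x^2) with hS
  have hSm : Measurable S := by fun_prop
  set μ := (volume : Measure (EE d)).prod (kmu d) with hμ
  set T := ∫⁻ p : EE d × EE d, ENNReal.ofReal (w p.1 ^2 * (cut 2 (p.1+p.2) - cut 2 p.1)^2) ∂μ with hT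
  have hT1 : T ≤ ENNReal.ofReal (C1 * C2) * loc d S := by
    rw [hT, lintegral_prod _ (by fun_prop)]
    calc _ ≤ ∫⁻ x, ENNReal.ofReal C1 * (ENNReal.ofReal (Psi d x) * S x) := by
          refine lintegral_mono fun x => ?_
          simp only [ENNReal.ofReal_mul (sq_nonneg (w x))]
          rw [lintegral_const_mul _ (by fun_prop)]
          calc _ ≤ S x * ENNReal.ofReal (C1 * Psi d x) := by gcongr; exact hA x
            _ = _ := by rw [ENNReal.ofReal_mul hC1.le]; ring
      _ = ENNReal.ofReal C1 * ∫⁻ x, (ENNReal.ofReal (Psi d x) * S x) :=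
          lintegral_const_mul _ (by fun_prop)
      _ ≤ ENNReal.ofReal C1 * (ENNReal.ofReal C2 * loc d S) := by gcongr; exact hP S hSm
      _ = _ := by rw [ENNReal.ofReal_mul hC1.le]; ring
  have hT2 : ∫⁻ p : EE d × EE d, ENNReal.ofReal (w (p.1+p.2) ^2 * (cut 2 (p.1+p.2) - cut 2 p.1)^2) ∂μ = T := by
    rw [hT, ← lsym (by fun_prop)]
    congr 1; ext p
    simp only [add_neg_cancel_right]
    congr 2; ring
  obtain ⟨i0, hid⟩ := energy_id hd 2 hw hB
  have i2 := int_cut hd 2 (H := fun p : EE d × EE d => w p.1 * w (p.1+p.2)) (by fun_prop)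
    (B := B * B) (fun p => by rw [abs_mul]; gcongr; exact hB _; exact hB _)
  have b1 : ∀ x, |cut 2 x * w x| ≤ B := fun x => by
    rw [abs_mul]
    calc _ ≤ 1 * B := by gcongr; exact cut_abs 2 x; exact hB x
      _ = B := one_mul _
  have b2 : ∀ x, |cut 2 x * (cut 2 x * w x)| ≤ B := fun x => by
    rw [abs_mul]
    calc _ ≤ 1 * B := by gcongr; exact cut_abs 2 x; exact b1 x
      _ = B := one_mul _
  have s2 : ∀ x : EE d, (2:ℝ) + 1 ≤ ‖x‖ → cut 2 x * (cut 2 x * w x) = 0 := fun x hx => by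
    rw [cut_zero hx]; simp
  have s3 : ∀ x : EE d, (2:ℝ) + 1 ≤ ‖x‖ → cut 2 x * (cut 2 x * w x) * w x = 0 := fun x hx => by
    rw [cut_zero hx]; simp
  have iL := psiLL2_int hd hw hB (by fun_prop) b2 s2
  have iW : Integrable (fun x => cut 2 x * (cut 2 x * w x) * w x) := cs_int (by fun_prop) s3
  have e1 : ∫ x, (cut 2 x * (cut 2 x * w x)) * LL2 w x ≤ Λ * ∫ x, cut 2 x * (cut 2 x * w x) * w x := by
    rw [← integral_const_mul]
    refine integral_mono iL (iW.const_mul Λ) fun x => ?_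
    have := mul_le_mul_of_nonneg_left (hL x) (sq_nonneg (cut 2 x))
    simp only
    nlinarith
  have nW : ∀ x, 0 ≤ cut 2 x * (cut 2 x * w x) * w x := fun x => by
    have : cut 2 x * (cut 2 x * w x) * w x = (cut 2 x * w x)^2 := by ring
    rw [this]; positivity
  have e2 : ENNReal.ofReal (∫ x, cut 2 x * (cut 2 x * w x) * w x) ≤ ENNReal.ofReal C3 * loc d S := by
    rw [ofReal_integral_eq_lintegral_ofReal iW (Filter.Eventually.of_forall nW)]
    refine le_trans ?_ (hb S hSm 0)
    rw [← lintegral_indicator measurableSet_ball]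
    refine lintegral_mono fun x => ?_
    by_cases hx : ‖x‖ < 3
    · rw [indicator_of_mem (by simpa using hx)]
      apply ENNReal.ofReal_le_ofReal
      have h1 := cut_le_one 2 x
      have h0 := cut_nonneg 2 x
      have : cut 2 x * cut 2 x ≤ 1 := by nlinarith
      nlinarith [sq_nonneg (w x)]
    · rw [s3 x (by linarith)]; simp
  have e3 : ENNReal.ofReal (∫ p : EE d × EE d, (w p.1 * w (p.1 + p.2)) * (cut 2 (p.1+p.2) - cut 2 p.1)^2 ∂μ)
      ≤ T := by
    have j1 := int_cut hd 2 (H := fun p : EE d × EE d => (w p.1^2 + w (p.1+p.2)^2)/2) (by fun_prop)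
      (B := B * B) (fun p => by
        rw [abs_of_nonneg (by positivity)]
        have := sq_le_sq' (abs_le.1 (hB p.1)).1 (abs_le.1 (hB p.1)).2
        have := sq_le_sq' (abs_le.1 (hB (p.1+p.2))).1 (abs_le.1 (hB (p.1+p.2))).2
        nlinarith)
    calc _ ≤ ENNReal.ofReal (∫ p : EE d × EE d, ((w p.1^2 + w (p.1+p.2)^2)/2) * (cut 2 (p.1+p.2) - cut 2 p.1)^2 ∂μ) := by
          apply ENNReal.ofReal_le_ofReal
          refine integral_mono i2 j1 fun p => ?_
          have := sq_nonneg (w p.1 - w (p.1+p.2))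
          simp only
          gcongr
          nlinarith
      _ = ∫⁻ p, ENNReal.ofReal (((w p.1^2 + w (p.1+p.2)^2)/2) * (cut 2 (p.1+p.2) - cut 2 p.1)^2) ∂μ :=
          ofReal_integral_eq_lintegral_ofReal j1 (Filter.Eventually.of_forall fun p => by positivity)
      _ = ∫⁻ p, (ENNReal.ofReal (1/2) * ENNReal.ofReal (w p.1 ^2 * (cut 2 (p.1+p.2) - cut 2 p.1)^2) +
           ENNReal.ofReal (1/2) * ENNReal.ofReal (w (p.1+p.2) ^2 * (cut 2 (p.1+p.2) - cut 2 p.1)^2)) ∂μ := by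
          congr 1; ext p
          rw [← ENNReal.ofReal_mul (by norm_num), ← ENNReal.ofReal_mul (by norm_num),
            ← ENNReal.ofReal_add (by positivity) (by positivity)]
          congr 1; ring
      _ = ENNReal.ofReal (1/2) * T + ENNReal.ofReal (1/2) * T := by
          rw [lintegral_add_left (by fun_prop), lintegral_const_mul _ (by fun_prop),
            lintegral_const_mul _ (by fun_prop), hT2]
      _ = T := by
          rw [← add_mul, ← ENNReal.ofReal_add (by norm_num) (by norm_num)]; norm_num
  have e4 : ∫⁻ p : EE d × EE d, ENNReal.ofReal ((cut 2 (p.1+p.2) * w (p.1+p.2) - cut 2 p.1 * w p.1)^2) ∂μ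
      ≤ ENNReal.ofReal (Λ * C3 + C1 * C2) * loc d S := by
    rw [← ofReal_integral_eq_lintegral_ofReal i0 (Filter.Eventually.of_forall fun p => sq_nonneg _), hid]
    calc _ ≤ ENNReal.ofReal (Λ * ∫ x, cut 2 x * (cut 2 x * w x) * w x) +
          ENNReal.ofReal (∫ p : EE d × EE d, (w p.1 * w (p.1 + p.2)) * (cut 2 (p.1+p.2) - cut 2 p.1)^2 ∂μ) := by
          refine (ENNReal.ofReal_add_le).trans ?_
          gcongr
      _ ≤ ENNReal.ofReal Λ * (ENNReal.ofReal C3 * loc d S) + ENNReal.ofReal (C1 * C2) * loc d S := by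
          rw [ENNReal.ofReal_mul hΛ]
          gcongr
          exact e3.trans hT1
      _ = _ := by
          rw [ENNReal.ofReal_add (by positivity) (by positivity), ENNReal.ofReal_mul hΛ]; ring
  calc _ ≤ ∫⁻ x, ∫⁻ h, ENNReal.ofReal (cut 2 x^2 * (w (x+h) - w x)^2) ∂(kmu d) := by
        rw [← lintegral_indicator measurableSet_ball]
        refine lintegral_mono fun x => ?_
        by_cases hx : x ∈ ball (0:EE d) 2
        · rw [indicator_of_mem hx, cut_one (by simp at hx; exact hx.le)]; simp
        · rw [indicator_of_notMem hx]; simp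
    _ = ∫⁻ p : EE d × EE d, ENNReal.ofReal (cut 2 p.1^2 * (w (p.1+p.2) - w p.1)^2) ∂μ := by
        rw [lintegral_prod _ (by fun_prop)]
    _ ≤ ∫⁻ p : EE d × EE d, (ENNReal.ofReal 2 * ENNReal.ofReal ((cut 2 (p.1+p.2) * w (p.1+p.2) - cut 2 p.1 * w p.1)^2)
        + ENNReal.ofReal 2 * ENNReal.ofReal (w (p.1+p.2) ^2 * (cut 2 (p.1+p.2) - cut 2 p.1)^2)) ∂μ := by
        refine lintegral_mono fun p => ?_
        rw [← ENNReal.ofReal_mul (by norm_num), ← ENNReal.ofReal_mul (by norm_num),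
            ← ENNReal.ofReal_add (by positivity) (by positivity)]
        apply ENNReal.ofReal_le_ofReal
        set q := cut 2 (p.1+p.2); set P := cut 2 p.1; set b := w (p.1+p.2); set a := w p.1
        nlinarith [sq_nonneg ((q*b-P*a) + b*(q-P))]
    _ ≤ ENNReal.ofReal 2 * (ENNReal.ofReal (Λ * C3 + C1 * C2) * loc d S) + ENNReal.ofReal 2 * (ENNReal.ofReal (C1 * C2) * loc d S) := by
        rw [lintegral_add_left (by fun_prop), lintegral_const_mul _ (by fun_prop),
            lintegral_const_mul _ (by fun_prop), hT2]
        gcongr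
    _ = ENNReal.ofReal (2 * (Λ * C3 + C1 * C2) + 2 * (C1 * C2)) * loc d S := by
        rw [← mul_assoc, ← mul_assoc, ← ENNReal.ofReal_mul (p := 2) (by norm_num),
          ← ENNReal.ofReal_mul (p := 2) (by norm_num), ← add_mul,
          ← ENNReal.ofReal_add (by positivity) (by positivity)]
    _ ≤ _ := by
        gcongr
        have : 0 ≤ C1 * C2 := by positivity
        nlinarith

lemma LL2_shift {d : ℕ} (w : EE d → ℝ) (z x : EE d) :
    LL2 (fun x => w (x+z)) x = LL2 w (x+z) := by
  unfold LL2
  congr 1; ext h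
  have a : x + h + z = x + z + h := by abel
  have b : x - h + z = x + z - h := by abel
  simp only [a, b]

lemma loc_shift {d : ℕ} (F : EE d → ℝ≥0∞) (z : EE d) : loc d (fun x => F (x+z)) ≤ loc d F := by
  refine iSup_le fun y => ?_
  rw [ball_shift]
  exact le_loc F _

lemma LemG (d : ℕ) (hd : 1 ≤ d) : ∃ C : ℝ, 0 < C ∧ ∀ w : EE d → ℝ, ContDiff ℝ 2 w →
    ∀ B : ℝ, (∀ x, |w x| ≤ B) → ∀ Λ : ℝ, 0 ≤ Λ → (∀ x, w x * LL2 w x ≤ Λ * w x^2) → ∀ z,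
    ∫⁻ x in ball z 2, ∫⁻ h, ENNReal.ofReal ((w (x+h) - w x)^2) ∂(kmu d) ≤
      ENNReal.ofReal (C * (Λ+1)) * loc d (fun x => ENNReal.ofReal (w x^2)) := by
  obtain ⟨C, hC, H⟩ := LemG0 d hd
  refine ⟨C, hC, fun w hw B hB Λ hΛ hL z => ?_⟩
  have := H (fun x => w (x+z)) (hw.comp (by fun_prop)) B (fun x => hB _) Λ hΛ
    (fun x => by rw [LL2_shift]; exact hL _)
  have e := ball_shift (fun x => ∫⁻ h, ENNReal.ofReal ((w (x+h) - w x)^2) ∂(kmu d)) 0 z 2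
  rw [zero_add] at e
  rw [← e]
  refine le_trans (le_of_eq ?_) (this.trans ?_)
  · simp only [add_right_comm]
  · gcongr
    exact loc_shift (fun x => ENNReal.ofReal (w x^2)) z

structure Good (d : ℕ) (Λ α : ℝ) (F F' : ℝ → ℝ) (u : EE d → ℝ) : Prop where
  cd : ContDiff ℝ 2 u
  bd : ∀ x, |u x| ≤ 1
  lip : ∀ a ∈ Icc (-1:ℝ) 1, ∀ b ∈ Icc (-1:ℝ) 1, |F a - F b| ≤ Λ * |a - b|
  hol : ∀ a ∈ Icc (-1:ℝ) 1, ∀ b ∈ Icc (-1:ℝ) 1,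
    |F b - F a - F' a * (b - a)| ≤ Λ * |b - a| ^ α * |b - a|
  cF : ContinuousOn F' (Icc (-1:ℝ) 1)
  eq : ∀ x, LL2 u x = F (u x)
  stab : ∀ η : EE d → ℝ, ContDiff ℝ (⊤ : ℕ∞) η → HasCompactSupport η →
    ∫ x, F' (u x) * (η x)^2 ≤ ∫ p : EE d × EE d, (η (p.1+p.2) - η p.1)^2 ∂(volume.prod (kmu d))

lemma Good.mem {d : ℕ} {Λ α : ℝ} {F F' : ℝ → ℝ} {u : EE d → ℝ} (g : Good d Λ α F F' u) (x : EE d) :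
    u x ∈ Icc (-1:ℝ) 1 := abs_le.1 (g.bd x)

/-- equation for differences -/
lemma LL2_diff {d : ℕ} (hd : 1 ≤ d) {u : EE d → ℝ} (cd : ContDiff ℝ 2 u) (bd : ∀ x, |u x| ≤ 1)
    (k x : EE d) : LL2 (fun x => u (x+k) - u x) x = LL2 u (x+k) - LL2 u x := by
  rw [← LL2_shift]
  have h1 := sd_integrable hd (f := fun x => u (x+k)) (cd.comp (by fun_prop)) (fun x => bd (x+k)) x
  have h2 := sd_integrable hd cd bd x
  unfold LL2
  rw [← integral_sub h1 h2]
  congr 1; ext h; ring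

lemma Good.wL {d : ℕ} {Λ α : ℝ} {F F' : ℝ → ℝ} {u : EE d → ℝ} (g : Good d Λ α F F' u) (hd : 1 ≤ d)
    (k x : EE d) : (u (x+k) - u x) * LL2 (fun x => u (x+k) - u x) x ≤ Λ * (u (x+k) - u x)^2 := by
  rw [LL2_diff hd g.cd g.bd, g.eq, g.eq]
  have := g.lip _ (g.mem (x+k)) _ (g.mem x)
  calc _ ≤ |u (x+k) - u x| * |F (u (x+k)) - F (u x)| := by rw [← abs_mul]; exact le_abs_self _
    _ ≤ |u (x+k) - u x| * (Λ * |u (x+k) - u x|) := by gcongr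
    _ = Λ * (|u (x+k) - u x| * |u (x+k) - u x|) := by ring
    _ = _ := by rw [abs_mul_abs_self]; ring

lemma avg (d : ℕ) : ∃ C : ℝ, 0 < C ∧ ∀ w : EE d → ℝ, Continuous w → ∀ (G : ℝ≥0∞) (y : EE d),
    (∫⁻ x in ball y 2, ∫⁻ h, ENNReal.ofReal ((w (x+h) - w x)^2) ∂(kmu d) ≤ G) →
    ∀ h : EE d, ‖h‖ ≤ 1 →
    ∫⁻ x in ball y 1, ENNReal.ofReal ((w (x+h) - w x)^2) ≤ ENNReal.ofReal (C * ‖h‖) * G := by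
  set ω := volume.real (ball (0:EE d) 1) with hω
  have hωp : 0 < ω := omega_pos d
  refine ⟨4 * 4^d / ω, by positivity, fun w hw G y hG h hh => ?_⟩
  rcases eq_or_ne h 0 with h0 | h0
  · simp [h0]
  have hn : 0 < ‖h‖ := norm_pos_iff.2 h0
  set g : EE d → EE d → ℝ≥0∞ := fun x m => ENNReal.ofReal ((w (x+m) - w x)^2) with hg
  have gm : Measurable (Function.uncurry g) := by
    simp only [hg, Function.uncurry_def]; fun_prop
  set I : EE d → ℝ≥0∞ := fun m => ∫⁻ x in ball y 2, g x m with hI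
  have Im : Measurable I := Measurable.lintegral_prod_left' (f := Function.uncurry g) gm
  have hG' : ∫⁻ m, I m ∂(kmu d) ≤ G := by
    refine le_trans (le_of_eq ?_) hG
    rw [hI, lintegral_lintegral_swap (f := fun x m => g x m)]
    exact gm.aemeasurable
  set D := ball ((1/2:ℝ) • h) (‖h‖/4) with hD
  set X := ∫⁻ x in ball y 1, g x h with hX
  have mb : ∀ m ∈ D, ‖m‖ ≤ ‖h‖ ∧ ‖h - m‖ ≤ ‖h‖ ∧ 0 < ‖m‖ ∧ 0 < ‖h - m‖ := by
    intro m hm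
    rw [hD, mem_ball, dist_eq_norm] at hm
    have n2 : ‖(1/2:ℝ) • h‖ = ‖h‖/2 := by rw [norm_smul]; norm_num; ring
    have e1 : m = (m - (1/2:ℝ) • h) + (1/2:ℝ) • h := by abel
    have e2 : h - m = (1/2:ℝ) • h - (m - (1/2:ℝ) • h) := by
      have : h = (1/2:ℝ) • h + (1/2:ℝ) • h := by rw [← add_smul]; norm_num
      nth_rewrite 1 [this]; abel
    have a1 : ‖m‖ ≤ ‖m - (1/2:ℝ) • h‖ + ‖(1/2:ℝ) • h‖ := by
      calc ‖m‖ = _ := by rw [← e1]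
        _ ≤ _ := norm_add_le _ _
    have a2 : ‖h - m‖ ≤ ‖(1/2:ℝ) • h‖ + ‖m - (1/2:ℝ) • h‖ := by rw [e2]; exact norm_sub_le _ _
    have a3 : ‖h‖ ≤ ‖m‖ + ‖h - m‖ := by
      calc ‖h‖ = ‖m + (h - m)‖ := by congr 1; abel
        _ ≤ _ := norm_add_le _ _
    refine ⟨by linarith, by linarith, by linarith, by linarith⟩
  have kb : ∀ m : EE d, 0 < ‖m‖ → ‖m‖ ≤ ‖h‖ → kap d h ≤ kap d m := by
    intro m h1 h2
    unfold kap
    gcongr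
  -- pointwise in m
  have pm : ∀ m ∈ D, ENNReal.ofReal (kap d h) * X ≤
      ENNReal.ofReal 2 * (ENNReal.ofReal (kap d m) * I m) + ENNReal.ofReal 2 * (ENNReal.ofReal (kap d (h-m)) * I (h-m)) := by
    intro m hm
    obtain ⟨b1, b2, b3, b4⟩ := mb m hm
    have x1 : X ≤ ENNReal.ofReal 2 * I m + ENNReal.ofReal 2 * I (h - m) := by
      calc X ≤ ∫⁻ x in ball y 1, (ENNReal.ofReal 2 * g x m + ENNReal.ofReal 2 * g (x+m) (h-m)) := by
            refine lintegral_mono fun x => ?_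
            simp only [hg]
            rw [← ENNReal.ofReal_mul (by norm_num), ← ENNReal.ofReal_mul (by norm_num),
              ← ENNReal.ofReal_add (by positivity) (by positivity)]
            apply ENNReal.ofReal_le_ofReal
            have : x + m + (h - m) = x + h := by abel
            rw [this]
            nlinarith [sq_nonneg ((w (x+m) - w x) - (w (x+h) - w (x+m)))]
        _ = ENNReal.ofReal 2 * (∫⁻ x in ball y 1, g x m) + ENNReal.ofReal 2 * ∫⁻ x in ball y 1, g (x+m) (h-m) := by
            rw [lintegral_add_left (by fun_prop), lintegral_const_mul _ (by fun_prop),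
              lintegral_const_mul _ (by fun_prop)]
        _ ≤ _ := by
            rw [ball_shift (fun x => g x (h-m))]
            gcongr
            · exact lintegral_mono_set (ball_subset_ball (by norm_num))
            · refine lintegral_mono_set (ball_subset_ball' ?_)
              rw [dist_eq_norm, add_sub_cancel_left]; linarith
    calc _ ≤ ENNReal.ofReal (kap d h) * (ENNReal.ofReal 2 * I m + ENNReal.ofReal 2 * I (h - m)) := by gcongr
      _ = ENNReal.ofReal 2 * (ENNReal.ofReal (kap d h) * I m) + ENNReal.ofReal 2 * (ENNReal.ofReal (kap d h) * I (h-m)) := by ring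
      _ ≤ _ := by
        gcongr
        · exact kb _ b3 b1
        · exact kb _ b4 b2
  have fin : ENNReal.ofReal (kap d h) * X * volume D ≤ ENNReal.ofReal 4 * G := by
    calc _ = ∫⁻ m in D, ENNReal.ofReal (kap d h) * X := by simp
      _ ≤ ∫⁻ m in D, (ENNReal.ofReal 2 * (ENNReal.ofReal (kap d m) * I m) + ENNReal.ofReal 2 * (ENNReal.ofReal (kap d (h-m)) * I (h-m))) :=
          setLIntegral_mono' measurableSet_ball pm
      _ ≤ ∫⁻ m, (ENNReal.ofReal 2 * (ENNReal.ofReal (kap d m) * I m) + ENNReal.ofReal 2 * (ENNReal.ofReal (kap d (h-m)) * I (h-m))) :=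
          setLIntegral_le_lintegral _ _
      _ = ENNReal.ofReal 2 * (∫⁻ m, (ENNReal.ofReal (kap d m) * I m)) + ENNReal.ofReal 2 * ∫⁻ m, (ENNReal.ofReal (kap d (h-m)) * I (h-m)) := by
          rw [lintegral_add_left (by fun_prop), lintegral_const_mul _ (by fun_prop),
              lintegral_const_mul _ (by fun_prop)]
      _ = ENNReal.ofReal 4 * ∫⁻ m, I m ∂(kmu d) := by
          rw [lintegral_sub_left_eq_self (fun m => ENNReal.ofReal (kap d m) * I m) h, ← lintegral_kmu, ← add_mul,
            ← ENNReal.ofReal_add (by norm_num) (by norm_num)]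
          norm_num
      _ ≤ _ := by gcongr
  have vD : volume D = ENNReal.ofReal ((‖h‖/4)^d * ω) := by
    rw [hD, Measure.addHaar_ball_of_pos _ _ (by positivity), ENNReal.ofReal_mul (by positivity)]
    simp [hω, measure_ball_lt_top.ne]
  rw [vD, mul_right_comm, ← ENNReal.ofReal_mul (kap_nonneg _ _)] at fin
  have e : kap d h * ((‖h‖/4)^d * ω) * (4^d / ω * ‖h‖) = 1 := by
    unfold kap
    field_simp
    rw [mul_assoc, ← mul_pow, div_mul_cancel₀ _ (by norm_num), pow_succ]; ring
  calc X = ENNReal.ofReal (4^d / ω * ‖h‖) * (ENNReal.ofReal (kap d h * ((‖h‖/4)^d * ω)) * X) := by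
        rw [← mul_assoc, ← ENNReal.ofReal_mul (by positivity), mul_comm (4^d / ω * ‖h‖), e]; simp
    _ ≤ ENNReal.ofReal (4^d / ω * ‖h‖) * (ENNReal.ofReal 4 * G) := by gcongr
    _ = _ := by
        rw [← mul_assoc, ← ENNReal.ofReal_mul (by positivity)]
        congr 2; ring

noncomputable def Nn {d : ℕ} (u : EE d → ℝ) (h : EE d) : ℝ≥0∞ :=
  loc d (fun x => ENNReal.ofReal ((u (x+h) - u x)^2))

lemma loc_le {d : ℕ} {F G : EE d → ℝ≥0∞} (h : ∀ x, F x ≤ G x) : loc d F ≤ loc d G :=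
  iSup_mono fun _ => lintegral_mono h

lemma loc_const_bound {d : ℕ} {F : EE d → ℝ≥0∞} {c : ℝ} (hc : 0 ≤ c) (h : ∀ x, F x ≤ ENNReal.ofReal c) :
    loc d F ≤ ENNReal.ofReal (c * volume.real (ball (0:EE d) 1)) := by
  refine iSup_le fun y => ?_
  calc _ ≤ ∫⁻ x in ball y 1, ENNReal.ofReal c := lintegral_mono h
    _ = _ := by
      rw [setLIntegral_const, ENNReal.ofReal_mul hc, Measure.addHaar_ball_center]
      simp [measure_ball_lt_top.ne]

lemma Nn_triv {d : ℕ} {u : EE d → ℝ} (bd : ∀ x, |u x| ≤ 1) (h : EE d) :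
    Nn u h ≤ ENNReal.ofReal (4 * volume.real (ball (0:EE d) 1)) := by
  refine loc_const_bound (by norm_num) fun x => ENNReal.ofReal_le_ofReal ?_
  have a := abs_le.1 (bd (x+h))
  have b := abs_le.1 (bd x)
  nlinarith

lemma contraction (d : ℕ) (hd : 1 ≤ d) : ∃ c : ℝ, 0 < c ∧ c ≤ 1 ∧ ∀ (Λ α : ℝ) (F F' : ℝ → ℝ) (u : EE d → ℝ),
    0 ≤ Λ → Good d Λ α F F' u → ∀ h : EE d, ‖h‖ ≤ c / (Λ + 1) →
    Nn u h ≤ ENNReal.ofReal (3/8) * Nn u ((2:ℝ) • h) := by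
  obtain ⟨C1, hC1, HG⟩ := LemG d hd
  obtain ⟨C2, hC2, HA⟩ := avg d
  set K := (5/4) * (C1 * C2) * 6 + 1 with hK
  have hK1 : 1 ≤ K := by rw [hK]; have : 0 ≤ C1 * C2 := by positivity
                         linarith
  refine ⟨1/K, by positivity, by rw [div_le_one (by linarith)]; exact hK1, fun Λ α F F' u hΛ g h hh => ?_⟩
  have hh1 : ‖h‖ ≤ 1 := by
    refine hh.trans ?_
    rw [div_div, div_le_one (by positivity)]
    nlinarith
  have hcd := g.cd
  have huc := hcd.continuous
  set w : EE d → ℝ := fun x => u (x+h) - u x with hw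
  have hwc : Continuous w := by fun_prop
  have wB : ∀ x, |w x| ≤ 2 := fun x => by
    have a := abs_le.1 (g.bd (x+h))
    have b := abs_le.1 (g.bd x)
    rw [abs_le]; constructor <;> simp only [hw] <;> linarith
  have wcd : ContDiff ℝ 2 w := (hcd.comp (by fun_prop)).sub hcd
  have N2 : loc d (fun x => ENNReal.ofReal ((w (x+h) - w x)^2)) ≤
      ENNReal.ofReal (C2 * ‖h‖) * (ENNReal.ofReal (C1 * (Λ+1)) * Nn u h) := by
    refine iSup_le fun y => ?_
    exact HA w hwc _ y (HG w wcd 2 wB Λ hΛ (g.wL hd h) y) h hh1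
  have N1 : Nn u h ≤ ENNReal.ofReal (5/16) * Nn u ((2:ℝ) • h) +
      ENNReal.ofReal (5/4) * loc d (fun x => ENNReal.ofReal ((w (x+h) - w x)^2)) := by
    refine iSup_le fun y => ?_
    calc _ ≤ ∫⁻ x in ball y 1, (ENNReal.ofReal (5/16) * ENNReal.ofReal ((u (x+(2:ℝ) • h) - u x)^2)
          + ENNReal.ofReal (5/4) * ENNReal.ofReal ((w (x+h) - w x)^2)) := by
          refine lintegral_mono fun x => ?_
          rw [← ENNReal.ofReal_mul (by norm_num), ← ENNReal.ofReal_mul (by norm_num),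
              ← ENNReal.ofReal_add (by positivity) (by positivity)]
          apply ENNReal.ofReal_le_ofReal
          have e : x + (2:ℝ) • h = x + h + h := by rw [two_smul]; abel
          simp only [hw, e]
          set A := u (x+h+h); set B := u (x+h); set D := u x
          nlinarith [sq_nonneg ((A - D) + 4 * ((A - B) - (B - D)))]
      _ = ENNReal.ofReal (5/16) * (∫⁻ x in ball y 1, ENNReal.ofReal ((u (x+(2:ℝ) • h) - u x)^2))
          + ENNReal.ofReal (5/4) * (∫⁻ x in ball y 1, ENNReal.ofReal ((w (x+h) - w x)^2)) := by
          rw [lintegral_add_left (by fun_prop), lintegral_const_mul _ (by fun_prop),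
              lintegral_const_mul _ (by fun_prop)]
      _ ≤ _ := by
          gcongr
          · exact le_loc (fun x => ENNReal.ofReal ((u (x+(2:ℝ) • h) - u x)^2)) y
          · exact le_loc (fun x => ENNReal.ofReal ((w (x+h) - w x)^2)) y
  have fin : ∀ k, Nn u k ≠ ⊤ := fun k => ne_top_of_le_ne_top ENNReal.ofReal_ne_top (Nn_triv g.bd k)
  have N3 : Nn u h ≤ ENNReal.ofReal (5/16) * Nn u ((2:ℝ) • h) + ENNReal.ofReal (1/6) * Nn u h := by
    refine N1.trans ?_
    refine add_le_add le_rfl ?_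
    calc _ ≤ ENNReal.ofReal (5/4) * (ENNReal.ofReal (C2 * ‖h‖) * (ENNReal.ofReal (C1 * (Λ+1)) * Nn u h)) := by gcongr
      _ = ENNReal.ofReal (5/4 * (C2 * ‖h‖) * (C1 * (Λ+1))) * Nn u h := by
          rw [← mul_assoc, ← mul_assoc, ← ENNReal.ofReal_mul (by positivity), ← ENNReal.ofReal_mul (by positivity)]
      _ ≤ _ := by
          refine mul_le_mul_left (ENNReal.ofReal_le_ofReal ?_) _
          have : ‖h‖ * (Λ+1) ≤ 1/K := by rwa [le_div_iff₀ (by positivity)] at hh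
          calc _ = 5/4 * (C1 * C2) * (‖h‖ * (Λ+1)) := by ring
            _ ≤ 5/4 * (C1*C2) * (1/K) := by gcongr
            _ ≤ _ := by
              rw [mul_one_div, div_le_iff₀ (by positivity)]
              linarith
  lift Nn u h to ℝ≥0 using fin h with a ha
  lift Nn u ((2:ℝ) • h) to ℝ≥0 using fin _ with b hb
  simp only [ENNReal.ofReal] at N3 ⊢
  norm_cast at N3 ⊢
  have N4 : (a:ℝ) ≤ (5/16) * b + (1/6) * a := by
    have := NNReal.coe_le_coe.2 N3
    push_cast at this
    rwa [Real.coe_toNNReal _ (by norm_num), Real.coe_toNNReal _ (by norm_num)] at this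
  rw [← NNReal.coe_le_coe]
  push_cast
  rw [Real.coe_toNNReal _ (by norm_num)]
  linarith

lemma pow54_two : (3/8:ℝ) * 2 ^ (5/4:ℝ) ≤ 1 := by
  have : (2:ℝ) ^ (5/4:ℝ) ≤ 8/3 := by
    rw [show (5/4:ℝ) = 5 * (1/4) by norm_num, Real.rpow_mul (by norm_num)]
    rw [show ((2:ℝ)^(5:ℝ)) = 32 by norm_num]
    calc (32:ℝ)^(1/4:ℝ) ≤ ((8/3)^(4:ℝ))^(1/4:ℝ) := by gcongr; norm_num
      _ = 8/3 := by rw [← Real.rpow_mul (by norm_num)]; norm_num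
  linarith

/-- the decay of differences -/
lemma Nbound (d : ℕ) (hd : 1 ≤ d) : ∃ C : ℝ, 0 < C ∧ ∀ (Λ α : ℝ) (F F' : ℝ → ℝ) (u : EE d → ℝ),
    0 ≤ Λ → Good d Λ α F F' u → ∀ h : EE d,
    Nn u h ≤ ENNReal.ofReal (C * (Λ+1)^2 * ‖h‖ ^ (5/4:ℝ)) := by
  obtain ⟨c, hc, hc1, H⟩ := contraction d hd
  set ω := volume.real (ball (0:EE d) 1) with hω
  have hωp : 0 < ω := omega_pos d
  refine ⟨4 * ω * (1/c)^2, by positivity, fun Λ α F F' u hΛ g h => ?_⟩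
  set r := c / (Λ+1) with hr
  have hrp : 0 < r := by positivity
  have key : ∀ n : ℕ, ∀ h : EE d, r ≤ 2^n * ‖h‖ → Nn u h ≤ ENNReal.ofReal (4 * ω * (‖h‖/r)^(5/4:ℝ)) := by
    intro n
    induction n with
    | zero =>
      intro h hh
      refine (Nn_triv g.bd h).trans (ENNReal.ofReal_le_ofReal ?_)
      have : 1 ≤ (‖h‖/r)^(5/4:ℝ) := Real.one_le_rpow (by rw [one_le_div hrp]; simpa using hh) (by norm_num)
      nlinarith
    | succ n ih =>
      intro h hh
      rcases le_total r ‖h‖ with h1 | h1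
      · refine (Nn_triv g.bd h).trans (ENNReal.ofReal_le_ofReal ?_)
        have : 1 ≤ (‖h‖/r)^(5/4:ℝ) := Real.one_le_rpow (by rw [one_le_div hrp]; simpa using h1) (by norm_num)
        nlinarith
      · refine (H Λ α F F' u hΛ g h h1).trans ?_
        have n2 : ‖(2:ℝ) • h‖ = 2 * ‖h‖ := by rw [norm_smul]; norm_num
        have := ih ((2:ℝ) • h) (by rw [n2, ← mul_assoc, ← pow_succ]; exact hh)
        calc _ ≤ ENNReal.ofReal (3/8) * ENNReal.ofReal (4 * ω * (‖(2:ℝ) • h‖/r)^(5/4:ℝ)) := by gcongr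
          _ = ENNReal.ofReal ((3/8 * 2^(5/4:ℝ)) * (4 * ω * (‖h‖/r)^(5/4:ℝ))) := by
            rw [← ENNReal.ofReal_mul (by norm_num), n2, mul_div_assoc, Real.mul_rpow (by norm_num) (by positivity)]
            congr 1; ring
          _ ≤ _ := by
            apply ENNReal.ofReal_le_ofReal
            have : 0 ≤ 4 * ω * (‖h‖/r)^(5/4:ℝ) := by positivity
            nlinarith [pow54_two]
  rcases eq_or_ne h 0 with h0 | h0
  · subst h0
    simp [Nn, loc]
  have hn : 0 < ‖h‖ := norm_pos_iff.2 h0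
  obtain ⟨n, hn2⟩ := pow_unbounded_of_one_lt (r/‖h‖) (one_lt_two)
  refine (key n h (by rw [div_lt_iff₀ hn] at hn2; exact hn2.le)).trans (ENNReal.ofReal_le_ofReal ?_)
  have e1 : (‖h‖/r)^(5/4:ℝ) = (1/r)^(5/4:ℝ) * ‖h‖^(5/4:ℝ) := by
    rw [← Real.mul_rpow (by positivity) (by positivity)]; congr 1; ring
  have hr1 : 1 ≤ 1/r := by
    rw [one_le_div hrp, hr, div_le_one (by positivity)]; linarith
  have e2 : (1/r)^(5/4:ℝ) ≤ (1/r)^2 := by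
    rw [← Real.rpow_natCast]
    exact Real.rpow_le_rpow_of_exponent_le hr1 (by norm_num)
  have e3 : (1/r)^2 = (1/c)^2 * (Λ+1)^2 := by rw [hr]; field_simp
  rw [e1]
  calc _ ≤ 4 * ω * ((1/r)^2 * ‖h‖^(5/4:ℝ)) := by gcongr
    _ = _ := by rw [e3]; ring

lemma mollify {d : ℕ} {η : EE d → ℝ} {K ρ : ℝ} (hK : ∀ x y, |η x - η y| ≤ K * ‖x - y‖)
    (hc : Continuous η) (hs : ∀ x, ρ ≤ ‖x‖ → η x = 0) (hK0 : 0 ≤ K) {ε : ℝ} (hε : 0 < ε) (hε1 : ε ≤ 1) :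
    ∃ g : EE d → ℝ, ContDiff ℝ (⊤ : ℕ∞) g ∧ (∀ x, |g x - η x| ≤ K * ε) ∧
      (∀ x y, |g x - g y| ≤ K * ‖x - y‖) ∧ ∀ x, ρ + 1 ≤ ‖x‖ → g x = 0 := by
  let φ : ContDiffBump (0 : EE d) := ⟨ε/2, ε, by linarith, by linarith⟩
  have hli : LocallyIntegrable η volume := hc.locallyIntegrable
  refine ⟨convolution (φ.normed volume) η (ContinuousLinearMap.lsmul ℝ ℝ) volume, ?_, ?_, ?_, ?_⟩
  · exact φ.hasCompactSupport_normed.contDiff_convolution_left _ φ.contDiff_normed hli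
  · intro x
    rw [← Real.dist_eq]
    refine φ.dist_normed_convolution_le hc.aestronglyMeasurable fun y hy => ?_
    rw [Real.dist_eq]
    refine (hK y x).trans ?_
    gcongr
    rw [mem_ball, dist_eq_norm] at hy
    exact hy.le
  · intro x y
    have hi : ∀ x, Integrable (fun t => φ.normed volume t * η (x - t)) := by
      intro x
      exact Continuous.integrable_of_hasCompactSupport (by
        have := φ.continuous_normed (μ := volume); fun_prop) φ.hasCompactSupport_normed.mul_right
    simp only [convolution_def, ContinuousLinearMap.lsmul_apply, smul_eq_mul]
    rw [← integral_sub (hi x) (hi y)]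
    calc _ ≤ ∫ t, φ.normed volume t * (K * ‖x - y‖) := by
          rw [← Real.norm_eq_abs]
          refine norm_integral_le_of_norm_le (φ.integrable_normed.mul_const _) (Filter.Eventually.of_forall fun t => ?_)
          rw [← mul_sub, norm_mul, Real.norm_of_nonneg (φ.nonneg_normed t)]
          gcongr
          · exact φ.nonneg_normed t
          · have := hK (x - t) (y - t)
            simpa using this
      _ = _ := by rw [integral_mul_const, φ.integral_normed, one_mul]
  · intro x hx
    have := φ.dist_normed_convolution_le (μ := volume) (x₀ := x) (ε := 0) hc.aestronglyMeasurable fun y hy => ?_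
    · rw [hs x (by linarith)] at this
      simpa using dist_le_zero.1 this
    · rw [mem_ball, dist_eq_norm] at hy
      have h1 : ‖y - x‖ < ε := hy
      have h2 : ‖x‖ ≤ ‖y‖ + ‖y - x‖ := by
        calc ‖x‖ = ‖y - (y - x)‖ := by congr 1; abel
          _ ≤ _ := norm_sub_le _ _
      rw [hs x (by linarith), hs y (by linarith)]; simp

lemma Good.F'u {d : ℕ} {Λ α : ℝ} {F F' : ℝ → ℝ} {u : EE d → ℝ} (g : Good d Λ α F F' u) :
    Continuous (fun x => F' (u x)) ∧ ∃ B, 0 ≤ B ∧ ∀ x, |F' (u x)| ≤ B := by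
  constructor
  · exact g.cF.comp_continuous g.cd.continuous g.mem
  · obtain ⟨C, hC⟩ := isCompact_Icc.exists_bound_of_continuousOn g.cF
    refine ⟨C, (norm_nonneg _).trans (hC _ (g.mem 0)), fun x => hC _ (g.mem x)⟩

lemma ext_stab {d : ℕ} (hd : 1 ≤ d) {Λ α : ℝ} {F F' : ℝ → ℝ} {u : EE d → ℝ} (g : Good d Λ α F F' u)
    {η : EE d → ℝ} {K ρ D : ℝ} (hK : ∀ x y, |η x - η y| ≤ K * ‖x - y‖)
    (hc : Continuous η) (hs : ∀ x, ρ ≤ ‖x‖ → η x = 0) (hK0 : 0 ≤ K) (hD : ∀ x, |η x| ≤ D) :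
    ∫ x, F' (u x) * (η x)^2 ≤ ∫ p : EE d × EE d, (η (p.1+p.2) - η p.1)^2 ∂(volume.prod (kmu d)) := by
  have hD0 : 0 ≤ D := (abs_nonneg _).trans (hD 0)
  have hpos : ∀ n : ℕ, 0 < 1 / ((n:ℝ) + 1) := fun n => by positivity
  have hle : ∀ n : ℕ, 1 / ((n:ℝ) + 1) ≤ 1 := fun n => by
    rw [div_le_one (by positivity)]; linarith [(Nat.cast_nonneg n : (0:ℝ) ≤ n)]
  choose G Gc Gη GK Gs using fun n : ℕ => mollify hK hc hs hK0 (hpos n) (hle n)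
  have Gcont : ∀ n, Continuous (G n) := fun n => (Gc n).continuous
  have GD : ∀ n x, |G n x| ≤ D + K := by
    intro n x
    have := Gη n x
    have h2 : |G n x| ≤ |G n x - η x| + |η x| := by
      calc |G n x| = |(G n x - η x) + η x| := by congr 1; ring
        _ ≤ _ := abs_add_le _ _
    nlinarith [hD x, hle n]
  have Glim : ∀ x, Filter.Tendsto (fun n => G n x) Filter.atTop (nhds (η x)) := by
    intro x
    rw [tendsto_iff_dist_tendsto_zero]
    refine squeeze_zero (fun _ => dist_nonneg) (fun n => (Real.dist_eq _ _).le.trans (Gη n x)) ?_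
    simpa using tendsto_one_div_add_atTop_nhds_zero_nat.const_mul K
  obtain ⟨Fc, B, hB0, hB⟩ := g.F'u
  have hst : ∀ n, ∫ x, F' (u x) * (G n x)^2 ≤ ∫ p : EE d × EE d, (G n (p.1+p.2) - G n p.1)^2 ∂(volume.prod (kmu d)) := by
    intro n
    refine g.stab (G n) (Gc n) (HasCompactSupport.intro (isCompact_closedBall (0:EE d) (ρ+1)) fun x hx => Gs n x ?_)
    simp at hx; exact hx.le
  refine le_of_tendsto_of_tendsto' (b := Filter.atTop) ?_ ?_ hst
  · refine tendsto_integral_of_dominated_convergence (fun x => (B * (D+K)^2) * bi (ρ+1) x) ?_ ((bi_int _).const_mul _) ?_ ?_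
    · intro n
      exact (Fc.mul ((Gcont n).pow 2)).aestronglyMeasurable
    · intro n
      refine Filter.Eventually.of_forall fun x => ?_
      by_cases hx : ‖x‖ < ρ + 1
      · rw [bi_one hx, mul_one, norm_mul, norm_pow]
        gcongr
        · exact hB x
        · exact GD n x
      · rw [Gs n x (by linarith), bi_zero hx]; simp
    · refine Filter.Eventually.of_forall fun x => ?_
      exact ((Glim x).pow 2).const_mul _
  · refine tendsto_integral_of_dominated_convergence
      (fun p => (K^2 + 4*(D+K)^2) * (mh d p.2 * bi (ρ+1) (p.1 + (0:ℝ) • p.2) + mh d p.2 * bi (ρ+1) (p.1 + (1:ℝ) • p.2))) ?_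
      (((int_shift hd (ρ+1) 0).add (int_shift hd (ρ+1) 1)).const_mul _) ?_ ?_
    · intro n
      have := Gcont n
      exact Continuous.aestronglyMeasurable (by fun_prop)
    · intro n
      refine Filter.Eventually.of_forall fun p => ?_
      obtain ⟨x, h⟩ := p
      simp only [zero_smul, add_zero, one_smul]
      rw [Real.norm_of_nonneg (sq_nonneg _)]
      have n0 := bi_nonneg (ρ+1) x
      have n1 := bi_nonneg (ρ+1) (x+h)
      have n3 := mh_nonneg h
      by_cases hx : ‖x‖ < ρ+1 ∨ ‖x+h‖ < ρ+1
      · have one : 1 ≤ bi (ρ+1) x + bi (ρ+1) (x+h) := by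
          rcases hx with hx | hx
          · rw [bi_one hx]; linarith
          · rw [bi_one hx]; linarith
        have : (G n (x+h) - G n x)^2 ≤ (K^2 + 4*(D+K)^2) * mh d h := by
          rcases le_total ‖h‖ 1 with h1 | h1
          · have a := GK n (x+h) x
            simp only [add_sub_cancel_left] at a
            have b := pow_le_pow_left₀ (abs_nonneg _) a 2
            rw [sq_abs, mul_pow] at b
            nlinarith [sq_le_mh h h1, sq_nonneg K, sq_nonneg (D+K)]
          · rw [mh_eq_one h h1, mul_one]
            have a := abs_le.1 (GD n (x+h))
            have b := abs_le.1 (GD n x)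
            have : (G n (x+h) - G n x)^2 ≤ (2*(D+K))^2 := sq_le_sq' (by linarith) (by linarith)
            nlinarith [sq_nonneg K]
        calc _ ≤ (K^2 + 4*(D+K)^2) * mh d h * 1 := by linarith
          _ ≤ (K^2 + 4*(D+K)^2) * mh d h * (bi (ρ+1) x + bi (ρ+1) (x+h)) := by gcongr
          _ = _ := by ring
      · push Not at hx
        rw [Gs n _ hx.1, Gs n _ hx.2]; simp; positivity
    · refine Filter.Eventually.of_forall fun p => ?_
      exact ((Glim _).sub (Glim _)).pow 2

lemma pow_taylor (n : ℕ) : ∃ C : ℝ, 0 ≤ C ∧ ∀ y : ℝ, 0 ≤ y → y ≤ 2 →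
    |y^n - 1 - n * (y - 1)| ≤ C * (y-1)^2 := by
  induction n with
  | zero => exact ⟨0, le_rfl, fun y _ _ => by simp⟩
  | succ n ih =>
    obtain ⟨C, hC, h⟩ := ih
    refine ⟨2*C + n, by positivity, fun y h0 h2 => ?_⟩
    have e : y^(n+1) - 1 - ((n+1:ℕ):ℝ) * (y-1) = y * (y^n - 1 - n*(y-1)) + n * (y-1)^2 := by
      push_cast; ring
    rw [e]
    refine (abs_add_le _ _).trans ?_
    rw [abs_mul, abs_of_nonneg h0, abs_of_nonneg (by positivity : 0 ≤ (n:ℝ) * (y-1)^2)]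
    have := h y h0 h2
    calc _ ≤ 2 * (C * (y-1)^2) + n * (y-1)^2 := by gcongr
      _ = _ := by ring

lemma inv_pow_taylor (n : ℕ) : ∃ C : ℝ, 0 ≤ C ∧ ∀ s : ℝ, 1/2 ≤ s →
    |(s^n)⁻¹ - 1 + n * (s - 1)| ≤ C * (s-1)^2 := by
  obtain ⟨C, hC, h⟩ := pow_taylor n
  refine ⟨4*C + 2*n, by positivity, fun s hs => ?_⟩
  have hs0 : 0 < s := by linarith
  have hy2 : s⁻¹ ≤ 2 := by rw [inv_le_comm₀ hs0 (by norm_num)]; linarith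
  have := h s⁻¹ (by positivity) hy2
  have e1 : s⁻¹ - 1 = -(s-1) * s⁻¹ := by field_simp; ring
  have e : (s^n)⁻¹ - 1 + n * (s - 1) = ((s⁻¹)^n - 1 - n * (s⁻¹ - 1)) + n * ((s-1)^2 * s⁻¹) := by
    rw [inv_pow]
    have : (s - 1) + (s⁻¹ - 1) = (s-1)^2 * s⁻¹ := by field_simp; ring
    rw [← this]; ring
  rw [e]
  refine (abs_add_le _ _).trans ?_
  rw [abs_of_nonneg (by positivity : 0 ≤ (n:ℝ) * ((s-1)^2 * s⁻¹))]
  have h4 : (s⁻¹)^2 ≤ 4 := by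
    have : 0 ≤ s⁻¹ := by positivity
    nlinarith
  calc _ ≤ C * (s⁻¹ - 1)^2 + n * ((s-1)^2 * 2) := by gcongr
    _ = C * ((s-1)^2 * (s⁻¹)^2) + n * ((s-1)^2 * 2) := by rw [e1]; ring
    _ ≤ C * ((s-1)^2 * 4) + n * ((s-1)^2 * 2) := by gcongr
    _ = _ := by ring

lemma norm_second {d : ℕ} (z e : EE d) (hz : 0 < ‖z‖) :
    0 ≤ ‖z+e‖ + ‖z-e‖ - 2*‖z‖ ∧ ‖z+e‖ + ‖z-e‖ - 2*‖z‖ ≤ ‖e‖^2/‖z‖ := by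
  constructor
  · have : 2 * ‖z‖ = ‖(z+e) + (z-e)‖ := by
      rw [show (z+e) + (z-e) = (2:ℝ) • z by rw [two_smul]; abel, norm_smul]; norm_num
    have := norm_add_le (z+e) (z-e)
    linarith
  · have par := parallelogram_law_with_norm ℝ z e
    have : ‖z+e‖ + ‖z-e‖ ≤ 2*‖z‖ + ‖e‖^2/‖z‖ := by
      apply (pow_le_pow_iff_left₀ (by positivity) (by positivity) two_ne_zero).1
      have e1 : (2*‖z‖ + ‖e‖^2/‖z‖)^2 = 4*‖z‖^2 + 4*‖e‖^2 + (‖e‖^2/‖z‖)^2 := by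
        field_simp; ring
      rw [e1]
      nlinarith [sq_nonneg (‖z+e‖ - ‖z-e‖), sq_nonneg (‖e‖^2/‖z‖)]
    linarith

lemma kap_ratio {d : ℕ} (z y : EE d) (hz : 0 < ‖z‖) : kap d y = kap d z * ((‖y‖/‖z‖)^(d+1))⁻¹ := by
  unfold kap
  rw [div_pow]; field_simp

lemma kap_diff (d : ℕ) : ∃ C : ℝ, 0 ≤ C ∧ ∀ z e : EE d, 0 < ‖z‖ → 2 * ‖e‖ ≤ ‖z‖ →
    ‖z‖ * |kap d (z+e) - kap d z| ≤ C * ‖e‖ * kap d z ∧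
    ‖z‖^2 * |kap d (z+e) + kap d (z-e) - 2 * kap d z| ≤ C * ‖e‖^2 * kap d z := by
  obtain ⟨C, hC, h⟩ := inv_pow_taylor (d+1)
  refine ⟨2*C + (d+1:ℕ), by positivity, fun z e hz he => ?_⟩
  set N : ℝ := ((d+1:ℕ):ℝ) with hN
  have hN0 : 0 ≤ N := by positivity
  set r := ‖e‖/‖z‖ with hr
  have hr0 : 0 ≤ r := by positivity
  have hr2 : r ≤ 1/2 := by rw [hr, div_le_iff₀ hz]; linarith
  have hez : ‖e‖ = r * ‖z‖ := by rw [hr]; field_simp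
  set a := ‖z+e‖/‖z‖ with ha
  set b := ‖z-e‖/‖z‖ with hb
  have ha1 : |a - 1| ≤ r := by
    have : a - 1 = (‖z+e‖ - ‖z‖)/‖z‖ := by rw [ha]; field_simp
    rw [this, abs_div, abs_of_pos hz, hr]
    gcongr
    have := abs_norm_sub_norm_le (z+e) z
    simpa using this
  have hb1 : |b - 1| ≤ r := by
    have : b - 1 = (‖z-e‖ - ‖z‖)/‖z‖ := by rw [hb]; field_simp
    rw [this, abs_div, abs_of_pos hz, hr]
    gcongr
    have := abs_norm_sub_norm_le (z-e) z
    simpa using this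
  have hab : |a + b - 2| ≤ r^2 := by
    obtain ⟨n1, n2⟩ := norm_second z e hz
    have : a + b - 2 = (‖z+e‖ + ‖z-e‖ - 2*‖z‖)/‖z‖ := by rw [ha, hb]; field_simp
    rw [this, abs_of_nonneg (by positivity), div_le_iff₀ hz]
    refine n2.trans (le_of_eq ?_)
    rw [hez]; field_simp
  have ta := h a (by have := (abs_le.1 ha1).1; linarith)
  have tb := h b (by have := (abs_le.1 hb1).1; linarith)
  have a2 : (a-1)^2 ≤ r^2 := by rw [← sq_abs]; gcongr
  have b2 : (b-1)^2 ≤ r^2 := by rw [← sq_abs]; gcongr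
  have hk := kap_nonneg d z
  rw [kap_ratio z (z+e) hz, kap_ratio z (z-e) hz, ← ha, ← hb]
  set A := (a^(d+1))⁻¹
  set B := (b^(d+1))⁻¹
  constructor
  · have e1 : kap d z * A - kap d z = kap d z * (A - 1) := by ring
    rw [e1, abs_mul, abs_of_nonneg hk, hez]
    have : |A - 1| ≤ (2*C + N) * r := by
      have : A - 1 = (A - 1 + N * (a-1)) - N * (a - 1) := by ring
      rw [this]
      refine (abs_sub _ _).trans ?_
      rw [abs_mul, abs_of_nonneg hN0]
      calc _ ≤ C * (a-1)^2 + N * r := by gcongr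
        _ ≤ C * r^2 + N * r := by gcongr
        _ ≤ _ := by nlinarith [mul_nonneg hC hr0]
    calc _ ≤ ‖z‖ * (kap d z * ((2*C + N) * r)) := by gcongr
      _ = _ := by ring
  · have e1 : kap d z * A + kap d z * B - 2 * kap d z = kap d z * (A + B - 2) := by ring
    rw [e1, abs_mul, abs_of_nonneg hk, hez]
    have : |A + B - 2| ≤ (2*C + N) * r^2 := by
      have : A + B - 2 = (A - 1 + N * (a-1)) + (B - 1 + N * (b-1)) - N * (a + b - 2) := by ring
      rw [this]
      refine (abs_sub _ _).trans ?_
      rw [abs_mul, abs_of_nonneg hN0]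
      calc _ ≤ (C * (a-1)^2 + C * (b-1)^2) + N * r^2 := by
            gcongr
            exact (abs_add_le _ _).trans (add_le_add ta tb)
        _ ≤ (C * r^2 + C * r^2) + N * r^2 := by gcongr
        _ = _ := by ring
    calc _ ≤ ‖z‖^2 * (kap d z * ((2*C + N) * r^2)) := by gcongr
      _ = _ := by ring

noncomputable def GG {d : ℕ} (x y : EE d) : ℝ := (cut 1 x - cut 1 y)^2 * kap d (y - x)

lemma GG_nonneg {d : ℕ} (x y : EE d) : 0 ≤ GG x y := mul_nonneg (sq_nonneg _) (kap_nonneg _ _)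

noncomputable def SS {d : ℕ} (e x y : EE d) : ℝ :=
  GG (x-e) (y-e) - GG (x-e) y - GG x (y-e) + GG x y

lemma SS_zero {d : ℕ} {e x y : EE d} (he : ‖e‖ ≤ 1) (hx : 3 ≤ ‖x‖) (hy : 3 ≤ ‖y‖) : SS e x y = 0 := by
  have h1 : 2 ≤ ‖x - e‖ := by have := norm_sub_norm_le x e; linarith
  have h2 : 2 ≤ ‖y - e‖ := by have := norm_sub_norm_le y e; linarith
  unfold SS GG
  rw [cut_zero (x := x) (by linarith), cut_zero (x := y) (by linarith), cut_zero (x := x-e) (by linarith),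
    cut_zero (x := y-e) (by linarith)]
  simp

lemma SS_far (d : ℕ) : ∃ C : ℝ, 0 ≤ C ∧ ∀ e x y : EE d, x ≠ y → 2 * ‖e‖ ≤ ‖y - x‖ →
    |SS e x y| ≤ C * ‖e‖^2 * kap d (y - x) := by
  obtain ⟨C, hC, h⟩ := kap_diff d
  refine ⟨2 + 9*C, by positivity, fun e x y hxy he => ?_⟩
  have hz : 0 < ‖y - x‖ := norm_pos_iff.2 (sub_ne_zero.2 hxy.symm)
  set z := y - x with hzd
  obtain ⟨_, k2⟩ := h z e hz he
  obtain ⟨k1, _⟩ := h z (-e) hz (by simpa using he)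
  have hk := kap_nonneg d z
  rw [← sub_eq_add_neg, norm_neg] at k1
  have z1 : y - e - (x - e) = z := by rw [hzd]; abel
  have z2 : y - (x - e) = z + e := by rw [hzd]; abel
  have z3 : y - e - x = z - e := by rw [hzd]; abel
  unfold SS GG
  rw [z1, z2, z3, ← hzd]
  have l1 : |cut 1 x - cut 1 (x-e)| ≤ ‖e‖ := by simpa using cut_lip 1 x (x-e)
  have l2 : |cut 1 y - cut 1 (y-e)| ≤ ‖e‖ := by simpa using cut_lip 1 y (y-e)
  have l3 : |cut 1 (x-e) - cut 1 y| ≤ 3/2 * ‖z‖ := by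
    refine (cut_lip 1 (x-e) y).trans ?_
    rw [norm_sub_rev, z2]
    refine (norm_add_le _ _).trans (by linarith)
  have l4 : |cut 1 x - cut 1 (y-e)| ≤ 3/2 * ‖z‖ := by
    refine (cut_lip 1 x (y-e)).trans ?_
    rw [norm_sub_rev, z3]
    refine (norm_sub_le _ _).trans (by linarith)
  set p := cut 1 x; set p' := cut 1 (x-e); set q := cut 1 y; set q' := cut 1 (y-e)
  set k := kap d z; set kp := kap d (z+e); set km := kap d (z-e)
  have id : (p'-q')^2 * k - (p'-q)^2 * kp - (p-q')^2 * km + (p-q)^2 * k =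
      -2 * ((p-p')*(q-q')*k) - (p'-q)^2 * (kp + km - 2*k) +
      (-((p-p')) + -(q-q')) * ((p'-q) + (p-q')) * (km - k) := by ring
  rw [id]
  have t1 : |(-2:ℝ) * ((p-p')*(q-q')*k)| ≤ 2 * ‖e‖^2 * k := by
    rw [abs_mul, abs_mul, abs_mul, abs_of_nonneg hk]
    norm_num
    calc _ ≤ 2 * (‖e‖ * ‖e‖ * k) := by gcongr
      _ = _ := by ring
  have t2 : |(p'-q)^2 * (kp + km - 2*k)| ≤ 9/4 * C * ‖e‖^2 * k := by
    rw [abs_mul, abs_of_nonneg (sq_nonneg _), ← sq_abs]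
    calc _ ≤ (3/2 * ‖z‖)^2 * |kp + km - 2*k| := by gcongr
      _ = 9/4 * (‖z‖^2 * |kp + km - 2*k|) := by ring
      _ ≤ 9/4 * (C * ‖e‖^2 * k) := by gcongr
      _ = _ := by ring
  have t3 : |(-((p-p')) + -(q-q')) * ((p'-q) + (p-q')) * (km - k)| ≤ 6 * C * ‖e‖^2 * k := by
    rw [abs_mul, abs_mul]
    have u1 : |-(p-p') + -(q-q')| ≤ 2 * ‖e‖ := by
      refine (abs_add_le _ _).trans ?_
      rw [abs_neg, abs_neg]; linarith
    have u2 : |(p'-q) + (p-q')| ≤ 3 * ‖z‖ := (abs_add_le _ _).trans (by linarith)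
    calc _ ≤ (2 * ‖e‖) * (3 * ‖z‖) * |km - k| := by gcongr
      _ = 6 * ‖e‖ * (‖z‖ * |km - k|) := by ring
      _ ≤ 6 * ‖e‖ * (C * ‖e‖ * k) := by gcongr
      _ = _ := by ring
  refine (abs_add_le _ _).trans ((add_le_add_left (abs_sub _ _) _).trans ?_)
  have : 0 ≤ C * ‖e‖^2 * k := by positivity
  nlinarith

lemma conv_l {d : ℕ} {G : EE d × EE d → ℝ≥0∞} (hG : Measurable G) :
    ∫⁻ p, G (p.1, p.1 + p.2) ∂((volume : Measure (EE d)).prod (kmu d)) =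
      ∫⁻ p : EE d × EE d, ENNReal.ofReal (kap d (p.2 - p.1)) * G p ∂(volume.prod volume) := by
  rw [lintegral_prod _ (by fun_prop), lintegral_prod _ (by fun_prop)]
  congr 1; ext x
  rw [lintegral_kmu]
  have := lintegral_add_left_eq_self (μ := volume) (fun y => ENNReal.ofReal (kap d (y - x)) * G (x,y)) x
  rw [← this]
  simp

lemma conv_mp (d : ℕ) : MeasurePreserving (MeasurableEquiv.shearAddRight (EE d))
    ((volume : Measure (EE d)).prod (kmu d))
    (((volume : Measure (EE d)).prod volume).withDensity
      (fun p => ((Real.toNNReal (kap d (p.2 - p.1)) : ℝ≥0) : ℝ≥0∞))) := by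
  refine ⟨(MeasurableEquiv.shearAddRight (EE d)).measurable, ?_⟩
  ext s hs
  rw [Measure.map_apply (MeasurableEquiv.shearAddRight (EE d)).measurable hs, withDensity_apply _ hs,
    ← lintegral_indicator_one ((MeasurableEquiv.shearAddRight (EE d)).measurable hs),
    ← lintegral_indicator hs]
  have := conv_l (G := s.indicator 1) (measurable_one.indicator hs)
  refine Eq.trans ?_ (this.trans ?_)
  · rfl
  · congr 1; ext p
    by_cases hp : p ∈ s <;> simp [hp, ENNReal.ofReal]

lemma conv_i {d : ℕ} (G : EE d × EE d → ℝ) :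
    ∫ p, G (p.1, p.1 + p.2) ∂((volume : Measure (EE d)).prod (kmu d)) =
      ∫ p : EE d × EE d, kap d (p.2 - p.1) * G p ∂(volume.prod volume) := by
  have := (conv_mp d).integral_comp' (g := G)
  refine Eq.trans this ?_
  rw [integral_withDensity_eq_integral_smul (by fun_prop)]
  congr 1; ext p
  rw [NNReal.smul_def, smul_eq_mul, Real.coe_toNNReal _ (kap_nonneg _ _)]

lemma conv_int {d : ℕ} (G : EE d × EE d → ℝ)
    (h : Integrable (fun p : EE d × EE d => G (p.1, p.1 + p.2)) ((volume : Measure (EE d)).prod (kmu d))) :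
    Integrable (fun p : EE d × EE d => kap d (p.2 - p.1) * G p) (volume.prod volume) := by
  have := ((conv_mp d).integrable_comp_emb (MeasurableEquiv.shearAddRight (EE d)).measurableEmbedding
    (g := G)).1 h
  rw [integrable_withDensity_iff_integrable_smul (by fun_prop)] at this
  refine this.congr (Filter.Eventually.of_forall fun p => ?_)
  simp only
  rw [NNReal.smul_def, smul_eq_mul, Real.coe_toNNReal _ (kap_nonneg _ _)]

lemma GG_int {d : ℕ} (hd : 1 ≤ d) {H : EE d × EE d → ℝ} (hH : Continuous H) {B : ℝ}
    (hB : ∀ p, |H p| ≤ B) :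
    Integrable (fun p : EE d × EE d => H p * GG p.1 p.2) (volume.prod volume) := by
  have := conv_int (fun p : EE d × EE d => H p * (cut 1 p.2 - cut 1 p.1)^2)
    (int_cut hd 1 (H := fun p => H (p.1, p.1+p.2)) (by fun_prop) fun p => hB _)
  refine this.congr (Filter.Eventually.of_forall fun p => ?_)
  simp only [GG]; ring

lemma comb4 {X : Type*} [MeasurableSpace X] {μ : Measure X} {A B C D : X → ℝ} (hA : Integrable A μ)
    (hB : Integrable B μ) (hC : Integrable C μ) (hD : Integrable D μ) :
    ∫ x, (A x - B x - C x + D x) ∂μ = (∫ x, A x ∂μ) - (∫ x, B x ∂μ) - (∫ x, C x ∂μ) + ∫ x, D x ∂μ := by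
  have h1 : Integrable (fun x => A x - B x) μ := hA.sub hB
  have h2 : Integrable (fun x => A x - B x - C x) μ := h1.sub hC
  rw [integral_add h2 hD, integral_sub h1 hC, integral_sub hA hB]

lemma main_id {d : ℕ} (hd : 1 ≤ d) {u : EE d → ℝ} (hu : Continuous u) (bd : ∀ x, |u x| ≤ 1) (e : EE d) :
    Integrable (fun p : EE d × EE d => (u p.1 - u p.2)^2 * SS e p.1 p.2) (volume.prod volume) ∧
    ∫ p : EE d × EE d, ((u (p.1+e) - u p.1) * (u (p.1 + p.2 + e) - u (p.1 + p.2))) *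
      (cut 1 (p.1+p.2) - cut 1 p.1)^2 ∂(volume.prod (kmu d)) =
    -(1/2) * ∫ p : EE d × EE d, (u p.1 - u p.2)^2 * SS e p.1 p.2 ∂(volume.prod volume) := by
  have bU : ∀ x y, |(u x - u y)^2| ≤ 4 := fun x y => by
    rw [abs_of_nonneg (sq_nonneg _)]
    have := abs_le.1 (bd x); have := abs_le.1 (bd y)
    nlinarith
  have I : ∀ a b : EE d, Integrable (fun p : EE d × EE d => (u (p.1+a) - u (p.2+b))^2 * GG p.1 p.2)
      (volume.prod volume) := fun a b => GG_int hd (by fun_prop) (fun p => bU _ _)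
  have J : ∀ a b : EE d, Integrable (fun p : EE d × EE d => (u p.1 - u p.2)^2 * GG (p.1-a) (p.2-b))
      (volume.prod volume) := fun a b => by
    have := (I a b).comp_add_right (-a,-b)
    refine this.congr (Filter.Eventually.of_forall fun p => ?_)
    simp [← sub_eq_add_neg]
  have T : ∀ a b : EE d, ∫ p : EE d × EE d, (u (p.1+a) - u (p.2+b))^2 * GG p.1 p.2 ∂(volume.prod volume)
      = ∫ p : EE d × EE d, (u p.1 - u p.2)^2 * GG (p.1-a) (p.2-b) ∂(volume.prod volume) := fun a b => by
    rw [← integral_add_right_eq_self (fun p : EE d × EE d => (u p.1 - u p.2)^2 * GG (p.1-a) (p.2-b)) (a,b)]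
    simp
  have JJ := (((J e e).sub (J e 0)).sub (J 0 e)).add (J 0 0)
  have eS : ∀ p : EE d × EE d, (u p.1 - u p.2)^2 * SS e p.1 p.2 =
    (u p.1 - u p.2)^2 * GG (p.1-e) (p.2-e) - (u p.1 - u p.2)^2 * GG (p.1-e) (p.2-0)
     - (u p.1 - u p.2)^2 * GG (p.1-0) (p.2-e) + (u p.1 - u p.2)^2 * GG (p.1-0) (p.2-0) := fun p => by
    simp only [SS, sub_zero]; ring
  constructor
  · exact JJ.congr (Filter.Eventually.of_forall fun p => (eS p).symm)
  · rw [conv_i (fun p : EE d × EE d => ((u (p.1+e) - u p.1) * (u (p.2 + e) - u (p.2))) *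
      (cut 1 p.2 - cut 1 p.1)^2)]
    simp_rw [eS]
    rw [comb4 (J e e) (J e 0) (J 0 e) (J 0 0), ← T, ← T, ← T, ← T,
      ← comb4 (I e e) (I e 0) (I 0 e) (I 0 0), ← integral_const_mul]
    congr 1; ext p
    simp only [GG, add_zero]; ring

noncomputable def EN {d : ℕ} (u : EE d → ℝ) : ℝ≥0∞ :=
  ∫⁻ x in ball (0:EE d) 3, ∫⁻ h, ENNReal.ofReal ((u (x+h) - u x)^2) ∂(kmu d)

lemma near_GG (d : ℕ) (hd : 1 ≤ d) : ∃ C : ℝ, 0 ≤ C ∧ ∀ ε : ℝ, 0 < ε →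
    ∫⁻ p : EE d × EE d, ({p | ‖p.2 - p.1‖ < ε} : Set (EE d × EE d)).indicator
      (fun p => ENNReal.ofReal (GG p.1 p.2)) p ∂(volume.prod volume) ≤ ENNReal.ofReal (C * ε^(1/4:ℝ)) := by
  set V := volume.real (ball (0:EE d) 2) with hV
  refine ⟨2 * V * (cdd d * 4), by have := cdd_nonneg d; positivity, fun ε hε => ?_⟩
  have c1 : Continuous (cut (d := d) 1) := cut_cont 1
  have hms : MeasurableSet {p : EE d × EE d | ‖p.2 - p.1‖ < ε} :=
    measurableSet_lt (by fun_prop) measurable_const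
  have key := conv_l (d := d) (G := ({p | ‖p.2 - p.1‖ < ε} : Set (EE d × EE d)).indicator
    (fun p => ENNReal.ofReal ((cut 1 p.1 - cut 1 p.2)^2)))
    (Measurable.indicator (by fun_prop) hms)
  have e1 : ∀ p : EE d × EE d, ({p | ‖p.2 - p.1‖ < ε} : Set (EE d × EE d)).indicator
      (fun p => ENNReal.ofReal (GG p.1 p.2)) p = ENNReal.ofReal (kap d (p.2 - p.1)) *
      ({p | ‖p.2 - p.1‖ < ε} : Set (EE d × EE d)).indicator
    (fun p => ENNReal.ofReal ((cut 1 p.1 - cut 1 p.2)^2)) p := fun p => by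
    by_cases hp : p ∈ {p : EE d × EE d | ‖p.2 - p.1‖ < ε}
    · rw [indicator_of_mem hp, indicator_of_mem hp, ← ENNReal.ofReal_mul (kap_nonneg _ _), GG, mul_comm]
    · rw [indicator_of_notMem hp, indicator_of_notMem hp, mul_zero]
  simp_rw [e1]
  rw [← key, lintegral_prod_symm _ (by
    apply Measurable.aemeasurable
    exact (Measurable.indicator (by fun_prop) hms).comp (by fun_prop))]
  have inner : ∀ h : EE d, ∫⁻ x : EE d, ({p | ‖p.2 - p.1‖ < ε} : Set (EE d × EE d)).indicator
    (fun p => ENNReal.ofReal ((cut 1 p.1 - cut 1 p.2)^2)) (x, x+h) ≤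
    ENNReal.ofReal (2*V) * (ball (0:EE d) ε).indicator (fun h => ENNReal.ofReal (‖h‖^(5/4:ℝ))) h := by
    intro h
    by_cases hh : ‖h‖ < ε
    · rw [indicator_of_mem (by simpa using hh)]
      calc _ ≤ ∫⁻ x : EE d, (ENNReal.ofReal (bi 2 x) + ENNReal.ofReal (bi 2 (x+h))) *
              ENNReal.ofReal (‖h‖^(5/4:ℝ)) := by
            refine lintegral_mono fun x => ?_
            rw [indicator_of_mem (by simpa using hh), ← ENNReal.ofReal_add (bi_nonneg _ _) (bi_nonneg _ _),
              ← ENNReal.ofReal_mul (add_nonneg (bi_nonneg _ _) (bi_nonneg _ _))]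
            apply ENNReal.ofReal_le_ofReal
            have := cut_sq_bi (r := 1) x h
            norm_num at this
            have n0 := bi_nonneg 2 x
            have n1 := bi_nonneg 2 (x+h)
            calc (cut 1 x - cut 1 (x+h))^2 = (cut 1 (x+h) - cut 1 x)^2 := by ring
              _ ≤ _ := this
              _ ≤ ‖h‖^(5/4:ℝ) * (bi 2 x + bi 2 (x+h)) := by
                gcongr; exact min_le_right _ _
              _ = _ := by ring
        _ = _ := by
            rw [lintegral_mul_const _ (by fun_prop), lintegral_add_left (by fun_prop),
              lintegral_add_right_eq_self (fun x => ENNReal.ofReal (bi 2 x)) h,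
              ← ofReal_integral_eq_lintegral_ofReal (bi_int 2) (Filter.Eventually.of_forall (bi_nonneg 2))]
            have : ∫ x : EE d, bi 2 x = V := by
              unfold bi; rw [integral_indicator measurableSet_ball]; simp [hV]
            rw [this, ← ENNReal.ofReal_add (by positivity) (by positivity), two_mul]
    · refine le_of_eq_of_le ?_ zero_le
      rw [lintegral_eq_zero_iff']
      · refine Filter.Eventually.of_forall fun x => ?_
        simp [hh]
      · apply Measurable.aemeasurable
        exact (Measurable.indicator (by fun_prop) hms).comp (by fun_prop)
  calc _ ≤ ∫⁻ h, ENNReal.ofReal (2*V) * (ball (0:EE d) ε).indicator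
        (fun h => ENNReal.ofReal (‖h‖^(5/4:ℝ))) h ∂(kmu d) := lintegral_mono inner
    _ = ENNReal.ofReal (2*V) * ∫⁻ h in ball (0:EE d) ε, ENNReal.ofReal (‖h‖^(5/4:ℝ)) ∂(kmu d) := by
        rw [lintegral_const_mul _ (Measurable.indicator (by fun_prop) measurableSet_ball),
          lintegral_indicator measurableSet_ball]
    _ ≤ ENNReal.ofReal (2*V) * ENNReal.ofReal (cdd d * (4 * ε ^ (1/4:ℝ))) := by
        gcongr; exact I_near hd hε
    _ = _ := by rw [← ENNReal.ofReal_mul (by positivity)]; congr 1; ring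

lemma EN_eq {d : ℕ} {u : EE d → ℝ} (hu : Continuous u) :
    ∫⁻ p : EE d × EE d, ENNReal.ofReal ((u (p.1+p.2) - u p.1)^2) * ENNReal.ofReal (bi 3 p.1)
      ∂(volume.prod (kmu d)) = EN u := by
  rw [lintegral_prod _ (by fun_prop), EN, ← lintegral_indicator measurableSet_ball]
  congr 1; ext x
  dsimp only
  rw [lintegral_mul_const _ (by fun_prop)]
  by_cases hx : ‖x‖ < 3
  · rw [indicator_of_mem (by simpa using hx), bi_one hx]; simp
  · rw [indicator_of_notMem (by simpa using hx), bi_zero hx]; simp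

lemma EN_eq2 {d : ℕ} {u : EE d → ℝ} (hu : Continuous u) :
    ∫⁻ p : EE d × EE d, ENNReal.ofReal (kap d (p.2 - p.1)) * (ENNReal.ofReal ((u p.1 - u p.2)^2) *
      (ENNReal.ofReal (bi 3 p.1) + ENNReal.ofReal (bi 3 p.2))) ∂(volume.prod volume) = EN u + EN u := by
  rw [← conv_l (G := fun p : EE d × EE d => ENNReal.ofReal ((u p.1 - u p.2)^2) *
      (ENNReal.ofReal (bi 3 p.1) + ENNReal.ofReal (bi 3 p.2))) (by fun_prop)]
  simp_rw [mul_add]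
  rw [lintegral_add_left (by fun_prop)]
  congr 1
  · rw [← EN_eq hu]; congr 1; ext p; congr 2; ring
  · rw [← EN_eq hu, ← lsym (by fun_prop)]
    congr 1; ext p; simp

lemma main_bound (d : ℕ) (hd : 1 ≤ d) : ∃ C : ℝ, 0 ≤ C ∧ ∀ u : EE d → ℝ, ContDiff ℝ 2 u →
    (∀ x, |u x| ≤ 1) → ∃ Cu : ℝ, 0 ≤ Cu ∧ ∀ e : EE d, e ≠ 0 → ‖e‖ ≤ 1 →
    ENNReal.ofReal (∫ p : EE d × EE d, ((u (p.1+e) - u p.1) * (u (p.1 + p.2 + e) - u (p.1 + p.2))) *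
      (cut 1 (p.1+p.2) - cut 1 p.1)^2 ∂(volume.prod (kmu d))) ≤
    ENNReal.ofReal (C * ‖e‖^2) * EN u + ENNReal.ofReal (Cu * ‖e‖^2 * ‖e‖^(1/4:ℝ)) := by
  obtain ⟨Cf, hCf, hfar⟩ := SS_far d
  obtain ⟨Cn, hCn, hnear⟩ := near_GG d hd
  refine ⟨2*Cf, by positivity, fun u hu bd => ?_⟩
  obtain ⟨K, hK, hlip⟩ := LL_C2 hu 5
  have huc : Continuous u := hu.continuous
  refine ⟨16*K^2*Cn*3^(1/4:ℝ), by positivity, fun e he0 he1 => ?_⟩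
  have hep : 0 < ‖e‖ := norm_pos_iff.2 he0
  obtain ⟨i1, hid⟩ := main_id hd huc bd e
  rw [hid]
  set g : EE d × EE d → ℝ := fun p => (u p.1 - u p.2)^2 * SS e p.1 p.2 with hg
  have s1 : ENNReal.ofReal (-(1/2) * ∫ p, g p ∂(volume.prod volume)) ≤
      ∫⁻ p, ENNReal.ofReal |g p| ∂(volume.prod volume) := by
    rw [← ofReal_integral_eq_lintegral_ofReal i1.abs (Filter.Eventually.of_forall fun p => abs_nonneg _)]
    apply ENNReal.ofReal_le_ofReal
    have a1 := abs_integral_le_integral_abs (f := g) (μ := volume.prod volume)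
    have a2 := neg_abs_le (∫ p, g p ∂(volume.prod volume))
    have a3 := abs_nonneg (∫ p, g p ∂(volume.prod volume))
    linarith
  refine s1.trans ?_
  set Ind : EE d × EE d → ℝ≥0∞ := ({p | ‖p.2 - p.1‖ < 3*‖e‖} : Set (EE d × EE d)).indicator
      (fun p => ENNReal.ofReal (GG p.1 p.2)) with hInd
  have c1 : Continuous (cut (d := d) 1) := cut_cont 1
  have mGG : Measurable (fun p : EE d × EE d => GG p.1 p.2) := by unfold GG; fun_prop
  have mInd : Measurable Ind := Measurable.indicator (by fun_prop)
    (measurableSet_lt (by fun_prop) measurable_const)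
  have pt : ∀ p : EE d × EE d, ENNReal.ofReal |g p| ≤
      ENNReal.ofReal (Cf*‖e‖^2) * (ENNReal.ofReal (kap d (p.2 - p.1)) * (ENNReal.ofReal ((u p.1 - u p.2)^2) *
      (ENNReal.ofReal (bi 3 p.1) + ENNReal.ofReal (bi 3 p.2)))) +
      ENNReal.ofReal (4*K^2*‖e‖^2) * (Ind (p + (-e,-e)) + Ind (p + (-e,0)) + Ind (p + (0,-e)) + Ind (p+0)) := by
    rintro ⟨x, y⟩
    simp only [hg, abs_mul, abs_of_nonneg (sq_nonneg (u x - u y))]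
    by_cases hS : SS e x y = 0
    · simp [hS]
    have h3 : ‖x‖ < 3 ∨ ‖y‖ < 3 := by
      by_contra! hh
      exact hS (SS_zero he1 hh.1 hh.2)
    rcases le_or_gt (2*‖e‖) ‖y - x‖ with hz | hz
    · refine le_trans ?_ (le_add_of_nonneg_right zero_le)
      have hxy : x ≠ y := by
        rintro rfl
        simp at hz
        linarith
      have b1 : 1 ≤ bi 3 x + bi 3 y := by
        rcases h3 with h | h
        · rw [bi_one h]; linarith [bi_nonneg 3 y]
        · rw [bi_one h]; linarith [bi_nonneg 3 x]
      have n0 := bi_nonneg 3 x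
      have n1 := bi_nonneg 3 y
      have nk := kap_nonneg d (y-x)
      rw [← ENNReal.ofReal_add n0 n1, ← ENNReal.ofReal_mul (sq_nonneg _), ← ENNReal.ofReal_mul nk,
        ← ENNReal.ofReal_mul (by positivity)]
      apply ENNReal.ofReal_le_ofReal
      calc _ ≤ (u x - u y)^2 * (Cf * ‖e‖^2 * kap d (y-x)) := by gcongr; exact hfar e x y hxy hz
        _ = Cf*‖e‖^2 * (kap d (y-x) * ((u x - u y)^2 * 1)) := by ring
        _ ≤ _ := by gcongr
    · refine le_trans ?_ (le_add_of_nonneg_left zero_le)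
      have hx5 : ‖x‖ ≤ 5 := by
        rcases h3 with h | h
        · linarith
        · have := norm_sub_norm_le x y; rw [norm_sub_rev] at this; linarith
      have hy5 : ‖y‖ ≤ 5 := by
        rcases h3 with h | h
        · have := norm_sub_norm_le y x; linarith
        · linarith
      have U1 : (u x - u y)^2 ≤ 4*K^2*‖e‖^2 := by
        have := hlip x y hx5 hy5
        rw [norm_sub_rev] at this
        have h2 : |u x - u y| ≤ K * (2*‖e‖) := this.trans (by gcongr)
        rw [← sq_abs]
        calc _ ≤ (K * (2*‖e‖))^2 := by gcongr
          _ = _ := by ring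
      have z2 : ‖y - (x - e)‖ < 3*‖e‖ := by
        rw [show y - (x-e) = (y-x) + e by abel]; refine (norm_add_le _ _).trans_lt (by linarith)
      have z3 : ‖y - e - x‖ < 3*‖e‖ := by
        rw [show y - e - x = (y-x) - e by abel]; refine (norm_sub_le _ _).trans_lt (by linarith)
      have v1 : Ind ((x,y) + (-e,-e)) = ENNReal.ofReal (GG (x-e) (y-e)) := by
        rw [hInd, indicator_of_mem]
        · simp [← sub_eq_add_neg]
        · simp; linarith
      have v2 : Ind ((x,y) + (-e,0)) = ENNReal.ofReal (GG (x-e) y) := by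
        rw [hInd, indicator_of_mem]
        · simp [← sub_eq_add_neg]
        · simp [← sub_eq_add_neg]; linarith
      have v3 : Ind ((x,y) + (0,-e)) = ENNReal.ofReal (GG x (y-e)) := by
        rw [hInd, indicator_of_mem]
        · simp [← sub_eq_add_neg]
        · simp [← sub_eq_add_neg]; linarith
      have v4 : Ind ((x,y)+0) = ENNReal.ofReal (GG x y) := by
        rw [hInd, indicator_of_mem]
        · simp
        · simp; linarith
      have g1 := GG_nonneg (x-e) (y-e)
      have g2 := GG_nonneg (x-e) y
      have g3 := GG_nonneg x (y-e)
      have g4 := GG_nonneg x y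
      rw [v1, v2, v3, v4, ← ENNReal.ofReal_add g1 g2, ← ENNReal.ofReal_add (by linarith) g3,
        ← ENNReal.ofReal_add (by linarith) g4, ← ENNReal.ofReal_mul (by positivity)]
      apply ENNReal.ofReal_le_ofReal
      gcongr
      unfold SS
      rw [abs_le]; constructor <;> linarith
  have tr : ∀ a : EE d × EE d, ∫⁻ p, Ind (p + a) ∂(volume.prod volume) ≤ ENNReal.ofReal (Cn * (3*‖e‖)^(1/4:ℝ)) :=
    fun a => by
      rw [lintegral_add_right_eq_self]
      exact hnear _ (by positivity)
  refine (lintegral_mono pt).trans ?_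
  rw [lintegral_add_left (by fun_prop), lintegral_const_mul _ (by fun_prop), EN_eq2 huc,
    lintegral_const_mul _ (by fun_prop), lintegral_add_left (by fun_prop), lintegral_add_left (by fun_prop),
    lintegral_add_left (by fun_prop)]
  refine add_le_add ?_ ?_
  · rw [mul_assoc, ENNReal.ofReal_mul (by norm_num : (0:ℝ) ≤ 2), mul_comm (ENNReal.ofReal 2), mul_assoc]
    apply le_of_eq; congr 1
    rw [← two_mul]; simp
  · refine (mul_le_mul_right (add_le_add (add_le_add (add_le_add (tr _) (tr _)) (tr _)) (tr _)) _).trans ?_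
    rw [← ENNReal.ofReal_add (by positivity) (by positivity), ← ENNReal.ofReal_add (by positivity) (by positivity),
      ← ENNReal.ofReal_add (by positivity) (by positivity), ← ENNReal.ofReal_mul (by positivity)]
    apply ENNReal.ofReal_le_ofReal
    rw [Real.mul_rpow (by norm_num) (norm_nonneg _)]
    apply le_of_eq; ring

lemma glob_lip {d : ℕ} {f : EE d → ℝ} (hf : LL f) {B ρ : ℝ} (hB : ∀ x, |f x| ≤ B)
    (hs : ∀ x, ρ ≤ ‖x‖ → f x = 0) : ∃ K : ℝ, 0 ≤ K ∧ ∀ x y, |f x - f y| ≤ K * ‖x - y‖ := by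
  obtain ⟨C, hC, h⟩ := LL_m1 hf hB ρ
  refine ⟨C, hC, fun x y => ?_⟩
  by_cases hh : ‖y‖ < ρ ∨ ‖x‖ < ρ
  · have := h y (x - y) (by simpa using hh)
    rw [add_sub_cancel] at this
    exact this.trans (by gcongr; exact min_le_right _ _)
  · push Not at hh
    rw [hs x hh.2, hs y hh.1]; simp; positivity

lemma stab_step {d : ℕ} (hd : 1 ≤ d) {Λ α : ℝ} {F F' : ℝ → ℝ} {u : EE d → ℝ} (hα : 0 < α) (hΛ : 0 ≤ Λ)
    (g : Good d Λ α F F' u) : ∃ Cu : ℝ, 0 ≤ Cu ∧ ∀ e : EE d, ‖e‖ ≤ 1 →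
    (∫ x, cut 1 x * |u (x+e) - u x|)^2 ≤ (volume.real (ball (0:EE d) 3))^2 * ‖e‖^2 +
      4^(d+1) * (Cu * ‖e‖^2 * ‖e‖^α +
      ∫ p : EE d × EE d, ((u (p.1+e) - u p.1) * (u (p.1 + p.2 + e) - u (p.1 + p.2))) *
      (cut 1 (p.1+p.2) - cut 1 p.1)^2 ∂(volume.prod (kmu d))) := by
  set V := volume.real (ball (0:EE d) 3) with hV
  obtain ⟨K, hK, hlip⟩ := LL_C2 g.cd 3
  have huc : Continuous u := g.cd.continuous
  refine ⟨Λ * K^α * K^2 * V, by positivity, fun e he => ?_⟩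
  set w : EE d → ℝ := fun x => u (x+e) - u x with hw
  have hw2 : ContDiff ℝ 2 w := (g.cd.comp (by fun_prop)).sub g.cd
  have hwc : Continuous w := hw2.continuous
  have hwB : ∀ x, |w x| ≤ 2 := fun x => by
    have := abs_le.1 (g.bd x); have := abs_le.1 (g.bd (x+e))
    rw [abs_le]; constructor <;> simp only [hw] <;> linarith
  have c1 : Continuous (cut (d := d) 1) := cut_cont 1
  have hLw := LL_C2 hw2
  have hLa : LL (fun x => |w x|) := fun ρ => by
    obtain ⟨C, hC, h⟩ := hLw ρ
    exact ⟨C, hC, fun x y hx hy => (abs_abs_sub_abs_le _ _).trans (h x y hx hy)⟩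
  have habs : ∀ x, |(|w x|)| ≤ 2 := fun x => by rw [abs_abs]; exact hwB x
  have hLη : LL (fun x => cut 1 x * |w x|) := LL_mul (cut_LL 1) hLa (cut_abs 1) habs
  have hηB : ∀ x, |cut 1 x * (|w x|)| ≤ 2 := fun x => by
    rw [abs_mul, abs_abs]
    calc _ ≤ 1 * 2 := mul_le_mul (cut_abs 1 x) (hwB x) (abs_nonneg _) zero_le_one
      _ = _ := by norm_num
  have hηs : ∀ x : EE d, 2 ≤ ‖x‖ → cut 1 x * |w x| = 0 := fun x hx => by
    rw [cut_zero (by linarith)]; simp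
  obtain ⟨Kη, hKη, hη⟩ := glob_lip hLη hηB hηs
  have st := ext_stab hd g hη (by fun_prop) hηs hKη hηB
  obtain ⟨i0, hid⟩ := energy_id hd 1 hw2 hwB
  have i1 : Integrable (fun p : EE d × EE d =>
      (cut 1 (p.1+p.2) * |w (p.1+p.2)| - cut 1 p.1 * |w p.1|)^2) (volume.prod (kmu d)) :=
    (int_dd hd hLη (by fun_prop) hηB hLη (by fun_prop) hηB hηs).congr
      (Filter.Eventually.of_forall fun p => (pow_two _).symm)
  -- the interaction term
  set N : EE d × EE d → ℝ := fun p => cut 1 p.1 * cut 1 p.2 * (|w p.1| * |w p.2| - w p.1 * w p.2) with hN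
  have eN : ∀ p : EE d × EE d, N (p.1, p.1+p.2) = (1/2) *
      ((cut 1 (p.1+p.2) * w (p.1+p.2) - cut 1 p.1 * w p.1)^2 -
      (cut 1 (p.1+p.2) * |w (p.1+p.2)| - cut 1 p.1 * |w p.1|)^2) := fun p => by
    simp only [hN]
    have a1 := sq_abs (w p.1)
    have a2 := sq_abs (w (p.1+p.2))
    linear_combination (1/2) * (cut 1 p.1)^2 * a1 + (1/2) * (cut 1 (p.1+p.2))^2 * a2
  have iN : Integrable (fun p : EE d × EE d => N (p.1, p.1+p.2)) (volume.prod (kmu d)) := by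
    refine ((i0.sub i1).const_mul (1/2)).congr (Filter.Eventually.of_forall fun p => (eN p).symm)
  have IN : ∫ p : EE d × EE d, N (p.1, p.1+p.2) ∂(volume.prod (kmu d)) = (1/2) *
      ((∫ p : EE d × EE d, (cut 1 (p.1+p.2) * w (p.1+p.2) - cut 1 p.1 * w p.1)^2 ∂(volume.prod (kmu d))) -
      ∫ p : EE d × EE d, (cut 1 (p.1+p.2) * |w (p.1+p.2)| - cut 1 p.1 * |w p.1|)^2 ∂(volume.prod (kmu d))) := by
    simp_rw [eN]
    rw [integral_const_mul, integral_sub i0 i1]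
  -- reaction
  have b1 : ∀ x, |cut 1 x * w x| ≤ 2 := fun x => by
    rw [abs_mul]
    calc _ ≤ 1 * 2 := mul_le_mul (cut_abs 1 x) (hwB x) (abs_nonneg _) zero_le_one
      _ = _ := by norm_num
  have b2 : ∀ x, |cut 1 x * (cut 1 x * w x)| ≤ 2 := fun x => by
    rw [abs_mul]
    calc _ ≤ 1 * 2 := mul_le_mul (cut_abs 1 x) (b1 x) (abs_nonneg _) zero_le_one
      _ = _ := by norm_num
  have s2 : ∀ x : EE d, 2 ≤ ‖x‖ → cut 1 x * (cut 1 x * w x) = 0 := fun x hx => by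
    rw [cut_zero (by linarith)]; simp
  have j1 := psiLL2_int hd hw2 hwB (ψ := fun x => cut 1 x * (cut 1 x * w x)) (by fun_prop) b2 s2
  obtain ⟨F'c, _⟩ := g.F'u
  have j2 : Integrable (fun x => F' (u x) * (cut 1 x * |w x|)^2) := by
    refine cs_int (F'c.mul (by fun_prop)) (ρ := 2) fun x hx => ?_
    rw [hηs x hx]; simp
  have R1 : (∫ x, (cut 1 x * (cut 1 x * w x)) * LL2 w x) - ∫ x, F' (u x) * (cut 1 x * |w x|)^2 ≤
      Λ * K^α * K^2 * V * ‖e‖^2 * ‖e‖^α := by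
    rw [← integral_sub j1 j2]
    calc _ ≤ ∫ x : EE d, (Λ * K^α * K^2 * ‖e‖^2 * ‖e‖^α) * bi 3 x := by
          refine integral_mono (j1.sub j2) ((bi_int 3).const_mul _) fun x => ?_
          simp only
          rw [LL2_diff hd g.cd g.bd, g.eq, g.eq]
          by_cases hx : 2 ≤ ‖x‖
          · rw [s2 x hx, hηs x hx]
            have := bi_nonneg 3 x
            simp; positivity
          push Not at hx
          rw [bi_one (by linarith), mul_one]
          have hh := g.hol _ (g.mem x) _ (g.mem (x+e))
          have hwK : |u (x+e) - u x| ≤ K * ‖e‖ := by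
            have := hlip (x+e) x ((norm_add_le _ _).trans (by linarith)) (by linarith)
            simpa using this
          have p0 := cut_nonneg 1 x
          have p1 := cut_le_one 1 x
          have : cut 1 x * (cut 1 x * w x) * (F (u (x+e)) - F (u x)) - F' (u x) * (cut 1 x * |w x|)^2
            = (cut 1 x)^2 * (w x * (F (u (x+e)) - F (u x) - F' (u x) * (u (x+e) - u x))) := by
            have a1 := sq_abs (w x)
            simp only [hw] at a1 ⊢
            linear_combination (-F' (u x) * (cut 1 x)^2) * a1
          rw [this]
          calc _ ≤ (cut 1 x)^2 * (|w x| * |F (u (x+e)) - F (u x) - F' (u x) * (u (x+e) - u x)|) := by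
                refine mul_le_mul_of_nonneg_left ?_ (sq_nonneg _)
                rw [← abs_mul]; exact le_abs_self _
            _ ≤ 1^2 * ((K * ‖e‖) * (Λ * (K * ‖e‖)^α * (K * ‖e‖))) := by
                gcongr
                refine hh.trans (by gcongr)
            _ = _ := by rw [Real.mul_rpow hK (norm_nonneg _)]; ring
      _ = _ := by
          rw [integral_const_mul]
          have : ∫ x : EE d, bi 3 x = V := by
            unfold bi; rw [integral_indicator measurableSet_ball]; simp [hV]
          rw [this]; ring
  -- lower bound
  have iA : Integrable (fun x => cut 1 x * |w x|) := cs_int (by fun_prop) hηs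
  have iB : Integrable (fun x => cut 1 x * w x) := cs_int (by fun_prop) (ρ := 2) fun x hx => by
    rw [cut_zero (by linarith)]; simp
  have low : (4^(d+1))⁻¹ * ((∫ x, cut 1 x * |w x|)^2 - (∫ x, cut 1 x * w x)^2) ≤
      ∫ p : EE d × EE d, N (p.1, p.1+p.2) ∂(volume.prod (kmu d)) := by
    rw [conv_i N, pow_two, pow_two, ← integral_prod_mul, ← integral_prod_mul,
      ← integral_sub (iA.mul_prod iA) (iB.mul_prod iB), ← integral_const_mul]
    refine integral_mono (((iA.mul_prod iA).sub (iB.mul_prod iB)).const_mul _) (conv_int N iN) fun p => ?_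
    obtain ⟨x, y⟩ := p
    simp only [hN]
    have e1 : cut 1 x * |w x| * (cut 1 y * |w y|) - cut 1 x * w x * (cut 1 y * w y) =
      cut 1 x * cut 1 y * (|w x| * |w y| - w x * w y) := by ring
    rw [e1]
    by_cases hx : 2 ≤ ‖x‖
    · rw [cut_zero (x := x) (by linarith)]; simp
    by_cases hy : 2 ≤ ‖y‖
    · rw [cut_zero (x := y) (by linarith)]; simp
    by_cases hxy : x = y
    · subst hxy; simp
    push Not at hx hy
    have hz : 0 < ‖y - x‖ := norm_pos_iff.2 (sub_ne_zero.2 (Ne.symm hxy))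
    have hz4 : ‖y - x‖ ≤ 4 := (norm_sub_le _ _).trans (by linarith)
    have n1 := cut_nonneg 1 x
    have n2 := cut_nonneg 1 y
    have n3 : 0 ≤ |w x| * |w y| - w x * w y := by
      rw [← abs_mul]; linarith [le_abs_self (w x * w y)]
    gcongr
    unfold kap
    gcongr
  have avg0 : (∫ x, cut 1 x * w x)^2 ≤ V^2 * ‖e‖^2 := by
    have k1 : Integrable (fun x => cut 1 x * u (x+e)) := by
      have := cs_int_shift (d := d) c1 huc (ρ := 2) (fun x hx => cut_zero (by linarith)) 0 e
      simpa using this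
    have k2 : Integrable (fun x => cut 1 x * u x) := cs_int_mul c1 huc (ρ := 2)
      (fun x hx => cut_zero (by linarith))
    have k3 : Integrable (fun x => cut 1 (x-e) * u x) := by
      have := cs_int_shift (d := d) c1 huc (ρ := 2) (fun x hx => cut_zero (by linarith)) (-e) 0
      simpa [← sub_eq_add_neg] using this
    have e1 : ∫ x, cut 1 x * w x = ∫ x, (cut 1 (x-e) - cut 1 x) * u x := by
      simp only [hw, mul_sub, sub_mul]
      rw [integral_sub k1 k2, integral_sub k3 k2, ← integral_add_right_eq_self (fun x => cut 1 (x-e) * u x) e]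
      simp
    have e2 : |∫ x, cut 1 x * w x| ≤ V * ‖e‖ := by
      rw [e1]
      refine (abs_integral_le_integral_abs).trans ?_
      calc _ ≤ ∫ x : EE d, ‖e‖ * bi 3 x := by
            refine integral_mono_of_nonneg (Filter.Eventually.of_forall fun x => abs_nonneg _)
              ((bi_int 3).const_mul _) (Filter.Eventually.of_forall fun x => ?_)
            simp only
            rw [abs_mul]
            by_cases hx : ‖x‖ < 3
            · rw [bi_one hx]
              have := cut_lip 1 (x-e) x
              simp at this
              exact mul_le_mul this (g.bd x) (abs_nonneg _) (norm_nonneg _)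
            · push Not at hx
              rw [cut_zero (x := x) (by linarith), cut_zero (x := x - e)]
              · simp; exact mul_nonneg (norm_nonneg _) (bi_nonneg _ _)
              · have := norm_sub_norm_le x e; linarith
        _ = _ := by
          rw [integral_const_mul]
          have : ∫ x : EE d, bi 3 x = V := by
            unfold bi; rw [integral_indicator measurableSet_ball]; simp [hV]
          rw [this]; ring
    rw [← sq_abs, ← mul_pow]
    gcongr
  have p4 : (0:ℝ) < 4^(d+1) := by positivity
  have low' : (∫ x, cut 1 x * |w x|)^2 - (∫ x, cut 1 x * w x)^2 ≤
      4^(d+1) * ∫ p : EE d × EE d, N (p.1, p.1+p.2) ∂(volume.prod (kmu d)) := by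
    rw [inv_mul_le_iff₀ p4] at low; exact low
  have hNn : 0 ≤ ∫ p : EE d × EE d, N (p.1, p.1+p.2) ∂(volume.prod (kmu d)) := by
    refine integral_nonneg fun p => ?_
    simp only [hN]
    refine mul_nonneg (mul_nonneg (cut_nonneg _ _) (cut_nonneg _ _)) ?_
    rw [← abs_mul]; linarith [le_abs_self (w p.1 * w (p.1+p.2))]
  have fin : ∫ p : EE d × EE d, N (p.1, p.1+p.2) ∂(volume.prod (kmu d)) ≤ Λ * K^α * K^2 * V * ‖e‖^2 * ‖e‖^α +
      ∫ p : EE d × EE d, (w p.1 * w (p.1 + p.2)) * (cut 1 (p.1+p.2) - cut 1 p.1)^2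
        ∂(volume.prod (kmu d)) := by
    linarith
  calc _ ≤ V^2 * ‖e‖^2 + 4^(d+1) * ∫ p : EE d × EE d, N (p.1, p.1+p.2) ∂(volume.prod (kmu d)) := by linarith
    _ ≤ _ := by gcongr

lemma grad_step (d : ℕ) (hd : 1 ≤ d) : ∃ C : ℝ, 0 < C ∧ ∀ (Λ α : ℝ) (F F' : ℝ → ℝ) (u : EE d → ℝ),
    0 < α → 0 ≤ Λ → Good d Λ α F F' u → ∀ v : EE d, ‖v‖ = 1 →
    ENNReal.ofReal ((∫ x, cut 1 x * |fderiv ℝ u x v|)^2) ≤ ENNReal.ofReal C * (1 + EN u) := by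
  set V := volume.real (ball (0:EE d) 3) with hV
  obtain ⟨C, hC, hmb⟩ := main_bound d hd
  refine ⟨V^2 + 4^(d+1) * C + 1, by positivity, fun Λ α F F' u hα hΛ g v hv => ?_⟩
  obtain ⟨C1, hC1, h1⟩ := stab_step hd hα hΛ g
  obtain ⟨C2, hC2, h2⟩ := hmb u g.cd g.bd
  obtain ⟨K, hK, hlip⟩ := LL_C2 g.cd 3
  have huc : Continuous u := g.cd.continuous
  set t : ℕ → ℝ := fun n => 1 / ((n:ℝ)+1) with ht
  have tpos : ∀ n, 0 < t n := fun n => by simp only [ht]; positivity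
  have tle : ∀ n, t n ≤ 1 := fun n => by
    simp only [ht]; rw [div_le_one (by positivity)]; linarith [(Nat.cast_nonneg n : (0:ℝ) ≤ n)]
  have t0 : Filter.Tendsto t Filter.atTop (nhds 0) := tendsto_one_div_add_atTop_nhds_zero_nat
  have en : ∀ n, ‖t n • v‖ = t n := fun n => by
    rw [norm_smul, hv, mul_one, Real.norm_of_nonneg (tpos n).le]
  have c1 : Continuous (cut (d := d) 1) := cut_cont 1
  have lim1 : Filter.Tendsto (fun n => ∫ x, cut 1 x * |(t n)⁻¹ * (u (x + t n • v) - u x)|) Filter.atTop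
      (nhds (∫ x, cut 1 x * |fderiv ℝ u x v|)) := by
    refine tendsto_integral_of_dominated_convergence (fun x => K * bi 3 x) ?_ ((bi_int 3).const_mul _) ?_ ?_
    · intro n; apply Continuous.aestronglyMeasurable; fun_prop
    · intro n; refine Filter.Eventually.of_forall fun x => ?_
      rw [Real.norm_eq_abs, abs_mul, abs_abs, abs_of_nonneg (cut_nonneg 1 x)]
      by_cases hx : 2 ≤ ‖x‖
      · rw [cut_zero (by linarith)]; simp; exact mul_nonneg hK (bi_nonneg _ _)
      push Not at hx
      rw [bi_one (by linarith)]
      have := hlip (x + t n • v) x ((norm_add_le _ _).trans (by rw [en]; linarith [tle n])) (by linarith)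
      rw [add_sub_cancel_left, en] at this
      rw [abs_mul, abs_of_pos (inv_pos.2 (tpos n)), mul_one]
      calc _ ≤ 1 * ((t n)⁻¹ * (K * t n)) := by
            refine mul_le_mul (cut_le_one 1 x) ?_ (by have := (tpos n).le; positivity) zero_le_one
            exact mul_le_mul_of_nonneg_left this (inv_pos.2 (tpos n)).le
        _ = K := by have := (tpos n).ne'; field_simp
    · refine Filter.Eventually.of_forall fun x => ?_
      have hd1 : HasFDerivAt u (fderiv ℝ u x) x :=
        ((g.cd.differentiable (by norm_num)) x).hasFDerivAt
      have := (hd1.hasLineDerivAt v).tendsto_slope_zero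
      have t0' : Filter.Tendsto t Filter.atTop (nhdsWithin 0 {0}ᶜ) :=
        tendsto_nhdsWithin_iff.2 ⟨t0, Filter.Eventually.of_forall fun n => (tpos n).ne'⟩
      have := (this.comp t0').abs.const_mul (cut 1 x)
      simpa [Function.comp_def] using this
  have lhs := (ENNReal.continuous_ofReal.tendsto _).comp (lim1.pow 2)
  have step : ∀ n, ENNReal.ofReal ((∫ x, cut 1 x * |(t n)⁻¹ * (u (x + t n • v) - u x)|)^2) ≤
      (ENNReal.ofReal (V^2) + ENNReal.ofReal (4^(d+1) * (C * 1)) * EN u) +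
      (ENNReal.ofReal (4^(d+1) * (C1 * (t n)^α)) + ENNReal.ofReal (4^(d+1) * (C2 * (t n)^(1/4:ℝ)))) := by
    intro n
    have tp := tpos n
    have tnz := tp.ne'
    have a1 := h1 (t n • v) (by rw [en]; exact tle n)
    have a2 := h2 (t n • v) (by intro h0; rw [← norm_eq_zero, en] at h0; exact tnz h0) (by rw [en]; exact tle n)
    rw [en] at a1 a2
    set M := ∫ p : EE d × EE d, ((u (p.1+t n • v) - u p.1) * (u (p.1 + p.2 + t n • v) - u (p.1 + p.2))) *
      (cut 1 (p.1+p.2) - cut 1 p.1)^2 ∂(volume.prod (kmu d)) with hM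
    have e1 : ∫ x, cut 1 x * |(t n)⁻¹ * (u (x + t n • v) - u x)| =
        (t n)⁻¹ * ∫ x, cut 1 x * |u (x + t n • v) - u x| := by
      rw [← integral_const_mul]
      congr 1; ext x
      rw [abs_mul, abs_of_pos (inv_pos.2 tp)]; ring
    rw [e1, mul_pow]
    set A := ∫ x, cut 1 x * |u (x + t n • v) - u x|
    have b1 : ((t n)⁻¹)^2 * A^2 ≤ V^2 + 4^(d+1) * (C1 * (t n)^α) + (4^(d+1) * ((t n)⁻¹)^2) * M := by
      calc _ ≤ ((t n)⁻¹)^2 * _ := mul_le_mul_of_nonneg_left a1 (sq_nonneg _)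
        _ = _ := by rw [← hV]; field_simp; ring
    refine (ENNReal.ofReal_le_ofReal b1).trans ?_
    refine ENNReal.ofReal_add_le.trans ?_
    rw [ENNReal.ofReal_mul (by positivity : 0 ≤ (4:ℝ)^(d+1) * ((t n)⁻¹)^2)]
    refine (add_le_add ENNReal.ofReal_add_le (mul_le_mul_right a2 _)).trans ?_
    rw [mul_add, ← mul_assoc (ENNReal.ofReal _) (ENNReal.ofReal _) (EN u), ← ENNReal.ofReal_mul (by positivity), ← ENNReal.ofReal_mul (by positivity)]
    have q1 : 4^(d+1) * ((t n)⁻¹)^2 * (C * (t n)^2) = 4^(d+1) * (C * 1) := by field_simp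
    have q2 : 4^(d+1) * ((t n)⁻¹)^2 * (C2 * (t n)^2 * (t n)^(1/4:ℝ)) = 4^(d+1) * (C2 * (t n)^(1/4:ℝ)) := by
      field_simp
    rw [q1, q2]
    apply le_of_eq; ring
  have z1 : ∀ (c β : ℝ), 0 < β → Filter.Tendsto (fun n => ENNReal.ofReal (4^(d+1) * (c * (t n)^β)))
      Filter.atTop (nhds 0) := fun c β hβ => by
    have h0 : Filter.Tendsto (fun n => (t n)^β) Filter.atTop (nhds 0) := by
      have := t0.rpow_const (p := β) (Or.inr hβ.le)
      rwa [Real.zero_rpow hβ.ne'] at this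
    have := (h0.const_mul c).const_mul ((4:ℝ)^(d+1))
    have := (ENNReal.continuous_ofReal.tendsto _).comp this
    simpa [Function.comp_def] using this
  have rhs := (tendsto_const_nhds (x := ENNReal.ofReal (V^2) + ENNReal.ofReal (4^(d+1) * (C * 1)) * EN u)
    (f := Filter.atTop (α := ℕ))).add ((z1 C1 α hα).add (z1 C2 (1/4) (by norm_num)))
  have := le_of_tendsto_of_tendsto' lhs rhs step
  refine this.trans ?_
  rw [add_zero, add_zero, mul_add, mul_one, mul_one]
  have hh : 0 ≤ 4^(d+1) * C := by positivity
  refine add_le_add (ENNReal.ofReal_le_ofReal (by linarith)) (mul_le_mul_left (ENNReal.ofReal_le_ofReal ?_) _)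
  nlinarith [sq_nonneg V]

lemma diff_L1 {d : ℕ} {u : EE d → ℝ} (cd : ContDiff ℝ 2 u) {C : ℝ} {ρ : ℝ}
    (hC : ∀ F : EE d → ℝ≥0∞, Measurable F → ∀ z, ∫⁻ x in ball z ρ, F x ≤ ENNReal.ofReal C * loc d F) (h : EE d) :
    ∫⁻ x in ball (0:EE d) ρ, ENNReal.ofReal |u (x+h) - u x| ≤
      ENNReal.ofReal ‖h‖ * (ENNReal.ofReal C * loc d (fun x => ENNReal.ofReal ‖fderiv ℝ u x‖)) := by
  have hfc : Continuous (fderiv ℝ u) := cd.continuous_fderiv (by norm_num)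
  have pt : ∀ x, ENNReal.ofReal |u (x+h) - u x| ≤
      ∫⁻ s in Ioc (0:ℝ) 1, ENNReal.ofReal ‖h‖ * ENNReal.ofReal ‖fderiv ℝ u (x + s • h)‖ := by
    intro x
    have ftc : ∫ s in (0:ℝ)..1, fderiv ℝ u (x + s • h) h = u (x + (1:ℝ) • h) - u (x + (0:ℝ) • h) := by
      refine intervalIntegral.integral_eq_sub_of_hasDerivAt (f := fun s : ℝ => u (x + s • h)) (fun s _ => ?_) ?_
      · have h1 : HasFDerivAt u (fderiv ℝ u (x + s • h)) (x + s • h) :=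
          ((cd.differentiable (by norm_num)) _).hasFDerivAt
        have h2 : HasDerivAt (fun s : ℝ => x + s • h) h s := by
          simpa using ((hasDerivAt_id s).smul_const h).const_add x
        exact h1.comp_hasDerivAt s h2
      · apply Continuous.intervalIntegrable; fun_prop
    simp only [one_smul, zero_smul, add_zero] at ftc
    rw [← ftc, intervalIntegral.integral_of_le zero_le_one]
    have ii : IntegrableOn (fun s : ℝ => ‖h‖ * ‖fderiv ℝ u (x + s • h)‖) (Ioc 0 1) := by
      apply (Continuous.integrableOn_Icc (by fun_prop)).mono_set Ioc_subset_Icc_self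
    calc _ ≤ ENNReal.ofReal (∫ s in Ioc (0:ℝ) 1, ‖h‖ * ‖fderiv ℝ u (x + s • h)‖) := by
          apply ENNReal.ofReal_le_ofReal
          refine abs_integral_le_integral_abs.trans ?_
          refine integral_mono_of_nonneg (Filter.Eventually.of_forall fun s => abs_nonneg _) ii
            (Filter.Eventually.of_forall fun s => ?_)
          simp only
          rw [mul_comm]
          exact (fderiv ℝ u (x + s • h)).le_opNorm h
      _ = _ := by
          rw [ofReal_integral_eq_lintegral_ofReal ii (Filter.Eventually.of_forall fun s => by positivity)]
          congr 1; ext s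
          rw [ENNReal.ofReal_mul (norm_nonneg _)]
  calc _ ≤ ∫⁻ x in ball (0:EE d) ρ, ∫⁻ s in Ioc (0:ℝ) 1,
        ENNReal.ofReal ‖h‖ * ENNReal.ofReal ‖fderiv ℝ u (x + s • h)‖ := lintegral_mono fun x => pt x
    _ = ∫⁻ s in Ioc (0:ℝ) 1, ∫⁻ x in ball (0:EE d) ρ,
        ENNReal.ofReal ‖h‖ * ENNReal.ofReal ‖fderiv ℝ u (x + s • h)‖ := by
        apply lintegral_lintegral_swap
        apply Measurable.aemeasurable
        have : Continuous (fun q : EE d × ℝ => fderiv ℝ u (q.1 + q.2 • h)) := by fun_prop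
        simp only [Function.uncurry_def]
        fun_prop
    _ ≤ ∫⁻ s in Ioc (0:ℝ) 1, ENNReal.ofReal ‖h‖ * (ENNReal.ofReal C *
          loc d (fun x => ENNReal.ofReal ‖fderiv ℝ u x‖)) := by
        refine lintegral_mono fun s => ?_
        rw [lintegral_const_mul _ (by fun_prop), ball_shift (fun x => ENNReal.ofReal ‖fderiv ℝ u x‖)]
        exact mul_le_mul_right (hC _ (by fun_prop) _) _
    _ = _ := by simp

lemma EN_bound (d : ℕ) (hd : 1 ≤ d) : ∃ C : ℝ, 0 < C ∧ ∀ (Λ α : ℝ) (F F' : ℝ → ℝ) (u : EE d → ℝ),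
    0 ≤ Λ → Good d Λ α F F' u → ∀ ε : ℝ, 0 < ε → ε ≤ 1 →
    EN u ≤ ENNReal.ofReal (C * ((Λ+1)^2 * ε^(1/4:ℝ) + 1)) +
      ENNReal.ofReal (C * Real.log (1/ε)) * loc d (fun x => ENNReal.ofReal ‖fderiv ℝ u x‖) := by
  obtain ⟨C1, hC1, hN⟩ := Nbound d hd
  obtain ⟨C3, hC3, hB⟩ := ball_loc d 3 (by norm_num)
  set V := volume.real (ball (0:EE d) 3) with hV
  set m := ∫ h, mh d h ∂(kmu d) with hm
  have hm0 : 0 ≤ m := integral_nonneg fun h => mh_nonneg h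
  have cd0 := cdd_nonneg d
  refine ⟨C3 * C1 * (cdd d * 4) + 2 * C3 * cdd d + 4 * V * m + 1, by positivity,
    fun Λ α F F' u hΛ g ε hε hε1 => ?_⟩
  have huc := g.cd.continuous
  set X := loc d (fun x => ENNReal.ofReal ‖fderiv ℝ u x‖) with hX
  have sw : EN u = ∫⁻ h, (∫⁻ x in ball (0:EE d) 3, ENNReal.ofReal ((u (x+h) - u x)^2)) ∂(kmu d) := by
    unfold EN
    rw [lintegral_lintegral_swap]
    apply Measurable.aemeasurable
    simp only [Function.uncurry_def]; fun_prop
  have mS : MeasurableSet {h : EE d | ε ≤ ‖h‖ ∧ ‖h‖ < 1} :=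
    (measurableSet_le measurable_const measurable_norm).inter (measurableSet_lt measurable_norm measurable_const)
  have pt : ∀ h : EE d, ∫⁻ x in ball (0:EE d) 3, ENNReal.ofReal ((u (x+h) - u x)^2) ≤
      ENNReal.ofReal (C3 * (C1 * (Λ+1)^2)) * (ball (0:EE d) ε).indicator (fun h => ENNReal.ofReal (‖h‖^(5/4:ℝ))) h
      + (ENNReal.ofReal (2*C3) * X) * ({h : EE d | ε ≤ ‖h‖ ∧ ‖h‖ < 1}).indicator (fun h => ENNReal.ofReal ‖h‖) h
      + ENNReal.ofReal (4*V) * ENNReal.ofReal (mh d h) := by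
    intro h
    rcases lt_or_ge ‖h‖ ε with h1 | h1
    · refine le_trans ?_ (le_add_of_nonneg_right zero_le)
      refine le_trans ?_ (le_add_of_nonneg_right zero_le)
      rw [indicator_of_mem (by simpa using h1), ← ENNReal.ofReal_mul (by positivity)]
      refine (hB _ (by fun_prop) 0).trans ?_
      have := hN Λ α F F' u hΛ g h
      refine (mul_le_mul_right this _).trans ?_
      rw [← ENNReal.ofReal_mul hC3.le]
      apply ENNReal.ofReal_le_ofReal; apply le_of_eq; ring
    rcases lt_or_ge ‖h‖ 1 with h2 | h2
    · refine le_trans ?_ (le_add_of_nonneg_right zero_le)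
      refine le_trans ?_ (le_add_of_nonneg_left zero_le)
      rw [indicator_of_mem (by exact ⟨h1,h2⟩)]
      calc _ ≤ ∫⁻ x in ball (0:EE d) 3, ENNReal.ofReal 2 * ENNReal.ofReal |u (x+h) - u x| := by
            refine lintegral_mono fun x => ?_
            rw [← ENNReal.ofReal_mul (by norm_num)]
            apply ENNReal.ofReal_le_ofReal
            have a := abs_le.1 (g.bd (x+h))
            have b := abs_le.1 (g.bd x)
            have : |u (x+h) - u x| ≤ 2 := by rw [abs_le]; constructor <;> linarith
            rw [← sq_abs, pow_two]
            exact mul_le_mul_of_nonneg_right this (abs_nonneg _)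
        _ ≤ ENNReal.ofReal 2 * (ENNReal.ofReal ‖h‖ * (ENNReal.ofReal C3 * X)) := by
            rw [lintegral_const_mul _ (by fun_prop)]
            exact mul_le_mul_right (diff_L1 g.cd hB h) _
        _ = _ := by rw [ENNReal.ofReal_mul (by norm_num : (0:ℝ) ≤ 2)]; ring
    · refine le_trans ?_ (le_add_of_nonneg_left zero_le)
      rw [mh_eq_one h h2]
      calc _ ≤ ∫⁻ x in ball (0:EE d) 3, ENNReal.ofReal 4 := by
            refine lintegral_mono fun x => ENNReal.ofReal_le_ofReal ?_
            have a := abs_le.1 (g.bd (x+h))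
            have b := abs_le.1 (g.bd x)
            nlinarith
        _ = _ := by
          rw [lintegral_const, Measure.restrict_apply_univ, ENNReal.ofReal_mul (by norm_num : (0:ℝ) ≤ 4), hV,
            ofReal_measureReal (measure_ball_lt_top.ne)]
          simp
  rw [sw]
  refine (lintegral_mono pt).trans ?_
  have mi1 : Measurable ((ball (0:EE d) ε).indicator (fun h => ENNReal.ofReal (‖h‖^(5/4:ℝ)))) :=
    Measurable.indicator (by fun_prop) measurableSet_ball
  have mi2 : Measurable (({h : EE d | ε ≤ ‖h‖ ∧ ‖h‖ < 1}).indicator (fun h => ENNReal.ofReal ‖h‖)) :=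
    Measurable.indicator (by fun_prop) mS
  rw [lintegral_add_left (by fun_prop), lintegral_add_left (by fun_prop), lintegral_const_mul _ mi1,
    lintegral_const_mul _ mi2, lintegral_const_mul _ (by fun_prop), lintegral_indicator measurableSet_ball,
    lintegral_indicator mS,
    ← ofReal_integral_eq_lintegral_ofReal (mh_integrable hd) (Filter.Eventually.of_forall fun h => mh_nonneg h)]
  have hl : 0 ≤ Real.log (1/ε) := Real.log_nonneg (by rw [le_div_iff₀ hε]; linarith)
  calc _ ≤ ENNReal.ofReal (C3 * (C1 * (Λ+1)^2)) * ENNReal.ofReal (cdd d * (4 * ε ^ (1/4:ℝ))) +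
        (ENNReal.ofReal (2*C3) * X) * ENNReal.ofReal (cdd d * Real.log (1/ε)) +
        ENNReal.ofReal (4*V) * ENNReal.ofReal m := by
        refine add_le_add (add_le_add (mul_le_mul_right (I_near hd hε) _) (mul_le_mul_right (I_mid hd hε hε1) _)) le_rfl
    _ = (ENNReal.ofReal (C3 * (C1 * (Λ+1)^2)) * ENNReal.ofReal (cdd d * (4 * ε ^ (1/4:ℝ))) +
        ENNReal.ofReal (4*V) * ENNReal.ofReal m) +
        (ENNReal.ofReal (2*C3) * ENNReal.ofReal (cdd d * Real.log (1/ε))) * X := by ring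
    _ ≤ _ := by
        rw [← ENNReal.ofReal_mul (by positivity), ← ENNReal.ofReal_mul (by positivity),
          ← ENNReal.ofReal_mul (by positivity), ← ENNReal.ofReal_add (by positivity) (by positivity)]
        refine add_le_add (ENNReal.ofReal_le_ofReal ?_) (mul_le_mul_left (ENNReal.ofReal_le_ofReal ?_) _)
        · have p1 : 0 ≤ (Λ+1)^2 * ε^(1/4:ℝ) := by positivity
          have k1 : 0 ≤ C3 * C1 * (cdd d * 4) := by positivity
          have k2 : 0 ≤ 2 * C3 * cdd d := by positivity
          have k3 : 0 ≤ 4*V*m := by positivity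
          nlinarith [mul_nonneg k2 p1, mul_nonneg k3 p1]
        · have k1 : 0 ≤ C3 * C1 * (cdd d * 4) := by positivity
          have k3 : 0 ≤ 4*V*m := by positivity
          nlinarith [mul_nonneg k1 hl, mul_nonneg k3 hl]

lemma Good.shift {d : ℕ} {Λ α : ℝ} {F F' : ℝ → ℝ} {u : EE d → ℝ} (g : Good d Λ α F F' u) (y : EE d) :
    Good d Λ α F F' (fun x => u (x+y)) where
  cd := g.cd.comp (by fun_prop)
  bd := fun x => g.bd _
  lip := g.lip
  hol := g.hol
  cF := g.cF
  eq := fun x => by rw [LL2_shift]; exact g.eq _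
  stab := fun η h1 h2 => by
    have := g.stab (fun x => η (x - y)) (h1.comp (by fun_prop))
      (h2.comp_homeomorph (Homeomorph.subRight y))
    rw [← integral_add_right_eq_self (fun x => F' (u x) * (η (x - y))^2) y] at this
    have e2 : ∫ p : EE d × EE d, (η (p.1 + p.2 - y) - η (p.1 - y))^2 ∂(volume.prod (kmu d)) =
        ∫ p : EE d × EE d, (η (p.1+p.2) - η p.1)^2 ∂(volume.prod (kmu d)) := by
      have mp : MeasurePreserving (Prod.map (fun x : EE d => x + -y) (id : EE d → EE d))
          ((volume : Measure (EE d)).prod (kmu d)) ((volume : Measure (EE d)).prod (kmu d)) :=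
        (measurePreserving_add_right volume (-y)).prod (MeasurePreserving.id _)
      have := mp.integral_comp ((Homeomorph.addRight (-y)).prodCongr (Homeomorph.refl _)).measurableEmbedding
        (fun p : EE d × EE d => (η (p.1+p.2) - η p.1)^2)
      rw [← this]
      congr 1; ext p
      simp only [Prod.map_fst, Prod.map_snd, id]
      rw [show p.1 + -y + p.2 = p.1 + p.2 - y by abel, sub_eq_add_neg p.1 y]
    rw [e2] at this
    simpa using this

lemma opn {d : ℕ} (L : EE d →L[ℝ] ℝ) : ‖L‖ ≤ ∑ i, |L (EuclideanSpace.single i 1)| := by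
  refine L.opNorm_le_bound (Finset.sum_nonneg fun i _ => abs_nonneg _) fun v => ?_
  have : v = ∑ i, v i • EuclideanSpace.single i (1:ℝ) := by
    ext j; simp [Pi.single_apply]
  have h2 : L v = ∑ i, v i * L (EuclideanSpace.single i 1) := by
    conv_lhs => rw [this]
    simp
  rw [h2, Finset.sum_mul, Real.norm_eq_abs]
  refine (Finset.abs_sum_le_sum_abs _ _).trans (Finset.sum_le_sum fun i _ => ?_)
  rw [abs_mul, mul_comm]
  gcongr
  exact PiLp.norm_apply_le v i

lemma quad_solve {C L x : ℝ} (hC : 0 ≤ C) (hL : 1/2 ≤ L) (h : x^2 ≤ C * (1 + L * x)) : x ≤ (C+4) * L := by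
  by_contra! hh
  have h1 : 4 * L < x - C * L := by linarith
  have h2 : (C+4)*L * (4*L) < x * (x - C*L) := by
    apply mul_lt_mul'' hh h1 <;> positivity
  nlinarith [mul_nonneg hC (by nlinarith : 0 ≤ L^2 - 1/4)]

lemma final_unit (d : ℕ) (hd : 1 ≤ d) (A : ℝ) (hA : 0 ≤ A) : ∃ C : ℝ, 0 < C ∧
    ∀ (M Λ α : ℝ) (F F' : ℝ → ℝ) (u : EE d → ℝ), 2 ≤ M → 0 < α → 0 ≤ Λ → Λ ≤ A * M → Good d Λ α F F' u →
    ∫⁻ x in ball (0:EE d) 1, ENNReal.ofReal ‖fderiv ℝ u x‖ ≤ ENNReal.ofReal (C * Real.log M) ∧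
    EN u ≤ ENNReal.ofReal (C * (Real.log M)^2) := by
  obtain ⟨C1, hC1, hg⟩ := grad_step d hd
  obtain ⟨C2, hC2, hE⟩ := EN_bound d hd
  set K := C2 * ((A+1)^2 + 1) with hK
  have hK0 : 0 < K := by positivity
  set D := (d:ℝ)^2 * C1 * (1 + K + C2 * 8) with hD
  have hD0 : 0 ≤ D := by positivity
  refine ⟨(D+4) + (4*K + C2*8*(D+4)), by positivity, fun M Λ α F F' u hM hα hΛ hΛA g => ?_⟩
  set X := loc d (fun x => ENNReal.ofReal ‖fderiv ℝ u x‖) with hX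
  have fd : ∀ y x, fderiv ℝ (fun x => u (x+y)) x = fderiv ℝ u (x+y) := fun y x => fderiv_comp_add_right y
  have XS : ∀ y, loc d (fun x => ENNReal.ofReal ‖fderiv ℝ (fun x => u (x+y)) x‖) ≤ X := fun y => by
    simp_rw [fd]
    exact loc_shift (fun x => ENNReal.ofReal ‖fderiv ℝ u x‖) y
  have ENb : ∀ y ε, 0 < ε → ε ≤ 1 → EN (fun x => u (x+y)) ≤ ENNReal.ofReal (C2 * ((Λ+1)^2 * ε^(1/4:ℝ) + 1)) +
      ENNReal.ofReal (C2 * Real.log (1/ε)) * X := fun y ε h1 h2 =>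
    (hE Λ α F F' _ hΛ (g.shift y) ε h1 h2).trans (add_le_add le_rfl (mul_le_mul_right (XS y) _))
  -- gradient bound from an energy bound
  have GB : ∀ Q : ℝ, 0 ≤ Q → (∀ y, EN (fun x => u (x+y)) ≤ ENNReal.ofReal Q) →
      X ≤ ENNReal.ofReal (d * Real.sqrt (C1 * (1 + Q))) := by
    intro Q hQ hEQ
    refine iSup_le fun y => ?_
    have gs := g.shift y
    have hfc : Continuous (fderiv ℝ (fun x => u (x+y))) := gs.cd.continuous_fderiv (by norm_num)
    have c1 : Continuous (cut (d := d) 1) := cut_cont 1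
    have bs := ball_shift (fun x => ENNReal.ofReal ‖fderiv ℝ u x‖) 0 y 1
    rw [zero_add] at bs
    rw [← bs]
    simp_rw [← fd]
    have each : ∀ i : Fin d, ∫⁻ x, ENNReal.ofReal (cut 1 x * |fderiv ℝ (fun x => u (x+y)) x
        (EuclideanSpace.single i 1)|) ≤ ENNReal.ofReal (Real.sqrt (C1 * (1 + Q))) := fun i => by
      have ii : Integrable (fun x => cut 1 x * |fderiv ℝ (fun x => u (x+y)) x (EuclideanSpace.single i 1)|) :=
        cs_int (by fun_prop) (ρ := 2) fun x hx => by rw [cut_zero (by linarith)]; simp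
      rw [← ofReal_integral_eq_lintegral_ofReal ii (Filter.Eventually.of_forall fun x =>
        mul_nonneg (cut_nonneg _ _) (abs_nonneg _))]
      apply ENNReal.ofReal_le_ofReal
      apply Real.le_sqrt_of_sq_le
      have := hg Λ α F F' _ hα hΛ gs (EuclideanSpace.single i 1) (by simp)
      have h2 := this.trans (mul_le_mul_right (add_le_add le_rfl (hEQ y)) _)
      rw [← ENNReal.ofReal_one, ← ENNReal.ofReal_add zero_le_one hQ, ← ENNReal.ofReal_mul hC1.le] at h2
      exact (ENNReal.ofReal_le_ofReal_iff (by positivity)).1 h2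
    calc _ ≤ ∫⁻ x in ball (0:EE d) 1, ∑ i, ENNReal.ofReal (cut 1 x * |fderiv ℝ (fun x => u (x+y)) x
          (EuclideanSpace.single i 1)|) := by
          refine setLIntegral_mono' measurableSet_ball fun x hx => ?_
          rw [← ENNReal.ofReal_sum_of_nonneg fun i _ => mul_nonneg (cut_nonneg _ _) (abs_nonneg _)]
          apply ENNReal.ofReal_le_ofReal
          refine (opn _).trans (le_of_eq ?_)
          rw [cut_one (by simpa using (le_of_lt (by simpa using hx : ‖x‖ < 1)))]
          simp
      _ ≤ ∫⁻ x, ∑ i, ENNReal.ofReal (cut 1 x * |fderiv ℝ (fun x => u (x+y)) x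
          (EuclideanSpace.single i 1)|) := setLIntegral_le_lintegral _ _
      _ = ∑ i, ∫⁻ x, ENNReal.ofReal (cut 1 x * |fderiv ℝ (fun x => u (x+y)) x
          (EuclideanSpace.single i 1)|) := lintegral_finsetSum _ fun i _ => by fun_prop
      _ ≤ ∑ i : Fin d, ENNReal.ofReal (Real.sqrt (C1 * (1 + Q))) := Finset.sum_le_sum fun i _ => each i
      _ = _ := by
        rw [Finset.sum_const, Finset.card_univ, Fintype.card_fin, nsmul_eq_mul,
          ENNReal.ofReal_mul (by positivity), ENNReal.ofReal_natCast]
  have Xfin : X ≠ ∞ := by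
    refine ne_top_of_le_ne_top ENNReal.ofReal_ne_top (GB (C2 * ((Λ+1)^2 * 1^(1/4:ℝ) + 1)) (by positivity) fun y => ?_)
    have := ENb y 1 one_pos le_rfl
    simpa using this
  set L := Real.log M with hL
  have hL2 : 1/2 ≤ L := by
    have := Real.log_le_log (by norm_num) hM
    have := Real.log_two_gt_d9
    linarith
  have hM0 : 0 < M := by linarith
  set x := X.toReal with hx
  have hx0 : 0 ≤ x := ENNReal.toReal_nonneg
  have hXx : X = ENNReal.ofReal x := (ENNReal.ofReal_toReal Xfin).symm
  have Eb : ∀ y, EN (fun x => u (x+y)) ≤ ENNReal.ofReal (K + C2 * 8 * L * x) := fun y => by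
    refine (ENb y ((M^8)⁻¹) (by positivity) (inv_le_one_of_one_le₀ (one_le_pow₀ (by linarith)))).trans ?_
    have e1 : Real.log (1 / (M^8)⁻¹) = 8 * L := by
      rw [one_div, inv_inv, Real.log_pow]; norm_num [hL]
    have e2 : ((M^8)⁻¹)^(1/4:ℝ) = (M^2)⁻¹ := by
      rw [Real.inv_rpow (by positivity)]
      congr 1
      rw [show M^8 = (M^2)^4 by ring, ← Real.rpow_natCast (M^2) 4, ← Real.rpow_mul (by positivity)]
      norm_num
    rw [e1, e2, hXx, ← ENNReal.ofReal_mul (by positivity), ← ENNReal.ofReal_add (by positivity) (by positivity)]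
    apply ENNReal.ofReal_le_ofReal
    have : (Λ+1)^2 * (M^2)⁻¹ ≤ (A+1)^2 := by
      rw [← div_eq_mul_inv, div_le_iff₀ (by positivity), ← mul_pow]
      gcongr; nlinarith
    have : C2 * ((Λ+1)^2 * (M^2)⁻¹ + 1) ≤ K := by rw [hK]; gcongr
    linarith
  have hxq : x^2 ≤ D * (1 + L * x) := by
    have hQ : 0 ≤ K + C2 * 8 * L * x := by positivity
    have := GB _ hQ Eb
    rw [hXx, ENNReal.ofReal_le_ofReal_iff (by positivity)] at this
    calc x^2 ≤ (d * Real.sqrt (C1 * (1 + (K + C2 * 8 * L * x))))^2 := by gcongr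
      _ = d^2 * C1 * (1 + K + C2 * 8 * (L * x)) := by
        rw [mul_pow, Real.sq_sqrt (by positivity)]; ring
      _ ≤ D * (1 + L * x) := by
        rw [hD, mul_assoc (d^2 * C1 : ℝ)]
        refine mul_le_mul_of_nonneg_left ?_ (by positivity)
        have : 0 ≤ L * x := by positivity
        nlinarith
  have hxL := quad_solve hD0 hL2 hxq
  have r1 : 0 ≤ 4*K + C2*8*(D+4) := by positivity
  constructor
  · refine (le_loc (fun x => ENNReal.ofReal ‖fderiv ℝ u x‖) 0).trans ?_
    rw [← hX, hXx]
    apply ENNReal.ofReal_le_ofReal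
    nlinarith [mul_nonneg r1 (by linarith : 0 ≤ L)]
  · have := Eb 0
    simp only [add_zero] at this
    refine this.trans (ENNReal.ofReal_le_ofReal ?_)
    have q1 : C2 * 8 * L * x ≤ C2 * 8 * L * ((D+4)*L) := by gcongr
    have q2 : K * 1 ≤ K * (4 * L^2) := by gcongr; nlinarith
    have q3 : 0 ≤ (D+4) * L^2 := by positivity
    nlinarith

lemma kap_smul {d : ℕ} {R : ℝ} (hR : 0 < R) (h : EE d) : kap d h = R^(d+1) * kap d (R • h) := by
  unfold kap
  rw [norm_smul, Real.norm_of_nonneg hR.le, mul_pow, mul_inv]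
  have : R^(d+1) ≠ 0 := by positivity
  rw [← mul_assoc, mul_inv_cancel₀ this, one_mul]

lemma kmu_smul_i {d : ℕ} {R : ℝ} (hR : 0 < R) (g : EE d → ℝ) :
    ∫ h, g (R • h) ∂(kmu d) = R * ∫ h, g h ∂(kmu d) := by
  rw [integral_kmu, integral_kmu]
  have : ∀ h : EE d, kap d h * g (R • h) = R^(d+1) * (kap d (R • h) * g (R • h)) := fun h => by
    rw [kap_smul hR h]; ring
  simp_rw [this]
  rw [integral_const_mul, Measure.integral_comp_smul_of_nonneg volume (fun h => kap d h * g h) R (hR := hR.le)]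
  simp only [finrank_euclideanSpace, Fintype.card_fin, smul_eq_mul]
  have : R^d ≠ 0 := by positivity
  rw [pow_succ]; field_simp

lemma l_smul {d : ℕ} {R : ℝ} (hR : 0 < R) {G : EE d → ℝ≥0∞} (hG : Measurable G) :
    ∫⁻ x, G (R • x) = ENNReal.ofReal ((R^d)⁻¹) * ∫⁻ x, G x := by
  have := lintegral_map (μ := (volume : Measure (EE d))) hG (measurable_const_smul R)
  rw [← this, Measure.map_addHaar_smul volume hR.ne', lintegral_smul_measure,
    finrank_euclideanSpace, Fintype.card_fin, abs_of_pos (by positivity), smul_eq_mul]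

lemma l_smul_ball {d : ℕ} {R : ℝ} (hR : 0 < R) {G : EE d → ℝ≥0∞} (hG : Measurable G) :
    ∫⁻ x in ball (0:EE d) 1, G (R • x) = ENNReal.ofReal ((R^d)⁻¹) * ∫⁻ x in ball (0:EE d) R, G x := by
  rw [← lintegral_indicator measurableSet_ball, ← lintegral_indicator measurableSet_ball,
    ← l_smul hR (hG.indicator measurableSet_ball)]
  congr 1; ext x
  have : R • x ∈ ball (0:EE d) R ↔ x ∈ ball (0:EE d) 1 := by
    simp only [mem_ball_zero_iff, norm_smul, Real.norm_of_nonneg hR.le]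
    constructor
    · intro h; nlinarith
    · intro h; nlinarith
  by_cases hx : x ∈ ball (0:EE d) 1
  · rw [indicator_of_mem hx, indicator_of_mem (this.2 hx)]
  · rw [indicator_of_notMem hx, indicator_of_notMem (fun h => hx (this.1 h))]

lemma kmu_smul_l {d : ℕ} {R : ℝ} (hR : 0 < R) {g : EE d → ℝ≥0∞} (hg : Measurable g) :
    ∫⁻ h, g (R • h) ∂(kmu d) = ENNReal.ofReal R * ∫⁻ h, g h ∂(kmu d) := by
  rw [lintegral_kmu, lintegral_kmu]
  have : ∀ h : EE d, ENNReal.ofReal (kap d h) * g (R • h) = ENNReal.ofReal (R^(d+1)) *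
      (ENNReal.ofReal (kap d (R • h)) * g (R • h)) := fun h => by
    rw [kap_smul hR h, ENNReal.ofReal_mul (by positivity), mul_assoc]
  simp_rw [this]
  rw [lintegral_const_mul _ (by fun_prop), l_smul hR (G := fun h => ENNReal.ofReal (kap d h) * g h) (by fun_prop),
    ← mul_assoc, ← ENNReal.ofReal_mul (by positivity)]
  congr 2
  have : R^d ≠ 0 := by positivity
  rw [pow_succ]; field_simp

lemma eta_int {d : ℕ} (hd : 1 ≤ d) {η : EE d → ℝ} (h1 : ContDiff ℝ (⊤ : ℕ∞) η) (h2 : HasCompactSupport η) :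
    Integrable (fun p : EE d × EE d => (η (p.1+p.2) - η p.1)^2) (volume.prod (kmu d)) := by
  have hc : ContDiff ℝ 2 η := h1.of_le (WithTop.coe_le_coe.2 (le_top : (2:ℕ∞) ≤ ⊤))
  obtain ⟨B, hB⟩ := hc.continuous.bounded_above_of_compact_support h2
  obtain ⟨ρ, hρ⟩ := h2.isCompact.isBounded.subset_ball (0 : EE d)
  have hs : ∀ x, ρ ≤ ‖x‖ → η x = 0 := fun x hx => by
    by_contra h
    have := hρ (subset_tsupport η h)
    rw [mem_ball_zero_iff] at this; linarith
  exact (int_dd hd (LL_C2 hc) hc.continuous hB (LL_C2 hc) hc.continuous hB hs).congr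
      (Filter.Eventually.of_forall fun p => (pow_two _).symm)

lemma Good.scale {d : ℕ} (hd : 1 ≤ d) {Λ α : ℝ} {F F' : ℝ → ℝ} {u : EE d → ℝ} (g : Good d Λ α F F' u)
    {R : ℝ} (hR : 0 < R) :
    Good d (R * Λ) α (fun t => R * F t) (fun t => R * F' t) (fun x => u (R • x)) where
  cd := g.cd.comp (by fun_prop)
  bd := fun x => g.bd _
  lip := fun a ha b hb => by
    rw [← mul_sub, abs_mul, abs_of_pos hR, mul_assoc]
    exact mul_le_mul_of_nonneg_left (g.lip a ha b hb) hR.le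
  hol := fun a ha b hb => by
    have : R * F b - R * F a - R * F' a * (b - a) = R * (F b - F a - F' a * (b-a)) := by ring
    rw [this, abs_mul, abs_of_pos hR, mul_assoc R, mul_assoc R]
    exact mul_le_mul_of_nonneg_left (g.hol a ha b hb) hR.le
  cF := continuousOn_const.mul g.cF
  eq := fun x => by
    rw [← g.eq]
    unfold LL2
    rw [← kmu_smul_i hR]
    simp only [smul_add, smul_sub]
  stab := fun η h1 h2 => by
    set ζ : EE d → ℝ := fun y => η (R⁻¹ • y) with hζ
    have e0 : ∀ x, η x = ζ (R • x) := fun x => by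
      simp only [hζ, smul_smul, inv_mul_cancel₀ hR.ne', one_smul]
    have z1 : ContDiff ℝ (⊤ : ℕ∞) ζ := h1.comp (by fun_prop)
    have z2 : HasCompactSupport ζ := h2.comp_smul (inv_ne_zero hR.ne')
    have st := g.stab ζ z1 z2
    rw [integral_prod _ (eta_int hd z1 z2)] at st
    rw [integral_prod _ (eta_int hd h1 h2)]
    have l1 : ∫ x, R * F' (u (R • x)) * (η x)^2 = R * ((R^d)⁻¹ * ∫ x, F' (u x) * (ζ x)^2) := by
      simp_rw [e0, mul_assoc]
      rw [integral_const_mul, Measure.integral_comp_smul_of_nonneg volume (fun x => F' (u x) * (ζ x)^2) R (hR := hR.le)]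
      simp only [finrank_euclideanSpace, Fintype.card_fin, smul_eq_mul]
    have l2 : ∫ x, ∫ h, (η (x+h) - η x)^2 ∂(kmu d) =
        R * ((R^d)⁻¹ * ∫ x, ∫ h, (ζ (x+h) - ζ x)^2 ∂(kmu d)) := by
      simp_rw [e0, smul_add]
      simp_rw [fun x : EE d => kmu_smul_i hR (fun h => (ζ (R • x + h) - ζ (R • x))^2)]
      rw [integral_const_mul, Measure.integral_comp_smul_of_nonneg volume
        (fun x => ∫ h, (ζ (x+h) - ζ x)^2 ∂(kmu d)) R (hR := hR.le)]
      simp only [finrank_euclideanSpace, Fintype.card_fin, smul_eq_mul]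
    rw [l1, l2]
    exact mul_le_mul_of_nonneg_left (mul_le_mul_of_nonneg_left st (by positivity)) hR.le

/-- conclusions for the rescaled solution -/
lemma final_R (d : ℕ) (hd : 1 ≤ d) (A : ℝ) (hA : 0 ≤ A) : ∃ C : ℝ, 0 < C ∧
    ∀ (M Λ α : ℝ) (F F' : ℝ → ℝ) (u : EE d → ℝ), 2 ≤ M → 0 < α → 0 ≤ Λ → Λ ≤ A * M → Good d Λ α F F' u →
    ∀ (x₀ : EE d) (R : ℝ), 1 ≤ R →
    ∫⁻ x in ball x₀ R, ENNReal.ofReal ‖fderiv ℝ u x‖ ≤ ENNReal.ofReal (C * R^((d:ℝ)-1) * Real.log (M*R)) ∧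
    ∫⁻ x in ball x₀ R, ∫⁻ h, ENNReal.ofReal ((u (x+h) - u x)^2) ∂(kmu d) ≤
      ENNReal.ofReal (C * R^((d:ℝ)-1) * (Real.log (M*R))^2) := by
  obtain ⟨C, hC, H⟩ := final_unit d hd A hA
  refine ⟨C, hC, fun M Λ α F F' u hM hα hΛ hΛA g x₀ R hR => ?_⟩
  have hR0 : 0 < R := by linarith
  set w : EE d → ℝ := fun x => u (x+x₀) with hw
  have gw : Good d Λ α F F' w := g.shift x₀
  have wc : Continuous w := gw.cd.continuous
  have gv := gw.scale hd hR0
  obtain ⟨h1, h2⟩ := H (M*R) (R*Λ) α _ _ _ (by nlinarith) hα (by positivity) (by nlinarith) gv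
  have hRd : ENNReal.ofReal (R^((d:ℝ)-1)) * (ENNReal.ofReal R * ENNReal.ofReal ((R^d)⁻¹)) = 1 := by
    rw [← ENNReal.ofReal_mul hR0.le, ← ENNReal.ofReal_mul (by positivity), Real.rpow_sub hR0, Real.rpow_natCast,
      Real.rpow_one]
    have : R^d ≠ 0 := by positivity
    rw [← ENNReal.ofReal_one]; congr 1; field_simp
  have fin : ∀ (X Y : ℝ≥0∞) (Z : ℝ), Y = ENNReal.ofReal R * ENNReal.ofReal ((R^d)⁻¹) * X →
      Y ≤ ENNReal.ofReal (C * Z) → X ≤ ENNReal.ofReal (C * R^((d:ℝ)-1) * Z) := fun X Y Z e l => by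
    calc X = ENNReal.ofReal (R^((d:ℝ)-1)) * Y := by rw [e, ← mul_assoc, hRd, one_mul]
      _ ≤ ENNReal.ofReal (R^((d:ℝ)-1)) * ENNReal.ofReal (C * Z) := by gcongr
      _ = _ := by rw [← ENNReal.ofReal_mul (by positivity)]; congr 1; ring
  constructor
  · refine fin _ _ _ ?_ h1
    have fd : ∀ x, fderiv ℝ (fun x => w (R • x)) x = R • fderiv ℝ w (R • x) := fun x => by
      exact fderiv_comp_smul R
    have fw : ∀ x, fderiv ℝ w x = fderiv ℝ u (x+x₀) := fun x => fderiv_comp_add_right x₀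
    have fm : Measurable (fun x => ENNReal.ofReal ‖fderiv ℝ w x‖) :=
      ((gw.cd.continuous_fderiv (by norm_num)).norm.measurable).ennreal_ofReal
    simp_rw [fd, norm_smul, Real.norm_of_nonneg hR0.le, ENNReal.ofReal_mul hR0.le]
    rw [lintegral_const_mul _ (by exact fm.comp (measurable_const_smul R)),
      l_smul_ball hR0 (G := fun x => ENNReal.ofReal ‖fderiv ℝ w x‖) fm, mul_assoc]
    congr 2
    simp_rw [fw]
    rw [ball_shift (fun x => ENNReal.ofReal ‖fderiv ℝ u x‖), zero_add]
  · refine fin _ (∫⁻ x in ball (0:EE d) 1, ∫⁻ h, ENNReal.ofReal ((w (R • (x+h)) - w (R • x))^2) ∂(kmu d)) _ ?_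
      (le_trans ?_ h2)
    · have e1 : ∀ x : EE d, ∫⁻ h, ENNReal.ofReal ((w (R • (x+h)) - w (R • x))^2) ∂(kmu d) =
          ENNReal.ofReal R * ∫⁻ h, ENNReal.ofReal ((w (R • x+h) - w (R • x))^2) ∂(kmu d) := fun x => by
        simp_rw [smul_add]
        exact kmu_smul_l hR0 (g := fun h => ENNReal.ofReal ((w (R • x+h) - w (R • x))^2)) (by fun_prop)
      have fm : Measurable (fun x => ∫⁻ h, ENNReal.ofReal ((w (x+h) - w x)^2) ∂(kmu d)) :=
        Measurable.lintegral_prod_right' (f := fun p : EE d × EE d => ENNReal.ofReal ((w (p.1+p.2) - w p.1)^2)) (by fun_prop)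
      simp_rw [e1]
      rw [lintegral_const_mul _ (by exact fm.comp (measurable_const_smul R)),
        l_smul_ball hR0 (G := fun x => ∫⁻ h, ENNReal.ofReal ((w (x+h) - w x)^2) ∂(kmu d)) fm, mul_assoc]
      congr 2
      have := ball_shift (fun x => ∫⁻ h, ENNReal.ofReal ((u (x+h) - u x)^2) ∂(kmu d)) 0 x₀ R
      rw [zero_add] at this
      rw [← this]
      simp only [hw]
      congr 1; ext x; congr 1; ext h
      rw [show x + h + x₀ = x + x₀ + h by abel]
    · unfold EN
      exact lintegral_mono_set (ball_subset_ball (by norm_num))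

lemma fracC_pos (d : ℕ) : 0 < fracC d (1/2) := by
  unfold fracC
  have h1 : 0 < Real.Gamma ((d:ℝ)/2 + 1/2) := Real.Gamma_pos_of_pos (by positivity)
  have h2 : Real.Gamma (-(1/2)) ≠ 0 := by
    refine Real.Gamma_ne_zero fun m h => ?_
    have h3 : (1:ℝ) = 2 * m := by linarith
    have h4 : (1:ℕ) = 2 * m := by exact_mod_cast h3
    omega
  have h3 := abs_pos.2 h2
  have := Real.pi_pos
  positivity

lemma rp (d : ℕ) (y : EE d) : ‖y‖ ^ ((d:ℝ) + 2*(1/2)) = ‖y‖ ^ (d+1) := by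
  rw [← Real.rpow_natCast]; congr 1; push_cast; ring

lemma kdiv (d : ℕ) (t : ℝ) (y : EE d) : t / ‖y‖ ^ ((d:ℝ) + 2*(1/2)) = kap d y * t := by
  rw [rp, kap, div_eq_inv_mul]

lemma good0 {d : ℕ} (hd : 1 ≤ d) {α : ℝ} (hα : 0 < α) {M : ℝ} (hM : 0 ≤ M) {f f' : ℝ → ℝ}
    (hf : ∀ x ∈ Set.Icc (-1 : ℝ) 1, HasDerivAt f (f' x) x)
    (hf1 : ∀ x ∈ Set.Icc (-1 : ℝ) 1, |f' x| ≤ M)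
    (hf2 : ∀ x ∈ Set.Icc (-1 : ℝ) 1, ∀ y ∈ Set.Icc (-1 : ℝ) 1, |f' x - f' y| ≤ M * |x - y| ^ α)
    {u : EE d → ℝ} (hu : IsStableSolution d (1/2) f f' u) :
    Good d ((fracC d (1/2) / 2)⁻¹ * M) α (fun t => (fracC d (1/2) / 2)⁻¹ * f t)
      (fun t => (fracC d (1/2) / 2)⁻¹ * f' t) u := by
  obtain ⟨hu1, hu2, hu3, hu4⟩ := hu
  set c := fracC d (1/2) / 2 with hc
  have hc0 : 0 < c := by have := fracC_pos d; positivity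
  have hci : 0 < c⁻¹ := by positivity
  refine ⟨hu1, hu2, fun a ha b hb => ?_, fun a ha b hb => ?_, ?_, fun x => ?_, fun η h1 h2 => ?_⟩
  · rw [← mul_sub, abs_mul, abs_of_pos hci, mul_assoc]
    refine mul_le_mul_of_nonneg_left ?_ hci.le
    exact (convex_Icc (-1:ℝ) 1).norm_image_sub_le_of_norm_hasDerivWithin_le
      (fun x hx => (hf x hx).hasDerivWithinAt) hf1 hb ha
  · have : c⁻¹ * f b - c⁻¹ * f a - c⁻¹ * f' a * (b - a) = c⁻¹ * (f b - f a - f' a * (b-a)) := by ring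
    rw [this, abs_mul, abs_of_pos hci, mul_assoc c⁻¹, mul_assoc c⁻¹]
    refine mul_le_mul_of_nonneg_left ?_ hci.le
    have hsub : uIcc a b ⊆ Icc (-1:ℝ) 1 := uIcc_subset_Icc ha hb
    have key := (convex_uIcc a b).norm_image_sub_le_of_norm_hasDerivWithin_le
      (f := fun x => f x - f' a * x) (f' := fun x => f' x - f' a * 1) (C := M * |b - a|^α)
      (fun x hx => ((hf x (hsub hx)).sub ((hasDerivAt_id x).const_mul (f' a))).hasDerivWithinAt)
      (fun x hx => ?_) left_mem_uIcc right_mem_uIcc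
    · simp only [Real.norm_eq_abs] at key
      refine le_trans (le_of_eq ?_) key
      congr 1; ring
    · rw [mul_one, Real.norm_eq_abs]
      refine (hf2 x (hsub hx) a ha).trans ?_
      refine mul_le_mul_of_nonneg_left ?_ hM
      exact Real.rpow_le_rpow (abs_nonneg _) (abs_sub_left_of_mem_uIcc hx) hα.le
  · refine continuousOn_const.mul fun x hx => ?_
    refine tendsto_iff_dist_tendsto_zero.2 ?_
    have ht : Filter.Tendsto (fun y : ℝ => M * |y - x| ^ α) (nhdsWithin x (Icc (-1:ℝ) 1)) (nhds 0) := by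
      have cc : Continuous (fun y : ℝ => M * |y - x| ^ α) :=
        continuous_const.mul ((continuous_id.sub continuous_const).abs.rpow_const fun _ => Or.inr hα.le)
      have := cc.tendsto x
      simp only [sub_self, abs_zero, Real.zero_rpow hα.ne', mul_zero] at this
      exact this.mono_left nhdsWithin_le_nhds
    refine squeeze_zero' (Filter.Eventually.of_forall fun y => dist_nonneg) ?_ ht
    filter_upwards [self_mem_nhdsWithin] with y hy
    exact hf2 y hy x hx
  · have := hu3 x
    simp_rw [kdiv] at this
    rw [← this, LL2, integral_kmu, inv_mul_cancel_left₀ hc0.ne']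
  · have st := hu4 η h1 h2
    have hi := eta_int hd h1 h2
    have hi2 := conv_int (fun p : EE d × EE d => (η p.2 - η p.1)^2) hi
    have e := conv_i (fun p : EE d × EE d => (η p.2 - η p.1)^2)
    simp only at e
    rw [e, integral_prod _ hi2]
    simp_rw [mul_assoc]
    rw [integral_const_mul, inv_mul_le_iff₀ hc0]
    refine st.trans (le_of_eq ?_)
    congr 1
    refine integral_congr_ae (Filter.Eventually.of_forall fun x => ?_)
    refine integral_congr_ae (Filter.Eventually.of_forall fun y => ?_)
    simp only
    rw [kdiv, ← kap_neg, neg_sub]; ring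

lemma Js_le {d : ℕ} {u : EE d → ℝ} (hu : Continuous u) {Ω : Set (EE d)} (hΩ : MeasurableSet Ω) :
    Js d (1/2) u Ω ≤ ENNReal.ofReal 2 *
      ∫⁻ x in Ω, ∫⁻ h, ENNReal.ofReal ((u (x+h) - u x)^2) ∂(kmu d) := by
  set I := ∫⁻ x in Ω, ∫⁻ h, ENNReal.ofReal ((u (x+h) - u x)^2) ∂(kmu d) with hI
  set Φ : EE d × EE d → ℝ≥0∞ := fun p => ENNReal.ofReal ((u p.2 - u p.1)^2) with hΦ
  have hΦm : Measurable Φ := by fun_prop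
  have hΦs : ∀ p : EE d × EE d, ENNReal.ofReal ((u p.1 - u p.2)^2 / ‖p.1 - p.2‖ ^ ((d : ℝ) + 2*(1/2))) =
      ENNReal.ofReal (kap d (p.2 - p.1)) * Φ p := fun p => by
    rw [kdiv, ENNReal.ofReal_mul (kap_nonneg _ _), ← kap_neg, neg_sub]
    simp only [hΦ]; congr 2; ring
  set S : Set (EE d × EE d) := Ω ×ˢ univ with hS
  set T : Set (EE d × EE d) := univ ×ˢ Ω with hT
  have hSm : MeasurableSet S := hΩ.prod MeasurableSet.univ
  have hTm : MeasurableSet T := MeasurableSet.univ.prod hΩ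
  have hsub : (Ωᶜ ×ˢ Ωᶜ : Set (EE d × EE d))ᶜ ⊆ S ∪ T := by
    intro p hp
    simp only [mem_compl_iff, mem_prod, not_and_or, not_not] at hp
    rcases hp with h | h
    · left; exact ⟨h, trivial⟩
    · right; exact ⟨trivial, h⟩
  have gen : ∀ W : Set (EE d × EE d), MeasurableSet W →
      ∫⁻ p in W, ENNReal.ofReal (kap d (p.2 - p.1)) * Φ p ∂(volume.prod volume) =
      ∫⁻ p, W.indicator Φ (p.1, p.1+p.2) ∂((volume : Measure (EE d)).prod (kmu d)) := fun W hW => by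
    rw [conv_l (hΦm.indicator hW), ← lintegral_indicator hW]
    congr 1; ext p
    by_cases hp : p ∈ W <;> simp [hp]
  have hSI : ∫⁻ p, S.indicator Φ (p.1, p.1+p.2) ∂((volume : Measure (EE d)).prod (kmu d)) = I := by
    have hm : Measurable (fun p : EE d × EE d => S.indicator Φ (p.1, p.1+p.2)) :=
      (hΦm.indicator hSm).comp (by fun_prop)
    rw [lintegral_prod _ hm.aemeasurable, hI, ← lintegral_indicator hΩ]
    congr 1; ext x
    by_cases hx : x ∈ Ω <;> simp [hx, hS, hΦ, indicator]
  have hTI : ∫⁻ p, T.indicator Φ (p.1, p.1+p.2) ∂((volume : Measure (EE d)).prod (kmu d)) = I := by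
    rw [← hSI, ← lsym (G := fun p : EE d × EE d => S.indicator Φ (p.1, p.1+p.2))
      ((hΦm.indicator hSm).comp (by fun_prop))]
    congr 1; ext p
    have e : p.1 + p.2 + -p.2 = p.1 := by abel
    simp only [e]
    by_cases hx : p.1 + p.2 ∈ Ω
    · simp only [hS, hT, hΦ, indicator, mem_prod, hx, mem_univ, true_and, and_true, if_true]
      congr 1; ring
    · simp [hS, hT, indicator, hx]
  unfold Js
  simp_rw [hΦs]
  rw [Measure.volume_eq_prod]
  calc _ ≤ ∫⁻ p in S ∪ T, ENNReal.ofReal (kap d (p.2 - p.1)) * Φ p ∂(volume.prod volume) :=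
        lintegral_mono_set hsub
    _ ≤ _ := lintegral_union_le _ _ _
    _ = I + I := by rw [gen S hSm, gen T hTm, hSI, hTI]
    _ = _ := by rw [ENNReal.ofReal_ofNat, two_mul]

/-- Let `d ≥ 1`, `s = 1/2`, `α > 0`, `f` be `C^{1,α}` with `C^{1,α}` norm
bounded by `M₀ ≥ 2`, and `u` a stable solution of `(−Δ)^{1/2} u = f(u)` in `ℝ^d` with
`|u| ≤ 1`. Then there is `C = C(d,α)`, independent of `f`, such that for every `x₀` and every
`R ≥ 1`: `∫_{B_R(x₀)} |∇u| ≤ C·R^{d−1}·log(M₀R)` and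
`J^{1/2}(u,B_R(x₀)) ≤ C·R^{d−1}·(log(M₀R))²`. -/
theorem stmt15 (d : ℕ) (hd : 1 ≤ d) (α : ℝ) (hα : 0 < α) :
    ∃ C : ℝ, 0 < C ∧ ∀ M₀ : ℝ, 2 ≤ M₀ → ∀ f f' : ℝ → ℝ,
      (∀ x ∈ Set.Icc (-1 : ℝ) 1, HasDerivAt f (f' x) x) →
      (∀ x ∈ Set.Icc (-1 : ℝ) 1, |f x| ≤ M₀) →
      (∀ x ∈ Set.Icc (-1 : ℝ) 1, |f' x| ≤ M₀) →
      (∀ x ∈ Set.Icc (-1 : ℝ) 1, ∀ y ∈ Set.Icc (-1 : ℝ) 1,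
        |f' x - f' y| ≤ M₀ * |x - y| ^ α) →
      ∀ u : EuclideanSpace ℝ (Fin d) → ℝ, IsStableSolution d (1/2) f f' u →
      ∀ x₀ : EuclideanSpace ℝ (Fin d), ∀ R : ℝ, 1 ≤ R →
        (∫ x in ball x₀ R, ‖fderiv ℝ u x‖) ≤ C * R ^ ((d : ℝ) - 1) * Real.log (M₀ * R) ∧
        Js d (1/2) u (ball x₀ R) ≤
          ENNReal.ofReal (C * R ^ ((d : ℝ) - 1) * (Real.log (M₀ * R))^2) := by
  have hcp := fracC_pos d
  obtain ⟨C, hC, H⟩ := final_R d hd (fracC d (1/2) / 2)⁻¹ (by positivity)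
  refine ⟨2*C, by positivity, fun M₀ hM f f' hf _ hf1 hf2 u hu x₀ R hR => ?_⟩
  have g := good0 hd hα (by linarith) hf hf1 hf2 hu
  obtain ⟨h1, h2⟩ := H M₀ _ α _ _ u hM hα (by positivity) le_rfl g x₀ R hR
  have hR0 : 0 < R := by linarith
  have hl : 0 ≤ Real.log (M₀ * R) := Real.log_nonneg (by nlinarith)
  have hp : 0 < R ^ ((d:ℝ) - 1) := by positivity
  have hX : 0 ≤ C * R ^ ((d:ℝ) - 1) * Real.log (M₀ * R) := by positivity
  constructor
  · rw [integral_eq_lintegral_of_nonneg_ae (Filter.Eventually.of_forall fun x => norm_nonneg _)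
      ((g.cd.continuous_fderiv (by norm_num)).norm.aestronglyMeasurable)]
    refine (ENNReal.toReal_le_of_le_ofReal hX h1).trans ?_
    nlinarith
  · refine (Js_le g.cd.continuous measurableSet_ball).trans ?_
    refine (mul_le_mul_right h2 _).trans (le_of_eq ?_)
    rw [← ENNReal.ofReal_mul (by norm_num)]
    congr 1; ring
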